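/- The subgroup Aut*(A_Γ) of Aut(A_Γ) generated by all transvections and all partial conjugations is a normal subgroup of Aut(A_Γ). -/

import Mathlib

/-- The relations of a right-angled Artin group: commutators of adjacent vertices. -/
def raagRels {V : Type*} (G : SimpleGraph V) : Set (FreeGroup V) :=
  {r | ∃ u v : V, G.Adj u v ∧
    r = FreeGroup.of u * FreeGroup.of v * (FreeGroup.of u)⁻¹ * (FreeGroup.of v)⁻¹}

/-- The right-angled Artin group of a simplicial graph `G`. -/
abbrev RAAG {V : Type*} (G : SimpleGraph V) := PresentedGroup (raagRels G)

/-- The generator of `RAAG G` corresponding to a vertex. -/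
def gen {V : Type*} (G : SimpleGraph V) (v : V) : RAAG G := PresentedGroup.of v

/-- The star of a vertex: the vertex together with its neighbours. -/
def star {V : Type*} (G : SimpleGraph V) (v : V) : Set V := insert v (G.neighborSet v)

/-- `a ≤ b` : the link of `a` is contained in the star of `b`. -/
def LkLeSt {V : Type*} (G : SimpleGraph V) (a b : V) : Prop := G.neighborSet a ⊆ star G b

/-- The complement of the star of `v`. -/
def stComp {V : Type*} (G : SimpleGraph V) (v : V) : Set V := (star G v)ᶜ

/-- `C` is (the vertex set of) a connected component of `Γ − st(v)`. -/
def IsCompOf {V : Type*} (G : SimpleGraph V) (v : V) (C : Set V) : Prop :=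
  ∃ c : (G.induce (stComp G v)).ConnectedComponent, C = Subtype.val '' c.supp

/-- `C` is (the vertex set of) a connected component of `Γ`. -/
def IsGraphComp {V : Type*} (G : SimpleGraph V) (C : Set V) : Prop :=
  ∃ c : G.ConnectedComponent, C = c.supp

/-- `φ` is the right transvection `R_{ab} : a ↦ ab`, fixing all other generators. -/
def IsRT {V : Type*} {G : SimpleGraph V} (φ : MulAut (RAAG G)) (a b : V) : Prop :=
  φ (gen G a) = gen G a * gen G b ∧ ∀ w ≠ a, φ (gen G w) = gen G w

/-- `φ` is the left transvection `L_{ab} : a ↦ ba`, fixing all other generators. -/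
def IsLT {V : Type*} {G : SimpleGraph V} (φ : MulAut (RAAG G)) (a b : V) : Prop :=
  φ (gen G a) = gen G b * gen G a ∧ ∀ w ≠ a, φ (gen G w) = gen G w

/-- `φ` is the partial conjugation `P_v^C`, conjugating every vertex of `C` by `v`
and fixing all other generators. -/
def IsPC {V : Type*} {G : SimpleGraph V} (φ : MulAut (RAAG G)) (v : V) (C : Set V) : Prop :=
  (∀ w ∈ C, φ (gen G w) = gen G v * gen G w * (gen G v)⁻¹) ∧
  ∀ w ∉ C, φ (gen G w) = gen G w


/-- `φ` is a transvection (right or left). -/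
def IsTransvection {V : Type*} {G : SimpleGraph V} (φ : MulAut (RAAG G)) : Prop :=
  ∃ a b : V, a ≠ b ∧ LkLeSt G a b ∧ (IsRT φ a b ∨ IsLT φ a b)

/-- `φ` is a partial conjugation. -/
def IsPartialConj {V : Type*} {G : SimpleGraph V} (φ : MulAut (RAAG G)) : Prop :=
  ∃ (v : V) (C : Set V), IsCompOf G v C ∧ IsPC φ v C

set_option autoImplicit false
set_option linter.all false

section
namespace RG

universe u
variable {V : Type u} {G : SimpleGraph V}

/-! ### Basic homomorphism tools -/

def lift {M : Type*} [Group M] (f : V → M)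
    (h : ∀ u v, G.Adj u v → f u * f v = f v * f u) : RAAG G →* M :=
  PresentedGroup.toGroup (f := f) (by
    rintro r ⟨u, v, huv, rfl⟩
    simp only [map_mul, map_inv, FreeGroup.lift_apply_of]
    rw [h u v huv]; group)

@[simp] theorem lift_gen {M : Type*} [Group M] (f : V → M)
    (h : ∀ u v, G.Adj u v → f u * f v = f v * f u) (v : V) : lift (G := G) f h (gen G v) = f v := by
  unfold lift gen
  exact PresentedGroup.toGroup.of _

theorem hom_ext {M : Type*} [Group M] {f g : RAAG G →* M}
    (h : ∀ v, f (gen G v) = g (gen G v)) : f = g :=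
  PresentedGroup.ext h

theorem aut_ext {f g : MulAut (RAAG G)} (h : ∀ v, f (gen G v) = g (gen G v)) : f = g := by
  have : f.toMonoidHom = g.toMonoidHom := hom_ext h
  ext x
  exact DFunLike.congr_fun this x

theorem gen_comm {u v : V} (h : G.Adj u v) : gen G u * gen G v = gen G v * gen G u := by
  have : (PresentedGroup.mk (raagRels G)
    (FreeGroup.of u * FreeGroup.of v * (FreeGroup.of u)⁻¹ * (FreeGroup.of v)⁻¹)) = 1 := by
    rw [PresentedGroup.mk_eq_one_iff]
    exact Subgroup.subset_normalClosure ⟨u, v, h, rfl⟩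
  simp only [map_mul, map_inv] at this
  have h2 : gen G u * gen G v * (gen G u)⁻¹ * (gen G v)⁻¹ = 1 := this
  rw [mul_inv_eq_one, mul_inv_eq_iff_eq_mul] at h2
  exact h2

theorem closure_gen : Subgroup.closure (Set.range (gen G)) = ⊤ :=
  PresentedGroup.closure_range_of _

/-- A letter: a generator or its inverse. -/
def lt (G : SimpleGraph V) (v : V) (b : Bool) : RAAG G := if b then gen G v else (gen G v)⁻¹

@[simp] theorem lt_true (v : V) : lt G v true = gen G v := rfl
@[simp] theorem lt_false (v : V) : lt G v false = (gen G v)⁻¹ := rfl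
@[simp] theorem lt_not (v : V) (b : Bool) : lt G v (!b) = (lt G v b)⁻¹ := by
  cases b <;> simp
theorem lt_inv (v : V) (b : Bool) : (lt G v b)⁻¹ = lt G v (!b) := by simp

theorem lt_comm {u v : V} (h : G.Adj u v) (b c : Bool) :
    lt G u b * lt G v c = lt G v c * lt G u b := by
  have h0 : Commute (gen G u) (gen G v) := gen_comm h
  show Commute _ _
  cases b <;> cases c <;> simp [h0]

theorem ind_left {p : RAAG G → Prop} (one : p 1)
    (step : ∀ v b g, p g → p (lt G v b * g)) (g : RAAG G) : p g := by
  have hg : g ∈ Subgroup.closure (Set.range (gen G)) := by rw [closure_gen]; trivial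
  induction hg using Subgroup.closure_induction_left with
  | one => exact one
  | mul_left x hx y _ ih =>
    obtain ⟨v, rfl⟩ := hx
    exact step v true y ih
  | inv_mul_cancel x hx y _ ih =>
    obtain ⟨v, rfl⟩ := hx
    exact step v false y ih

theorem ind_right {p : RAAG G → Prop} (one : p 1)
    (step : ∀ v b g, p g → p (g * lt G v b)) (g : RAAG G) : p g := by
  have := ind_left (G := G) (p := fun g => p g⁻¹) (by simpa using one)
    (fun v b g h => by
      have := step v (!b) g⁻¹ h
      simpa [mul_inv_rev] using this) g⁻¹
  simpa using this

/-! ### Pilings -/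

abbrev PS (V : Type u) := V → List (Option Bool)

open Classical in
noncomputable def push (G : SimpleGraph V) (v : V) (b : Bool) (σ : PS V) : PS V :=
  fun w => if w = v then some b :: σ w else if G.Adj v w then σ w else none :: σ w

open Classical in
noncomputable def pop (G : SimpleGraph V) (v : V) (σ : PS V) : PS V :=
  fun w => if G.Adj v w then σ w else (σ w).tail

inductive Pil (G : SimpleGraph V) : PS V → Prop
  | nil : Pil G (fun _ => [])
  | push (v : V) (b : Bool) (σ : PS V) : Pil G σ → (σ v).head? ≠ some (some !b) →
      Pil G (push G v b σ)

theorem push_self (v : V) (b : Bool) (σ : PS V) : push G v b σ v = some b :: σ v := by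
  simp [push]
theorem push_adj {v w : V} (h : G.Adj v w) (b : Bool) (σ : PS V) : push G v b σ w = σ w := by
  have : w ≠ v := h.ne'
  simp [push, this, h]
theorem push_nadj {v w : V} (hn : w ≠ v) (h : ¬ G.Adj v w) (b : Bool) (σ : PS V) :
    push G v b σ w = none :: σ w := by
  simp [push, hn, h]
theorem pop_adj {v w : V} (h : G.Adj v w) (σ : PS V) : pop G v σ w = σ w := by
  simp [pop, h]

theorem pop_push (v : V) (b : Bool) (σ : PS V) : pop G v (push G v b σ) = σ := by
  funext w
  by_cases hw : w = v
  · subst hw; simp [pop, push]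
  · by_cases h : G.Adj v w
    · simp [pop, push, h, hw]
    · simp [pop, push, h, hw]

theorem push_comm {v w : V} (h : G.Adj v w) (b c : Bool) (σ : PS V) :
    push G v b (push G w c σ) = push G w c (push G v b σ) := by
  funext x
  have hvw := h.ne
  have h' := h.symm
  by_cases h1 : x = v
  · subst h1
    simp [push, hvw, h']
  · by_cases h2 : x = w
    · subst h2; simp [push, h1, h]
    · by_cases h3 : G.Adj v x <;> by_cases h4 : G.Adj w x <;> simp [push, h1, h2, h3, h4]

theorem Pil.decomp {σ : PS V} (hσ : Pil G σ) : ∀ (v : V) (b : Bool),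
    (σ v).head? = some (some b) →
    ∃ τ, Pil G τ ∧ (τ v).head? ≠ some (some !b) ∧ σ = RG.push G v b τ := by
  induction hσ with
  | nil => intro v b h; simp at h
  | push w c τ hτ hc ih =>
    intro v b h
    by_cases hv : v = w
    · subst hv
      rw [push_self] at h
      simp at h
      subst h
      exact ⟨τ, hτ, hc, rfl⟩
    · by_cases ha : G.Adj w v
      · rw [push_adj ha] at h
        obtain ⟨τ', h1, h2, h3⟩ := ih v b h
        refine ⟨RG.push G w c τ', Pil.push w c τ' h1 ?_, ?_, ?_⟩
        · rw [h3, push_adj ha.symm] at hc; exact hc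
        · rw [push_adj ha]; exact h2
        · rw [h3, push_comm ha]
      · rw [push_nadj hv ha] at h
        simp at h

open Classical in
noncomputable def act (G : SimpleGraph V) (v : V) (b : Bool) (σ : PS V) : PS V :=
  if (σ v).head? = some (some !b) then pop G v σ else push G v b σ

theorem act_pos {v : V} {b : Bool} {σ : PS V} (h : (σ v).head? ≠ some (some !b)) :
    act G v b σ = push G v b σ := by simp [act, h]
theorem act_push (v : V) (b : Bool) (σ : PS V) :
    act G v (!b) (push G v b σ) = σ := by simp [act, push_self, pop_push]
theorem act_push' (v : V) (b : Bool) (σ : PS V) :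
    act G v b (push G v (!b) σ) = σ := by
  have := act_push (G := G) v (!b) σ
  simpa using this

theorem act_pil {σ : PS V} (hσ : Pil G σ) (v : V) (b : Bool) : Pil G (act G v b σ) := by
  by_cases h : (σ v).head? = some (some !b)
  · obtain ⟨τ, h1, h2, rfl⟩ := hσ.decomp v _ h
    rw [act_push']; exact h1
  · rw [act_pos h]; exact Pil.push v b σ hσ h

theorem act_inv {σ : PS V} (hσ : Pil G σ) (v : V) (b : Bool) :
    act G v (!b) (act G v b σ) = σ := by
  by_cases h : (σ v).head? = some (some !b)
  · obtain ⟨τ, h1, h2, rfl⟩ := hσ.decomp v _ h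
    rw [act_push', act_pos h2]
  · rw [act_pos h, act_push]

theorem act_adj {v w : V} (h : G.Adj v w) (b : Bool) (σ : PS V) : act G v b σ w = σ w := by
  unfold act
  split_ifs
  · exact pop_adj h σ
  · exact push_adj h b σ

theorem act_comm {v w : V} (h : G.Adj v w) (b c : Bool) {σ : PS V} (hσ : Pil G σ) :
    act G v b (act G w c σ) = act G w c (act G v b σ) := by
  by_cases h1 : (σ v).head? = some (some !b)
  · obtain ⟨τ, t1, t2, rfl⟩ := hσ.decomp v _ h1
    rw [act_push']
    by_cases h2 : (τ w).head? = some (some !c)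
    · obtain ⟨τ', t3, t4, rfl⟩ := t1.decomp w _ h2
      rw [act_push', push_comm h, act_push', act_push']
    · rw [act_pos h2, act_pos (v := w) (by rw [push_adj h]; exact h2), push_comm h.symm, act_push']
  · by_cases h2 : (σ w).head? = some (some !c)
    · obtain ⟨τ', t3, t4, rfl⟩ := hσ.decomp w _ h2
      rw [act_push', act_pos h1, push_comm h, act_push']
      rw [push_adj h.symm] at h1
      rw [act_pos h1]
    · rw [act_pos h1, act_pos h2, act_pos (by rw [push_adj h.symm]; exact h1),
        act_pos (by rw [push_adj h]; exact h2), push_comm h]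

noncomputable def actPerm (G : SimpleGraph V) (v : V) : Equiv.Perm {σ : PS V // Pil G σ} where
  toFun σ := ⟨act G v true σ.1, act_pil σ.2 v true⟩
  invFun σ := ⟨act G v false σ.1, act_pil σ.2 v false⟩
  left_inv σ := Subtype.ext (act_inv σ.2 v true)
  right_inv σ := Subtype.ext (act_inv σ.2 v false)

noncomputable def rep (G : SimpleGraph V) : RAAG G →* Equiv.Perm {σ : PS V // Pil G σ} :=
  lift (actPerm G) (by
    intro u v h
    ext1 σ
    exact Subtype.ext (act_comm h true true σ.2))

theorem rep_lt (v : V) (b : Bool) (σ : {σ : PS V // Pil G σ}) :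
    (rep G (lt G v b) σ).1 = act G v b σ.1 := by
  cases b
  · simp [rep, lift_gen]; rfl
  · simp [rep, lift_gen]; rfl

noncomputable def st (g : RAAG G) : PS V := (rep G g ⟨_, Pil.nil⟩).1

theorem st_pil (g : RAAG G) : Pil G (st g) := (rep G g ⟨_, Pil.nil⟩).2

theorem st_mul (v : V) (b : Bool) (g : RAAG G) : st (lt G v b * g) = act G v b (st g) := by
  unfold st
  rw [map_mul, Equiv.Perm.mul_apply, rep_lt]

theorem st_one : st (1 : RAAG G) = fun _ => [] := by simp [st]

/-- The basic half-space: elements having `v^b` as a possible first letter. -/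
def H (G : SimpleGraph V) (v : V) (b : Bool) : Set (RAAG G) :=
  {g | (st g v).head? = some (some b)}

theorem mem_H {v : V} {b : Bool} {g : RAAG G} : g ∈ H G v b ↔ (st g v).head? = some (some b) :=
  Iff.rfl

theorem one_notMem (v : V) (b : Bool) : (1 : RAAG G) ∉ H G v b := by
  simp [mem_H, st_one]

theorem H_not {v : V} {b : Bool} {g : RAAG G} (h : g ∈ H G v b) : g ∉ H G v (!b) := by
  rw [mem_H] at *
  rw [h]; simp

theorem H_sign {v : V} {b c : Bool} {g : RAAG G} (h : g ∈ H G v b) (h' : g ∈ H G v c) : b = c := by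
  rw [mem_H] at *
  rw [h] at h'; simpa using h'

theorem H_nadj {v w : V} (hne : v ≠ w) (ha : ¬ G.Adj v w) {b c : Bool} {g : RAAG G}
    (h : g ∈ H G v b) : g ∉ H G w c := by
  rw [mem_H] at *
  obtain ⟨τ, h1, h2, h3⟩ := (st_pil g).decomp v b h
  rw [h3, push_nadj hne.symm ha]
  simp

theorem H_adj {v w : V} (ha : G.Adj v w) {b c : Bool} {g : RAAG G} :
    lt G w c * g ∈ H G v b ↔ g ∈ H G v b := by
  rw [mem_H, mem_H, st_mul, act_adj ha.symm]

theorem H_flip {v : V} {b : Bool} {g : RAAG G} : lt G v b * g ∈ H G v b ↔ g ∉ H G v (!b) := by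
  rw [mem_H, mem_H, st_mul]
  constructor
  · intro h h'
    obtain ⟨τ, h1, h2, h3⟩ := (st_pil g).decomp v _ h'
    rw [h3, act_push'] at h
    simp at h2
    exact h2 h
  · intro h
    rw [act_pos h, push_self]; rfl

theorem H_flip' {v : V} {b : Bool} {g : RAAG G} :
    (lt G v b)⁻¹ * g ∈ H G v (!b) ↔ g ∉ H G v b := by
  have := H_flip (G := G) (v := v) (b := !b) (g := g)
  simpa using this

/-! ### Length -/
section Len
variable [Finite V]

noncomputable def cnt (σ : PS V) : ℕ :=
  ∑ᶠ v, (σ v).countP Option.isSome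

theorem cnt_push (v : V) (b : Bool) (σ : PS V) : cnt (push G v b σ) = cnt σ + 1 := by
  classical
  haveI := Fintype.ofFinite V
  unfold cnt
  rw [finsum_eq_sum_of_fintype, finsum_eq_sum_of_fintype]
  have : ∀ w, (push G v b σ w).countP Option.isSome
      = (σ w).countP Option.isSome + if w = v then 1 else 0 := by
    intro w
    by_cases hw : w = v
    · subst hw; simp [push]
    · by_cases h : G.Adj v w <;> simp [push, hw, h]
  simp [this, Finset.sum_add_distrib]

noncomputable def len (g : RAAG G) : ℕ := cnt (st g)

theorem len_one : len (1 : RAAG G) = 0 := by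
  simp [len, st_one, cnt]

theorem len_push {v : V} {b : Bool} {g : RAAG G} (h : g ∉ H G v (!b)) :
    len (lt G v b * g) = len g + 1 := by
  unfold len
  rw [st_mul, act_pos h, cnt_push]

theorem len_pop {v : V} {b : Bool} {g : RAAG G} (h : g ∈ H G v b) :
    len ((lt G v b)⁻¹ * g) + 1 = len g := by
  have h2 : (lt G v b)⁻¹ * g ∉ H G v (!b) := by
    rw [H_flip']; simpa using h
  have := len_push h2
  rw [mul_inv_cancel_left] at this
  exact this.symm

end Len

/-! ### Reduced induction -/

inductive Red (G : SimpleGraph V) : RAAG G → Prop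
  | one : Red G 1
  | cons (v b g) : g ∉ H G v (!b) → Red G g → Red G (lt G v b * g)

theorem Red.pop {g : RAAG G} (hg : Red G g) : ∀ v b, g ∈ H G v b → Red G ((lt G v b)⁻¹ * g) := by
  induction hg with
  | one => intro v b h; exact absurd h (one_notMem v b)
  | cons w c g hc hg ih =>
    intro v b h
    by_cases hv : v = w
    · subst hv
      have h1 : lt G v c * g ∈ H G v c := H_flip.2 hc
      have := H_sign h h1
      subst this
      simpa using hg
    · by_cases ha : G.Adj v w
      · have h1 := (H_adj ha).1 h
        have h2 := ih v b h1
        have e : (lt G v b)⁻¹ * (lt G w c * g) = lt G w c * ((lt G v b)⁻¹ * g) := by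
          rw [← mul_assoc, lt_inv, lt_comm ha, mul_assoc]
        rw [e]
        refine Red.cons w c _ ?_ h2
        rw [lt_inv, H_adj ha.symm]
        exact hc
      · have h1 : lt G w c * g ∈ H G w c := H_flip.2 hc
        exact absurd h1 (H_nadj hv ha h)

theorem red_all (g : RAAG G) : Red G g := by
  induction g using ind_left with
  | one => exact Red.one
  | step v b g ih =>
    by_cases h : g ∈ H G v (!b)
    · have := ih.pop v (!b) h
      simpa using this
    · exact Red.cons v b g h ih

theorem ind_red {p : RAAG G → Prop} (one : p 1)
    (step : ∀ v b g, g ∉ H G v (!b) → p g → p (lt G v b * g)) (g : RAAG G) : p g := by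
  induction red_all g with
  | one => exact one
  | cons v b g h _ ih => exact step v b g h ih

theorem exists_first {g : RAAG G} (h : g ≠ 1) : ∃ v b, g ∈ H G v b := by
  cases red_all g with
  | one => exact absurd rfl h
  | cons v b g h' _ => exact ⟨v, b, H_flip.2 h'⟩

end RG

end

section
namespace RG
open scoped Pointwise
universe u
variable {V : Type u} {G : SimpleGraph V}

/-! ### Special subgroups -/

def par (G : SimpleGraph V) (S : Set V) : Subgroup (RAAG G) := Subgroup.closure (gen G '' S)

theorem gen_mem {S : Set V} {v : V} (h : v ∈ S) : gen G v ∈ par G S :=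
  Subgroup.subset_closure ⟨v, h, rfl⟩

theorem lt_mem {S : Set V} {v : V} (h : v ∈ S) (b : Bool) : lt G v b ∈ par G S := by
  cases b
  · exact inv_mem (gen_mem h)
  · exact gen_mem h

theorem par_mono {S T : Set V} (h : S ⊆ T) : par G S ≤ par G T :=
  Subgroup.closure_mono (Set.image_mono h)

theorem par_univ : par G Set.univ = ⊤ := by
  rw [par, Set.image_univ, closure_gen]

theorem par_empty : par G ∅ = ⊥ := by
  simp [par]

theorem par_ind {S : Set V} {p : RAAG G → Prop} (one : p 1)
    (step : ∀ v ∈ S, ∀ b g, g ∈ par G S → p g → p (lt G v b * g)) {g : RAAG G}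
    (hg : g ∈ par G S) : p g := by
  induction hg using Subgroup.closure_induction_left with
  | one => exact one
  | mul_left x hx y hy ih =>
    obtain ⟨v, hv, rfl⟩ := hx
    exact step v hv true y hy ih
  | inv_mul_cancel x hx y hy ih =>
    obtain ⟨v, hv, rfl⟩ := hx
    exact step v hv false y hy ih

inductive RP (G : SimpleGraph V) (S : Set V) : RAAG G → Prop
  | one : RP G S 1
  | cons (v b g) : v ∈ S → g ∉ H G v (!b) → RP G S g → RP G S (lt G v b * g)

theorem RP.pop {S : Set V} {g : RAAG G} (hg : RP G S g) :
    ∀ v b, g ∈ H G v b → v ∈ S ∧ RP G S ((lt G v b)⁻¹ * g) := by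
  induction hg with
  | one => intro v b h; exact absurd h (one_notMem v b)
  | cons w c g hw hc hg ih =>
    intro v b h
    by_cases hv : v = w
    · subst hv
      have h1 : lt G v c * g ∈ H G v c := H_flip.2 hc
      have := H_sign h h1
      subst this
      exact ⟨hw, by simpa using hg⟩
    · by_cases ha : G.Adj v w
      · have h1 := (H_adj ha).1 h
        obtain ⟨h0, h2⟩ := ih v b h1
        have e : (lt G v b)⁻¹ * (lt G w c * g) = lt G w c * ((lt G v b)⁻¹ * g) := by
          rw [← mul_assoc, lt_inv, lt_comm ha, mul_assoc]
        rw [e]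
        refine ⟨h0, RP.cons w c _ hw ?_ h2⟩
        rw [lt_inv, H_adj ha.symm]
        exact hc
      · have h1 : lt G w c * g ∈ H G w c := H_flip.2 hc
        exact absurd h1 (H_nadj hv ha h)

theorem RP.mem {S : Set V} {g : RAAG G} (hg : RP G S g) : g ∈ par G S := by
  induction hg with
  | one => exact one_mem _
  | cons v b g hv _ _ ih => exact mul_mem (lt_mem hv b) ih

theorem RP.of_mem {S : Set V} {g : RAAG G} (hg : g ∈ par G S) : RP G S g := by
  refine par_ind (p := RP G S) RP.one ?_ hg
  intro v hv b g _ ih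
  by_cases h : g ∈ H G v (!b)
  · have := (ih.pop v (!b) h).2
    simpa using this
  · exact RP.cons v b g hv h ih

theorem par_H {S : Set V} {g : RAAG G} (hg : g ∈ par G S) {v : V} {b : Bool} (h : g ∈ H G v b) :
    v ∈ S := ((RP.of_mem hg).pop v b h).1

theorem par_ind_red {S : Set V} {p : RAAG G → Prop} (one : p 1)
    (step : ∀ v ∈ S, ∀ b g, g ∉ H G v (!b) → g ∈ par G S → p g → p (lt G v b * g)) {g : RAAG G}
    (hg : g ∈ par G S) : p g := by
  induction RP.of_mem hg with
  | one => exact one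
  | cons v b g hv h hg' ih => exact step v hv b g h hg'.mem (ih hg'.mem)

abbrev lk (G : SimpleGraph V) (v : V) : Set V := G.neighborSet v

theorem par_lk_comm {v : V} {g : RAAG G} (hg : g ∈ par G (lk G v)) (b : Bool) :
    g * lt G v b = lt G v b * g := by
  refine par_ind (p := fun g => g * lt G v b = lt G v b * g) (by simp) ?_ hg
  intro w hw c g _ ih
  have hw' : G.Adj v w := hw
  rw [mul_assoc, ih, ← mul_assoc, ← mul_assoc, lt_comm hw']

theorem H_par_lk {v : V} {g : RAAG G} (hg : g ∈ par G (lk G v)) (b : Bool) (x : RAAG G) :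
    g * x ∈ H G v b ↔ x ∈ H G v b := by
  refine par_ind (p := fun g => g * x ∈ H G v b ↔ x ∈ H G v b) (by simp) ?_ hg
  intro w hw c g _ ih
  have hw' : G.Adj v w := hw
  rw [mul_assoc, H_adj hw', ih]

/-- An edge crossing into a half-space. -/
theorem cross_in (m : RAAG G) : ∀ (v : V) (b : Bool) (w : V) (c : Bool), m ∉ H G v b →
    m * lt G w c ∈ H G v b → w = v ∧ c = b ∧ m ∈ par G (lk G v) := by
  induction m using ind_red with
  | one =>
    intro v b w c _ h
    rw [one_mul] at h
    have h1 : lt G w c ∈ H G w c := by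
      have := (H_flip (G := G) (v := w) (b := c) (g := 1)).2 (one_notMem _ _)
      simpa using this
    by_cases hv : v = w
    · subst hv; exact ⟨rfl, H_sign h1 h, one_mem _⟩
    · by_cases ha : G.Adj v w
      · have := (H_adj (G := G) ha (b := b) (c := c) (g := 1)).1 (by simpa using h)
        exact absurd this (one_notMem _ _)
      · exact absurd h1 (H_nadj hv ha h)
  | step u d m hd ih =>
    intro v b w c h1 h2
    rw [mul_assoc] at h2
    have hmu : lt G u d * m ∈ H G u d := H_flip.2 hd
    by_cases hv : v = u
    · subst hv
      have hdb : d = !b := by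
        by_contra hne
        have : d = b := by cases d <;> cases b <;> simp_all
        subst this; exact h1 hmu
      subst hdb
      exfalso
      rw [Bool.not_not] at hd
      have h3 : m * lt G w c ∈ H G v b := by
        by_contra h4
        have := (H_flip (G := G) (v := v) (b := !b) (g := m * lt G w c)).2 (by simpa using h4)
        exact H_not h2 this
      obtain ⟨rfl, rfl, h5⟩ := ih v b w c hd h3
      rw [par_lk_comm h5, lt_not, inv_mul_cancel_left] at h2
      exact hd h2
    · by_cases ha : G.Adj v u
      · rw [H_adj ha] at h1 h2
        obtain ⟨rfl, rfl, h5⟩ := ih v b w c h1 h2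
        exact ⟨rfl, rfl, mul_mem (lt_mem ha d) h5⟩
      · exfalso
        have h3 : lt G u d * (m * lt G w c) ∉ H G u d := H_nadj hv ha h2
        rw [H_flip, not_not] at h3
        obtain ⟨rfl, rfl, h5⟩ := ih u (!d) w c hd h3
        rw [par_lk_comm h5, lt_not, mul_inv_cancel_left] at h2
        exact ha (par_H h5 h2).symm

theorem cross_out {m : RAAG G} {v : V} {b : Bool} {w : V} {c : Bool} (h1 : m ∈ H G v b)
    (h2 : m * lt G w c ∉ H G v b) : w = v ∧ c = (!b) ∧ m * lt G w c ∈ par G (lk G v) := by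
  obtain ⟨rfl, h3, h4⟩ := cross_in (m * lt G w c) v b w (!c) h2 (by simpa using h1)
  refine ⟨rfl, by rw [← h3]; simp, h4⟩

def NoCross (v : V) (g : RAAG G) : Prop := ∀ h b, h ∈ H G v b ↔ h * g ∈ H G v b

theorem NoCross.mul {v : V} {g h : RAAG G} (hg : NoCross v g) (hh : NoCross v h) :
    NoCross v (g * h) := by
  intro x b
  rw [hg x b, hh (x * g) b, mul_assoc]

theorem NoCross.inv {v : V} {g : RAAG G} (hg : NoCross v g) : NoCross v g⁻¹ := by
  intro x b
  have := hg (x * g⁻¹) b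
  simpa using this.symm

theorem noCross_lt {v w : V} (h : w ≠ v) (c : Bool) : NoCross v (lt G w c) := by
  intro x b
  constructor
  · intro hx; by_contra h2
    exact h (cross_out hx h2).1
  · intro hx; by_contra h2
    exact h (cross_in _ _ _ _ _ h2 hx).1

theorem noCross_par {v : V} {S : Set V} (h : v ∉ S) {g : RAAG G} (hg : g ∈ par G S) :
    NoCross v g := by
  refine par_ind (p := NoCross v) (by intro x b; simp) ?_ hg
  intro w hw b g _ ih
  exact (noCross_lt (G := G) (fun e : w = v => h (e ▸ hw)) b).mul ih

theorem mem_par_of_noCross {S : Set V} (g : RAAG G) : (∀ v ∉ S, NoCross v g) → g ∈ par G S := by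
  induction g using ind_red with
  | one => intro _; exact one_mem _
  | step u d g hd ih =>
    intro h
    have hu : u ∈ S := by
      by_contra hu
      have := (h u hu 1 d).2 (by rw [one_mul]; exact H_flip.2 hd)
      exact one_notMem _ _ this
    refine mul_mem (lt_mem hu d) (ih ?_)
    intro v hv
    have h1 := (noCross_lt (G := G) (v := v) (w := u) (fun e => hv (e ▸ hu)) d).inv.mul (h v hv)
    simpa using h1

theorem mem_par_iff {S : Set V} {g : RAAG G} : g ∈ par G S ↔ ∀ v ∉ S, NoCross v g :=
  ⟨fun h _ hv => noCross_par hv h, mem_par_of_noCross g⟩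

theorem par_inter {S T : Set V} {g : RAAG G} (h1 : g ∈ par G S) (h2 : g ∈ par G T) :
    g ∈ par G (S ∩ T) := by
  rw [mem_par_iff] at *
  intro v hv
  by_cases h : v ∈ S
  · exact h2 v (fun h' => hv ⟨h, h'⟩)
  · exact h1 v h

theorem gen_ne_one (v : V) : gen G v ≠ 1 := by
  intro h
  have := (H_flip (G := G) (v := v) (b := true) (g := 1)).2 (one_notMem _ _)
  rw [mul_one, lt_true, h] at this
  exact one_notMem _ _ this

theorem lt_self_mem (v : V) (b : Bool) : lt G v b ∈ H G v b := by
  have := (H_flip (G := G) (v := v) (b := b) (g := 1)).2 (one_notMem _ _)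
  simpa using this

theorem gen_mem_par_iff {S : Set V} {v : V} : gen G v ∈ par G S ↔ v ∈ S :=
  ⟨fun h => par_H (b := true) h (lt_self_mem v true), gen_mem⟩

/-! ### Retractions -/
open Classical in
noncomputable def ret (G : SimpleGraph V) (S : Set V) : RAAG G →* RAAG G :=
  lift (fun v => if v ∈ S then gen G v else 1) (by
    intro u v h
    by_cases h1 : u ∈ S <;> by_cases h2 : v ∈ S <;> simp [h1, h2, gen_comm h])

theorem ret_gen {S : Set V} {v : V} (h : v ∈ S) : ret G S (gen G v) = gen G v := by
  simp [ret, h]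
theorem ret_gen' {S : Set V} {v : V} (h : v ∉ S) : ret G S (gen G v) = 1 := by
  simp [ret, h]
theorem ret_mem (S : Set V) (g : RAAG G) : ret G S g ∈ par G S := by
  induction g using ind_left with
  | one => simp
  | step v b g ih =>
    rw [map_mul]
    refine mul_mem ?_ ih
    by_cases h : v ∈ S
    · cases b
      · simp [ret_gen h, gen_mem h]
      · simp [ret_gen h, gen_mem h]
    · cases b <;> simp [ret_gen' h]
theorem ret_of_mem {S : Set V} {g : RAAG G} (h : g ∈ par G S) : ret G S g = g := by
  refine par_ind (p := fun g => ret G S g = g) (by simp) ?_ h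
  intro v hv b g _ ih
  rw [map_mul, ih]
  cases b <;> simp [ret_gen hv]

/-! ### Length -/
section Len
variable [Finite V]

theorem len_lt_mul_le (v : V) (b : Bool) (g : RAAG G) : len (lt G v b * g) ≤ len g + 1 := by
  by_cases h : g ∈ H G v (!b)
  · have := len_pop h
    simp at this
    omega
  · exact (len_push h).le

theorem len_mul_le (g h : RAAG G) : len (g * h) ≤ len g + len h := by
  induction g using ind_red with
  | one => simp
  | step v b g hd ih =>
    rw [len_push hd, mul_assoc]
    have := len_lt_mul_le v b (g * h)
    omega

theorem len_lt (v : V) (b : Bool) : len (lt G v b) = 1 := by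
  have := len_push (G := G) (one_notMem v (!b))
  simpa [len_one] using this

theorem len_inv_le (g : RAAG G) : len g⁻¹ ≤ len g := by
  induction g using ind_red with
  | one => simp
  | step v b g hd ih =>
    rw [len_push hd, mul_inv_rev, lt_inv]
    have := len_mul_le g⁻¹ (lt G v (!b))
    rw [len_lt] at this
    omega

theorem len_inv (g : RAAG G) : len g⁻¹ = len g :=
  le_antisymm (len_inv_le g) (by simpa using len_inv_le g⁻¹)

theorem len_eq_zero {g : RAAG G} : len g = 0 ↔ g = 1 := by
  constructor
  · intro h
    by_contra hne
    obtain ⟨v, b, hv⟩ := exists_first hne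
    have := len_pop hv
    omega
  · rintro rfl; exact len_one

/-- reduced induction from the right -/
theorem exists_last {g : RAAG G} (h : g ≠ 1) : ∃ v b y, g = y * lt G v b ∧ len g = len y + 1 := by
  obtain ⟨v, b, hv⟩ := exists_first (inv_ne_one.2 h)
  have := len_pop hv
  refine ⟨v, !b, g * lt G v b, by simp, ?_⟩
  rw [← len_inv g, ← this, ← len_inv (g * lt G v b), mul_inv_rev]

theorem len_cross {m : RAAG G} {v : V} {b : Bool} {w : V} {c : Bool} (h1 : m ∈ H G v b)
    (h2 : m * lt G w c ∉ H G v b) : len m = len (m * lt G w c) + 1 := by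
  obtain ⟨rfl, rfl, h3⟩ := cross_out h1 h2
  have h4 := len_pop h1
  have h5 : (lt G w b)⁻¹ * m = m * lt G w (!b) := by
    have := par_lk_comm h3 b
    rw [lt_not] at this ⊢
    rw [inv_mul_cancel_right] at this
    nth_rewrite 1 [this]
    rw [inv_mul_cancel_left]
  rw [h5] at h4
  exact h4.symm

end Len

/-! ### Half-spaces -/

def IsHS (v : V) (E : Set (RAAG G)) : Prop := ∃ (g : RAAG G) (b : Bool), E = g • H G v b

theorem mem_hs {g x : RAAG G} {v : V} {b : Bool} : x ∈ g • H G v b ↔ g⁻¹ * x ∈ H G v b := by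
  rw [Set.mem_smul_set_iff_inv_smul_mem, smul_eq_mul]

theorem mem_sm {g x : RAAG G} {E : Set (RAAG G)} : x ∈ g • E ↔ g⁻¹ * x ∈ E := by
  rw [Set.mem_smul_set_iff_inv_smul_mem, smul_eq_mul]

theorem isHS_H (v : V) (b : Bool) : IsHS v (H G v b) := ⟨1, b, by simp⟩

theorem IsHS.smul {v : V} {E : Set (RAAG G)} (h : IsHS v E) (g : RAAG G) : IsHS v (g • E) := by
  obtain ⟨k, b, rfl⟩ := h
  exact ⟨g * k, b, by rw [smul_smul]⟩

theorem H_compl (v : V) (b : Bool) : (H G v b)ᶜ = lt G v b • H G v (!b) := by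
  ext x
  rw [mem_hs, Set.mem_compl_iff, H_flip']

theorem hs_compl (g : RAAG G) (v : V) (b : Bool) :
    (g • H G v b)ᶜ = (g * lt G v b) • H G v (!b) := by
  rw [← Set.smul_set_compl, H_compl, smul_smul]

theorem IsHS.compl {v : V} {E : Set (RAAG G)} (h : IsHS v E) : IsHS v Eᶜ := by
  obtain ⟨k, b, rfl⟩ := h
  exact ⟨_, _, hs_compl k v b⟩

theorem smul_H_of_par {v : V} {g : RAAG G} (hg : g ∈ par G (lk G v)) (b : Bool) :
    g • H G v b = H G v b := by
  ext x
  rw [mem_hs, H_par_lk (inv_mem hg)]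

theorem hs_cross {g : RAAG G} {v : V} {b : Bool} {x : RAAG G} {w : V} {c : Bool}
    (h1 : x ∉ g • H G v b) (h2 : x * lt G w c ∈ g • H G v b) :
    w = v ∧ c = b ∧ g⁻¹ * x ∈ par G (lk G v) ∧ g • H G v b = x • H G v b := by
  rw [mem_hs] at h1 h2
  rw [← mul_assoc] at h2
  obtain ⟨rfl, rfl, h3⟩ := cross_in _ _ _ _ _ h1 h2
  refine ⟨rfl, rfl, h3, ?_⟩
  have := smul_H_of_par h3 c
  nth_rewrite 1 [← this]
  rw [smul_smul, mul_inv_cancel_left]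

theorem IsHS.cross {v : V} {E : Set (RAAG G)} (hE : IsHS v E) {x : RAAG G} {w : V} {c : Bool}
    (h1 : x ∉ E) (h2 : x * lt G w c ∈ E) : w = v ∧ E = x • H G v c := by
  obtain ⟨g, b, rfl⟩ := hE
  obtain ⟨rfl, rfl, _, h⟩ := hs_cross h1 h2
  exact ⟨rfl, h⟩

theorem notMem_base (g : RAAG G) (v : V) (b : Bool) : g ∉ g • H G v b := by
  rw [mem_hs]; simp [one_notMem]
theorem mem_base (g : RAAG G) (v : V) (b : Bool) : g * lt G v b ∈ g • H G v b := by
  rw [mem_hs]; simp [lt_self_mem]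

theorem hs_eq {g h : RAAG G} {v w : V} {b c : Bool} (e : g • H G v b = h • H G w c) :
    v = w ∧ b = c ∧ h⁻¹ * g ∈ par G (lk G w) := by
  have h1 := notMem_base g v b
  have h2 := mem_base g v b
  rw [e] at h1 h2
  obtain ⟨rfl, rfl, h3, _⟩ := hs_cross h1 h2
  exact ⟨rfl, rfl, h3⟩

theorem stab_H {g : RAAG G} {v : V} {b : Bool} : g • H G v b = H G v b ↔ g ∈ par G (lk G v) := by
  constructor
  · intro h
    have := (hs_eq (h := 1) (by rw [h, one_smul] : g • H G v b = (1 : RAAG G) • H G v b)).2.2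
    simpa using this
  · exact fun h => smul_H_of_par h b

theorem stab_hs {g h : RAAG G} {v : V} {b : Bool} :
    g • h • H G v b = h • H G v b ↔ h⁻¹ * g * h ∈ par G (lk G v) := by
  rw [← stab_H (b := b), ← smul_left_cancel_iff h (x := (h⁻¹ * g * h) • H G v b)]
  simp only [smul_smul, mul_assoc, mul_inv_cancel_left]

theorem no_inv {g : RAAG G} {v : V} {E : Set (RAAG G)} (hE : IsHS v E) : g • E ≠ Eᶜ := by
  obtain ⟨h, b, rfl⟩ := hE
  rw [hs_compl, smul_smul]
  intro e
  have := (hs_eq e).2.1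
  cases b <;> simp at this

theorem sep_fin (v : V) (x g : RAAG G) :
    {E : Set (RAAG G) | IsHS v E ∧ ¬ (x ∈ E ↔ x * g ∈ E)}.Finite := by
  induction g using ind_right with
  | one => simp
  | step w c g ih =>
    refine (ih.union (Set.toFinite {(x * g) • H G v c, (x * g * lt G w c) • H G v (!c)})).subset ?_
    rintro E ⟨hE, hs⟩
    by_cases h : x ∈ E ↔ x * g ∈ E
    · right
      rw [h, ← mul_assoc] at hs
      by_cases h1 : x * g ∈ E
      · have h2 : x * g * lt G w c ∉ E := by tauto
        right
        exact (hE.cross (w := w) (c := !c) h2 (by simpa using h1)).2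
      · have h2 : x * g * lt G w c ∈ E := by tauto
        left
        exact (hE.cross h1 h2).2
    · left; exact ⟨hE, h⟩

theorem sep_fin' (v : V) (x y : RAAG G) :
    {E : Set (RAAG G) | IsHS v E ∧ ¬ (x ∈ E ↔ y ∈ E)}.Finite := by
  have := sep_fin (G := G) v x (x⁻¹ * y)
  simpa using this

theorem smul_noCross {v w : V} (ha : ¬ G.Adj v w) {E : Set (RAAG G)} (hE : IsHS v E)
    {m : RAAG G} (hm : m ∈ par G (lk G w)) (x : RAAG G) : x ∈ E ↔ x * m ∈ E := by
  obtain ⟨g, b, rfl⟩ := hE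
  rw [mem_hs, mem_hs, ← mul_assoc]
  exact noCross_par (fun h => ha (G.adj_symm h)) hm _ _

theorem IsHS.noCross_lt {v w : V} (ha : v ≠ w) {E : Set (RAAG G)} (hE : IsHS v E)
    (c : Bool) (x : RAAG G) : x ∈ E ↔ x * lt G w c ∈ E := by
  obtain ⟨g, b, rfl⟩ := hE
  rw [mem_hs, mem_hs, ← mul_assoc]
  exact RG.noCross_lt ha.symm c _ _

section Conn
variable [Finite V]

theorem conn_compl (v : V) (b : Bool) (T : Set (RAAG G))
    (hT : ∀ x w c, x ∉ H G v b → x * lt G w c ∉ H G v b → (x ∈ T ↔ x * lt G w c ∈ T))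
    (x : RAAG G) (hx : x ∉ H G v b) : x ∈ T ↔ (1 : RAAG G) ∈ T := by
  induction hn : len x using Nat.strong_induction_on generalizing x with
  | _ n ih =>
    by_cases h1 : x = 1
    · rw [h1]
    · obtain ⟨w, c, y, rfl, hy⟩ := exists_last h1
      have hyH : y ∉ H G v b := by
        intro hyH
        have := len_cross hyH hx
        omega
      rw [← hT y w c hyH hx]
      exact ih (len y) (by omega) y hyH rfl

theorem IsHS.conn {v : V} {E : Set (RAAG G)} (hE : IsHS v E) (T : Set (RAAG G))
    (hT : ∀ x w c, x ∈ E → x * lt G w c ∈ E → (x ∈ T ↔ x * lt G w c ∈ T))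
    {x y : RAAG G} (hx : x ∈ E) (hy : y ∈ E) : x ∈ T ↔ y ∈ T := by
  have key : ∃ (g : RAAG G) (b : Bool), E = (g • H G v b)ᶜ := by
    obtain ⟨g, b, h⟩ := hE.compl
    exact ⟨g, b, by rw [← h, compl_compl]⟩
  obtain ⟨g, b, rfl⟩ := key
  simp only [Set.mem_compl_iff, mem_hs] at *
  have := conn_compl v b (g⁻¹ • T) (by
    intro x w c h1 h2
    have := hT (g * x) w c (by simpa using h1) (by simpa [mul_assoc] using h2)
    simpa [mem_sm, mul_assoc] using this)
  have hx' := this _ hx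
  have hy' := this _ hy
  simp only [mem_sm, inv_inv, mul_inv_cancel_left] at hx' hy'
  rw [hx', hy']

theorem nested {v w : V} (ha : ¬ G.Adj v w) {E F : Set (RAAG G)} (hE : IsHS v E) (hF : IsHS w F) :
    E ⊆ F ∨ F ⊆ E ∨ Disjoint E F ∨ E ∪ F = Set.univ := by
  by_cases h1 : ∀ x u c, x ∈ E → x * lt G u c ∈ E → (x ∈ F ↔ x * lt G u c ∈ F)
  · have h2 := fun x y (hx : x ∈ E) (hy : y ∈ E) => hE.conn F h1 hx hy
    by_cases h3 : ∃ x ∈ E, x ∈ F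
    · obtain ⟨x, hx, hx'⟩ := h3
      left; intro y hy; exact (h2 x y hx hy).1 hx'
    · right; right; left
      rw [Set.disjoint_left]; intro x hx hx'; exact h3 ⟨x, hx, hx'⟩
  · by_cases h1' : ∀ x u c, x ∈ Eᶜ → x * lt G u c ∈ Eᶜ → (x ∈ F ↔ x * lt G u c ∈ F)
    · have h2 := fun x y (hx : x ∈ Eᶜ) (hy : y ∈ Eᶜ) => hE.compl.conn F h1' hx hy
      by_cases h3 : ∃ x ∈ Eᶜ, x ∈ F
      · obtain ⟨x, hx, hx'⟩ := h3
        right; right; right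
        ext y
        by_cases hy : y ∈ E
        · simp [hy]
        · simp [(h2 x y hx hy).1 hx']
      · right; left
        intro x hx; by_contra hx'; exact h3 ⟨x, hx', hx⟩
    · exfalso
      have aux : ∀ E' : Set (RAAG G),
          (¬ ∀ x u c, x ∈ E' → x * lt G u c ∈ E' → (x ∈ F ↔ x * lt G u c ∈ F)) →
          ∃ x u c, x ∈ E' ∧ x ∉ F ∧ x * lt G u c ∈ F := by
        intro E' h
        push Not at h
        obtain ⟨x, u, c, h1, h2, h3⟩ := h
        rcases h3 with ⟨h3, h4⟩ | ⟨h3, h4⟩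
        · exact ⟨x * lt G u c, u, !c, h2, h4, by simpa using h3⟩
        · exact ⟨x, u, c, h1, h3, h4⟩
      obtain ⟨x, u, c, hx, hxF, hxF'⟩ := aux _ h1
      obtain ⟨y, u', c', hy, hyF, hyF'⟩ := aux _ h1'
      obtain ⟨rfl, e⟩ := hF.cross hxF hxF'
      rw [e] at hyF hyF'
      obtain ⟨rfl, rfl, h5, _⟩ := hs_cross hyF hyF'
      have := smul_noCross ha hE h5 x
      rw [mul_inv_cancel_left] at this
      exact hy (this.1 hx)

theorem exists_pow_mem (w : V) (b : Bool) (g : RAAG G) : ∃ m : ℕ, (lt G w b) ^ m * g ∈ H G w b := by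
  induction hn : len g using Nat.strong_induction_on generalizing g with
  | _ n ih =>
    by_cases h : g ∈ H G w (!b)
    · have := len_pop h
      rw [lt_not, inv_inv] at this
      obtain ⟨m, hm⟩ := ih _ (by omega) (lt G w b * g) rfl |> fun h => h
      exact ⟨m + 1, by rw [pow_succ, mul_assoc]; exact hm⟩
    · exact ⟨1, by rw [pow_one]; exact H_flip.2 h⟩

end Conn
end RG

end

section
namespace RG
open scoped Pointwise
universe u
variable {V : Type u} {G : SimpleGraph V}

/-! ### Exponents -/
open Classical in
noncomputable def exHom (G : SimpleGraph V) (v : V) : RAAG G →* Multiplicative ℤ :=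
  lift (fun w => Multiplicative.ofAdd (if w = v then (1 : ℤ) else 0)) (fun _ _ _ => mul_comm _ _)

noncomputable def ex (v : V) (g : RAAG G) : ℤ := Multiplicative.toAdd (exHom G v g)

@[simp] theorem ex_mul (v : V) (g h : RAAG G) : ex v (g * h) = ex v g + ex v h := by
  simp [ex]
@[simp] theorem ex_one (v : V) : ex v (1 : RAAG G) = 0 := by simp [ex]
@[simp] theorem ex_inv (v : V) (g : RAAG G) : ex v g⁻¹ = - ex v g := by simp [ex]
@[simp] theorem ex_pow (v : V) (g : RAAG G) (n : ℕ) : ex v (g ^ n) = n * ex v g := by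
  simp [ex]
@[simp] theorem ex_zpow (v : V) (g : RAAG G) (n : ℤ) : ex v (g ^ n) = n * ex v g := by
  simp [ex]
@[simp] theorem ex_gen_self (v : V) : ex v (gen G v) = 1 := by simp [ex, exHom]
theorem ex_gen_ne {v w : V} (h : w ≠ v) : ex v (gen G w) = 0 := by simp [ex, exHom, h]

theorem ex_par {S : Set V} {v : V} (h : v ∉ S) {g : RAAG G} (hg : g ∈ par G S) : ex v g = 0 := by
  refine par_ind (p := fun g => ex v g = 0) (by simp) ?_ hg
  intro w hw b g _ ih
  have : w ≠ v := fun e => h (e ▸ hw)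
  cases b <;> simp [ih, ex_gen_ne this]

/-! ### Centralizers -/
section Cent
variable [Finite V]

theorem cent {w : V} {x : RAAG G} (h : x * gen G w = gen G w * x) : x ∈ par G (star G w) := by
  have hc : Commute x (gen G w) := h
  have hcz : ∀ k : ℤ, x⁻¹ * gen G w ^ k = gen G w ^ k * x⁻¹ := fun k =>
    ((hc.inv_left).zpow_right k)
  obtain ⟨m, hm⟩ := exists_pow_mem w true x⁻¹
  obtain ⟨m', hm'⟩ := exists_pow_mem w false x⁻¹
  have key : ∃ k : ℤ, gen G w ^ k ∉ x • H G w true ∧ gen G w ^ k * lt G w true ∈ x • H G w true := by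
    by_contra hk
    push Not at hk
    have h0 : gen G w ^ (-(m' : ℤ)) ∉ x • H G w true := by
      rw [mem_hs, hcz]
      have := H_not hm'
      simpa using this
    have h1 : ∀ n : ℕ, gen G w ^ (-(m' : ℤ) + n) ∉ x • H G w true := by
      intro n
      induction n with
      | zero => simpa using h0
      | succ n ih =>
        have := hk _ ih
        rw [lt_true, ← zpow_add_one] at this
        push_cast
        rw [← add_assoc]
        exact this
    apply h1 (m' + m)
    rw [mem_hs, hcz]
    push_cast
    simpa using hm
  obtain ⟨k, h1, h2⟩ := key
  have h3 := (hs_cross h1 h2).2.2.1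
  have h4 : x⁻¹ * gen G w ^ k ∈ par G (star G w) := par_mono (Set.subset_insert _ _) h3
  have h5 : gen G w ^ k ∈ par G (star G w) := zpow_mem (gen_mem (Set.mem_insert _ _)) k
  have h6 := mul_mem h5 (inv_mem h4)
  simpa using h6

theorem cent_iff {w : V} {x : RAAG G} : x * gen G w = gen G w * x ↔ x ∈ par G (star G w) := by
  refine ⟨cent, fun h => ?_⟩
  refine par_ind (p := fun x => x * gen G w = gen G w * x) (by simp) ?_ h
  intro v hv b g _ ih
  have hv' : v = w ∨ G.Adj w v := hv
  have : lt G v b * gen G w = gen G w * lt G v b := by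
    rcases hv' with rfl | hv'
    · cases b <;> simp
    · exact (lt_comm hv' true b).symm
  rw [mul_assoc, ih, ← mul_assoc, this, mul_assoc]

end Cent

/-! ### Counting walls -/

theorem sm_inj {x y : RAAG G} {E : Set (RAAG G)} : x • E = y • E ↔ (y⁻¹ * x) • E = E := by
  rw [mul_smul, inv_smul_eq_iff]

def posW (v : V) (x y : RAAG G) : Set (Set (RAAG G)) :=
  {E | (∃ k : RAAG G, E = k • H G v true) ∧ x ∉ E ∧ y ∈ E}

theorem posW_fin (v : V) (x y : RAAG G) : (posW v x y).Finite := by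
  refine (sep_fin' v x y).subset ?_
  rintro E ⟨⟨k, rfl⟩, h1, h2⟩
  exact ⟨⟨k, true, rfl⟩, by tauto⟩

theorem hs_step {h k : RAAG G} {v : V} (hne : k • H G v true ≠ h • H G v true) :
    h ∈ k • H G v true ↔ h * gen G v ∈ k • H G v true := by
  constructor
  · intro h1
    by_contra h2
    have := (hs_cross (w := v) (c := false) h2 (by simpa using h1)).2.1
    simp at this
  · intro h1
    by_contra h2
    exact hne (hs_cross (w := v) (c := true) h2 h1).2.2.2

theorem count_step (v : V) (h : RAAG G) :
    ((posW v 1 (h * gen G v)).ncard : ℤ) - (posW v (h * gen G v) 1).ncard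
      = (posW v 1 h).ncard - (posW v h 1).ncard + 1 := by
  have hb1 : h ∉ h • H G v true := notMem_base h v true
  have hb2 : h * gen G v ∈ h • H G v true := mem_base h v true
  by_cases h1 : (1 : RAAG G) ∈ h • H G v true
  · have e1 : posW v 1 (h * gen G v) = posW v 1 h := by
      ext E
      constructor
      · rintro ⟨⟨k, rfl⟩, h2, h3⟩
        have : k • H G v true ≠ h • H G v true := fun e => h2 (e ▸ h1)
        exact ⟨⟨k, rfl⟩, h2, (hs_step this).2 h3⟩
      · rintro ⟨⟨k, rfl⟩, h2, h3⟩
        have : k • H G v true ≠ h • H G v true := fun e => h2 (e ▸ h1)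
        exact ⟨⟨k, rfl⟩, h2, (hs_step this).1 h3⟩
    have e2 : posW v h 1 = insert (h • H G v true) (posW v (h * gen G v) 1) := by
      ext E
      rw [Set.mem_insert_iff]
      constructor
      · rintro ⟨⟨k, rfl⟩, h2, h3⟩
        by_cases e : k • H G v true = h • H G v true
        · exact Or.inl e
        · exact Or.inr ⟨⟨k, rfl⟩, fun h4 => h2 ((hs_step e).2 h4), h3⟩
      · rintro (rfl | ⟨⟨k, rfl⟩, h2, h3⟩)
        · exact ⟨⟨h, rfl⟩, hb1, h1⟩
        · have : k • H G v true ≠ h • H G v true := fun e => h2 (e ▸ hb2)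
          exact ⟨⟨k, rfl⟩, fun h4 => h2 ((hs_step this).1 h4), h3⟩
    rw [e1, e2, Set.ncard_insert_of_notMem (fun h2 => h2.2.1 hb2) (posW_fin _ _ _)]
    push_cast; ring
  · have e1 : posW v (h * gen G v) 1 = posW v h 1 := by
      ext E
      constructor
      · rintro ⟨⟨k, rfl⟩, h2, h3⟩
        have : k • H G v true ≠ h • H G v true := fun e => h1 (e ▸ h3)
        exact ⟨⟨k, rfl⟩, fun h4 => h2 ((hs_step this).1 h4), h3⟩
      · rintro ⟨⟨k, rfl⟩, h2, h3⟩
        have : k • H G v true ≠ h • H G v true := fun e => h1 (e ▸ h3)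
        exact ⟨⟨k, rfl⟩, fun h4 => h2 ((hs_step this).2 h4), h3⟩
    have e2 : posW v 1 (h * gen G v) = insert (h • H G v true) (posW v 1 h) := by
      ext E
      rw [Set.mem_insert_iff]
      constructor
      · rintro ⟨⟨k, rfl⟩, h2, h3⟩
        by_cases e : k • H G v true = h • H G v true
        · exact Or.inl e
        · exact Or.inr ⟨⟨k, rfl⟩, h2, (hs_step e).2 h3⟩
      · rintro (rfl | ⟨⟨k, rfl⟩, h2, h3⟩)
        · exact ⟨⟨h, rfl⟩, h1, hb2⟩
        · have : k • H G v true ≠ h • H G v true := fun e => hb1 (e ▸ h3)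
          exact ⟨⟨k, rfl⟩, h2, (hs_step this).1 h3⟩
    rw [e1, e2, Set.ncard_insert_of_notMem (fun h2 => hb1 h2.2.2) (posW_fin _ _ _)]
    push_cast; ring

theorem ex_count (v : V) (h : RAAG G) :
    ex v h = (posW v 1 h).ncard - (posW v h 1).ncard := by
  induction h using ind_right with
  | one =>
    have : posW v 1 (1 : RAAG G) = ∅ := by
      ext E; simp only [posW, Set.mem_setOf_eq, Set.mem_empty_iff_false, iff_false]; tauto
    simp [this]
  | step w c g ih =>
    by_cases hw : w = v
    · subst hw
      cases c
      · have := count_step w (g * lt G w false)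
        simp only [lt_false, inv_mul_cancel_right] at this
        rw [ex_mul, ih, lt_false, ex_inv, ex_gen_self]
        linarith
      · rw [lt_true, count_step, ex_mul, ih, ex_gen_self]
    · have e : ∀ x, posW v x (g * lt G w c) = posW v x g ∧ posW v (g * lt G w c) x = posW v g x := by
        intro x
        constructor <;> ext E <;> constructor <;> rintro ⟨⟨k, rfl⟩, h2, h3⟩
        · exact ⟨⟨k, rfl⟩, h2, (IsHS.noCross_lt (Ne.symm hw) ⟨k, true, rfl⟩ c g).2 h3⟩
        · exact ⟨⟨k, rfl⟩, h2, (IsHS.noCross_lt (Ne.symm hw) ⟨k, true, rfl⟩ c g).1 h3⟩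
        · exact ⟨⟨k, rfl⟩, fun h => h2 ((IsHS.noCross_lt (Ne.symm hw) ⟨k, true, rfl⟩ c g).1 h), h3⟩
        · exact ⟨⟨k, rfl⟩, fun h => h2 ((IsHS.noCross_lt (Ne.symm hw) ⟨k, true, rfl⟩ c g).2 h), h3⟩
      rw [(e 1).1, (e 1).2, ← ih]
      cases c <;> simp [ex_gen_ne hw]

section Axis
variable [Finite V]

theorem hs_ne {v : V} {E F : Set (RAAG G)} (hE : IsHS v E) (hF : IsHS v F) {x y : RAAG G}
    (h1 : x ∉ E) (h2 : x ∉ F) (h3 : y ∈ E) (h4 : y ∈ F) : E ⊆ F ∨ F ⊆ E := by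
  rcases nested (G.irrefl) hE hF with h | h | h | h
  · exact Or.inl h
  · exact Or.inr h
  · exact absurd h4 (Set.disjoint_left.1 h h3)
  · have : x ∈ E ∪ F := h ▸ Set.mem_univ x
    exact absurd this (by simp [h1, h2])

theorem exists_axis_pos {v : V} {g : RAAG G} (h : 0 < ex v g) :
    ∃ m : ℤ, ∃ E : Set (RAAG G), IsHS v E ∧ g ^ m • E ⊂ E := by
  classical
  let F := posW v 1 g
  have hF : F.Finite := posW_fin _ _ _
  let N := F.ncard + 1
  let P := posW v 1 (g ^ N)
  have hP : P.Finite := posW_fin _ _ _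
  have hcard : F.ncard < P.ncard := by
    have h1 := ex_count v (g ^ N)
    rw [ex_pow] at h1
    have : (N : ℤ) ≤ N * ex v g := by nlinarith
    have h2 : (P.ncard : ℤ) ≥ N := by
      show ((posW v 1 (g ^ N)).ncard : ℤ) ≥ N
      linarith [Int.natCast_nonneg (posW v (g ^ N) 1).ncard]
    have : N ≤ P.ncard := by exact_mod_cast h2
    omega
  have hex : ∀ E ∈ P, ∃ i : ℕ, (g ^ i)⁻¹ • E ∈ F := by
    rintro E ⟨⟨k, rfl⟩, h1, h2⟩
    have : ∃ i : ℕ, g ^ i ∉ k • H G v true ∧ g ^ (i + 1) ∈ k • H G v true := by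
      by_contra hc
      push Not at hc
      have : ∀ i : ℕ, g ^ i ∉ k • H G v true := by
        intro i
        induction i with
        | zero => simpa using h1
        | succ i ih => exact hc i ih
      exact this N h2
    obtain ⟨i, h3, h4⟩ := this
    refine ⟨i, ⟨(g ^ i)⁻¹ * k, by rw [smul_smul]⟩, ?_, ?_⟩
    · rw [mem_sm]; simpa using h3
    · rw [mem_sm]; simpa [pow_succ] using h4
  choose! i hi using hex
  have hcard' : hF.toFinset.card < hP.toFinset.card := by
    rw [← Set.ncard_eq_toFinset_card F hF, ← Set.ncard_eq_toFinset_card P hP]; exact hcard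
  obtain ⟨E, hE, E', hE', hne, heq⟩ := Finset.exists_ne_map_eq_of_card_lt_of_maps_to
    (t := hF.toFinset) (s := hP.toFinset) hcard'
    (f := fun E => (g ^ (i E))⁻¹ • E) (by
      intro E hE
      have := hi E (by simpa using hE)
      simpa using this)
  have hE1 : E ∈ P := by simpa using hE
  have hE2 : E' ∈ P := by simpa using hE'
  obtain ⟨⟨k, rfl⟩, h1, h2⟩ := hE1
  obtain ⟨⟨k', rfl⟩, h1', h2'⟩ := hE2
  set E := k • H G v true with hEd
  set E' := k' • H G v true with hEd'
  have heq' : E' = g ^ (((i E' : ℤ)) - i E) • E := by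
    have : E' = g ^ (i E') • (g ^ (i E))⁻¹ • E := by
      rw [heq, smul_inv_smul]
    rw [zpow_sub, zpow_natCast, zpow_natCast, mul_smul]
    exact this
  rcases hs_ne ⟨k, true, rfl⟩ ⟨k', true, rfl⟩ h1 h1' h2 h2' with hs | hs
  · refine ⟨-(((i E' : ℤ)) - i E), E', ⟨k', true, rfl⟩, ?_⟩
    have : g ^ (-(((i E' : ℤ)) - i E)) • E' = E := by
      rw [zpow_neg, inv_smul_eq_iff]; exact heq'
    rw [this]
    exact hs.ssubset_of_ne hne
  · refine ⟨(((i E' : ℤ)) - i E), E, ⟨k, true, rfl⟩, ?_⟩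
    rw [← heq']
    exact hs.ssubset_of_ne (Ne.symm hne)

theorem exists_axis {v : V} {g : RAAG G} (h : ex v g ≠ 0) :
    ∃ m : ℤ, ∃ E : Set (RAAG G), IsHS v E ∧ g ^ m • E ⊂ E := by
  rcases lt_or_gt_of_ne h with h | h
  · obtain ⟨m, E, hE, h1⟩ := exists_axis_pos (g := g⁻¹) (v := v) (by simpa using h)
    exact ⟨-m, E, hE, by rw [zpow_neg, ← inv_zpow]; exact h1⟩
  · exact exists_axis_pos h

theorem ssub_smul {E F : Set (RAAG G)} (g : RAAG G) (h : E ⊂ F) : g • E ⊂ g • F := by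
  rw [ssubset_iff_subset_ne] at *
  exact ⟨Set.smul_set_mono h.1, fun e => h.2 (smul_left_cancel _ e)⟩

theorem trans_le {g : RAAG G} {E : Set (RAAG G)} (h : g • E ⊂ E) (n : ℕ) : g ^ n • E ⊆ E := by
  induction n with
  | zero => simp
  | succ n ih =>
    rw [pow_succ, mul_smul]
    exact (Set.smul_set_mono h.subset).trans ih

theorem trans_lt {g : RAAG G} {E : Set (RAAG G)} (h : g • E ⊂ E) (n : ℕ) : g ^ (n + 1) • E ⊂ E := by
  rw [pow_succ, mul_smul]
  exact (ssub_smul _ h).trans_subset (trans_le h n)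

theorem trans_anti {g : RAAG G} {E : Set (RAAG G)} (h : g • E ⊂ E) {i j : ℤ} (hij : i < j) :
    g ^ j • E ⊂ g ^ i • E := by
  obtain ⟨n, hn⟩ := Int.eq_ofNat_of_zero_le (by omega : 0 ≤ j - i - 1)
  have : j = i + (n + 1 : ℕ) := by push_cast; omega
  rw [this, zpow_add, mul_smul, zpow_natCast]
  exact ssub_smul _ (trans_lt h n)

theorem trans_inter {v : V} {g : RAAG G} {E : Set (RAAG G)} (hE : IsHS v E) (h : g • E ⊂ E)
    (x : RAAG G) : ∃ n : ℕ, x ∉ g ^ (n : ℤ) • E := by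
  by_contra hc
  push Not at hc
  obtain ⟨y, hy⟩ : ∃ y, y ∉ E := by
    obtain ⟨k, b, rfl⟩ := hE
    exact ⟨k, notMem_base k v b⟩
  have hy' : ∀ n : ℕ, y ∉ g ^ (n : ℤ) • E := fun n h2 => hy (trans_le h n (by simpa using h2))
  have hinj : Function.Injective (fun n : ℕ => g ^ (n : ℤ) • E) := by
    intro i j hij
    by_contra hne
    rcases lt_or_gt_of_ne hne with h1 | h1
    · exact (trans_anti h (by exact_mod_cast h1 : (i : ℤ) < j)).ne hij.symm
    · exact (trans_anti h (by exact_mod_cast h1 : (j : ℤ) < i)).ne hij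
  refine Set.infinite_of_injective_forall_mem hinj ?_ (sep_fin' v x y)
  intro n
  exact ⟨hE.smul _, by have := hc n; have := hy' n; tauto⟩

theorem trans_union {v : V} {g : RAAG G} {E : Set (RAAG G)} (hE : IsHS v E) (h : g • E ⊂ E)
    (x : RAAG G) : ∃ n : ℕ, x ∈ g ^ (-(n : ℤ)) • E := by
  have h' : g⁻¹ • Eᶜ ⊂ Eᶜ := by
    rw [Set.smul_set_compl, Set.ssubset_def, Set.compl_subset_compl, Set.compl_subset_compl]
    have := ssub_smul g⁻¹ h
    rw [inv_smul_smul] at this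
    exact this
  obtain ⟨n, hn⟩ := trans_inter hE.compl h' x
  refine ⟨n, ?_⟩
  rw [Set.smul_set_compl, Set.notMem_compl_iff] at hn
  rw [zpow_neg, ← inv_zpow]; exact hn

theorem axis {v : V} {g z : RAAG G} {E : Set (RAAG G)} (hE : IsHS v E) (h : g • E ⊂ E)
    (hz : z * g = g * z) : ∃ n : ℕ, ∃ k : ℤ, (z ^ (n + 1) * g ^ k) • E = E := by
  have hc : Commute z g := hz
  have hi : ∀ i : ℕ, ∃ k : ℤ, (1 : RAAG G) ∈ (g ^ k * z ^ i) • E ∧ g⁻¹ ∉ (g ^ k * z ^ i) • E := by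
    intro i
    have h' : g • (z ^ i • E) ⊂ z ^ i • E := by
      rw [smul_smul, ← (hc.pow_left i).eq, mul_smul]; exact ssub_smul _ h
    obtain ⟨a, ha⟩ := trans_inter (hE.smul _) h' 1
    obtain ⟨b, hb⟩ := trans_union (hE.smul _) h' 1
    obtain ⟨k, hk1, hk2⟩ := Int.exists_greatest_of_bdd
      (P := fun k : ℤ => (1 : RAAG G) ∈ g ^ k • (z ^ i • E)) ⟨a, fun k hk => by
        by_contra hlt
        exact ha ((trans_anti h' (by omega : (a : ℤ) < k)).subset hk)⟩ ⟨_, hb⟩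
    refine ⟨k, by rw [mul_smul]; exact hk1, fun h2 => ?_⟩
    have : (1 : RAAG G) ∈ g ^ (k + 1) • (z ^ i • E) := by
      rw [mul_smul] at h2
      rw [zpow_add_one, (Commute.refl g).zpow_left k |>.eq, mul_smul, mem_sm]
      simpa using h2
    have := hk2 _ this
    omega
  choose k hk1 hk2 using hi
  obtain ⟨i, j, hne, heq⟩ := (sep_fin' (G := G) v 1 g⁻¹).exists_lt_map_eq_of_forall_mem
    (f := fun i : ℕ => (g ^ (k i) * z ^ i) • E)
    (by intro i; exact ⟨hE.smul _, by have := hk1 i; have := hk2 i; tauto⟩)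
  refine ⟨j - i - 1, k j - k i, ?_⟩
  have e : j - i - 1 + 1 = j - i := by omega
  rw [e]
  have := sm_inj.1 heq.symm
  rw [← this]
  congr 1
  have h1 : z ^ j = z ^ i * z ^ (j - i) := by rw [← pow_add]; congr 1; omega
  have c1 := ((hc.pow_left i).zpow_right (k j - k i)).eq
  have c2 := ((hc.pow_left (j - i)).zpow_right (k j - k i)).eq
  rw [mul_inv_rev, h1, c2]
  simp only [mul_assoc]
  rw [← mul_assoc (g ^ k i)⁻¹, ← zpow_neg, ← zpow_add, ← mul_assoc (g ^ (-k i + k j)),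
    show -k i + k j = k j - k i by ring, ← c1]
  simp [mul_assoc]

/-- elements commuting with a translation and having a power in the stabilizer, stabilize -/
theorem axis_stab {v : V} {g z : RAAG G} {E : Set (RAAG G)} (hE : IsHS v E) (h : g • E ⊂ E)
    (hz : z * g = g * z) {n : ℕ} (hn : z ^ (n + 1) • E = E) : z • E = E := by
  have hc : Commute z g := hz
  rcases nested (G.irrefl) (hE.smul z) hE with h1 | h1 | h1 | h1
  · by_contra hne
    have := trans_lt (h1.ssubset_of_ne hne) n
    rw [hn] at this
    exact this.ne rfl
  · by_contra hne
    have h2 : z⁻¹ • E ⊂ E := by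
      have := ssub_smul z⁻¹ (h1.ssubset_of_ne (Ne.symm hne))
      rwa [inv_smul_smul] at this
    have := trans_lt h2 n
    rw [inv_pow, inv_smul_eq_iff.2 hn.symm] at this
    exact absurd rfl this.ne
  · exfalso
    obtain ⟨a, ha⟩ := trans_union hE h 1
    obtain ⟨b, hb⟩ := trans_union hE h z⁻¹
    have hab : ∀ a c : ℤ, a ≤ c → g ^ c • E ⊆ g ^ a • E := by
      intro a c hac
      rcases hac.lt_or_eq with h | rfl
      · exact (trans_anti ‹_› h).subset
      · exact subset_rfl
    have ha' := hab (-(a + b : ℤ)) (-a) (by omega) ha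
    have hb' := hab (-(a + b : ℤ)) (-b) (by omega) hb
    refine (Set.disjoint_left.1 h1 : ∀ ⦃x⦄, _) (?_ : (g ^ (-(a + b : ℤ)))⁻¹ ∈ _) ?_
    · rw [mem_sm] at hb' ⊢
      rw [← mul_inv_rev, ← (hc.zpow_right _).eq, mul_inv_rev]
      exact hb'
    · rw [mem_sm] at ha'; simpa using ha'
  · exfalso
    obtain ⟨a, ha⟩ := trans_inter hE h 1
    obtain ⟨b, hb⟩ := trans_inter hE h z⁻¹
    have hab : ∀ a c : ℤ, a ≤ c → g ^ c • E ⊆ g ^ a • E := by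
      intro a c hac
      rcases hac.lt_or_eq with h | rfl
      · exact (trans_anti ‹_› h).subset
      · exact subset_rfl
    have ha' := fun h => ha (hab (a) (a + b : ℤ) (by omega) h)
    have hb' := fun h => hb (hab (b) (a + b : ℤ) (by omega) h)
    have : (g ^ ((a + b : ℤ)))⁻¹ ∈ z • E ∪ E := h1 ▸ Set.mem_univ _
    rcases this with h2 | h2
    · apply hb'
      rw [mem_sm] at h2 ⊢
      rw [← mul_inv_rev, ← (hc.zpow_right _).eq, mul_inv_rev] at h2
      exact h2
    · apply ha'; rw [mem_sm]; simpa using h2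

end Axis
end RG

end

section
namespace RG
open scoped Pointwise
universe u
variable {V : Type u} {G : SimpleGraph V}

/-! ### Constructing automorphisms -/

def mkAut (f f' : RAAG G →* RAAG G) (h1 : ∀ v, f' (f (gen G v)) = gen G v)
    (h2 : ∀ v, f (f' (gen G v)) = gen G v) : MulAut (RAAG G) :=
  { toFun := f, invFun := f',
    left_inv := fun x => by
      have : f'.comp f = MonoidHom.id _ := hom_ext h1
      exact DFunLike.congr_fun this x
    right_inv := fun x => by
      have : f.comp f' = MonoidHom.id _ := hom_ext h2
      exact DFunLike.congr_fun this x
    map_mul' := map_mul f }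

@[simp] theorem mkAut_apply (f f' : RAAG G →* RAAG G) (h1 h2) (x : RAAG G) :
    mkAut f f' h1 h2 x = f x := rfl

theorem map_lt {M : Type*} [Group M] (f : RAAG G →* M) (v : V) (b : Bool) :
    f (lt G v b) = if b then f (gen G v) else (f (gen G v))⁻¹ := by
  cases b <;> simp

def AutS (G : SimpleGraph V) : Subgroup (MulAut (RAAG G)) :=
  Subgroup.closure {φ : MulAut (RAAG G) | IsTransvection φ ∨ IsPartialConj φ}

theorem inv_apply_eq {φ : MulAut (RAAG G)} {x y : RAAG G} (h : φ y = x) : φ⁻¹ x = y := by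
  rw [← h]; exact MulAut.inv_apply_self _ φ y

theorem lt_not' (v : V) (c : Bool) (hc : c = false) : lt G v c = (gen G v)⁻¹ := by subst hc; rfl

theorem tvR_mem {ψ : MulAut (RAAG G)} {a b : V} (hab : a ≠ b) (hl : LkLeSt G a b) (c : Bool)
    (h1 : ψ (gen G a) = gen G a * lt G b c) (h2 : ∀ w ≠ a, ψ (gen G w) = gen G w) :
    ψ ∈ AutS G := by
  cases c
  · rw [← inv_mem_iff]
    refine Subgroup.subset_closure (Or.inl ⟨a, b, hab, hl, Or.inl ⟨?_, ?_⟩⟩)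
    · apply inv_apply_eq
      rw [map_mul, h1, h2 b hab.symm]; simp
    · intro w hw
      exact inv_apply_eq (h2 w hw)
  · exact Subgroup.subset_closure (Or.inl ⟨a, b, hab, hl, Or.inl ⟨h1, h2⟩⟩)

theorem tvL_mem {ψ : MulAut (RAAG G)} {a b : V} (hab : a ≠ b) (hl : LkLeSt G a b) (c : Bool)
    (h1 : ψ (gen G a) = lt G b c * gen G a) (h2 : ∀ w ≠ a, ψ (gen G w) = gen G w) :
    ψ ∈ AutS G := by
  cases c
  · rw [← inv_mem_iff]
    refine Subgroup.subset_closure (Or.inl ⟨a, b, hab, hl, Or.inr ⟨?_, ?_⟩⟩)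
    · apply inv_apply_eq
      rw [map_mul, h1, h2 b hab.symm]; simp
    · intro w hw
      exact inv_apply_eq (h2 w hw)
  · exact Subgroup.subset_closure (Or.inl ⟨a, b, hab, hl, Or.inr ⟨h1, h2⟩⟩)

/-- `C` is closed for conjugation by `v`. -/
def Clos (G : SimpleGraph V) (v : V) (C : Set V) : Prop :=
  v ∉ C ∧ ∀ c ∈ C, ∀ d, G.Adj c d → d ∈ C ∨ d ∈ star G v

theorem mem_star {v w : V} : w ∈ star G v ↔ w = v ∨ G.Adj v w := Iff.rfl

theorem star_comm {v d : V} (h : d ∈ star G v) (b : Bool) :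
    gen G d * lt G v b = lt G v b * gen G d := by
  rcases mem_star.1 h with rfl | h
  · cases b <;> simp
  · exact (lt_comm h b true).symm

open Classical in
noncomputable def gpcHom (v : V) (b : Bool) (C : Set V) (hC : Clos G v C) : RAAG G →* RAAG G :=
  lift (fun w => if w ∈ C then lt G v b * gen G w * (lt G v b)⁻¹ else gen G w) (by
    have key : ∀ x y, G.Adj x y → x ∈ C → y ∉ C →
        lt G v b * gen G x * (lt G v b)⁻¹ * gen G y = gen G y * (lt G v b * gen G x * (lt G v b)⁻¹) := by
      intro x y hxy hx hy
      have h1 : y ∈ star G v := (hC.2 x hx y hxy).resolve_left hy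
      have c1 : Commute (gen G y) (lt G v b) := star_comm h1 b
      have c2 : Commute (gen G y) (gen G x) := (gen_comm hxy).symm
      exact ((c1.mul_right c2).mul_right c1.inv_right).symm.eq
    intro x y hxy
    by_cases hx : x ∈ C <;> by_cases hy : y ∈ C
    · simp only [hx, hy, if_true]
      have := gen_comm hxy
      calc _ = lt G v b * (gen G x * gen G y) * (lt G v b)⁻¹ := by group
        _ = _ := by rw [this]; group
    · simp only [hx, hy, if_true, if_false]; exact key x y hxy hx hy
    · simp only [hx, hy, if_true, if_false]; exact (key y x hxy.symm hy hx).symm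
    · simp only [hx, hy, if_false]; exact gen_comm hxy)

theorem gpcHom_in {v : V} {b : Bool} {C : Set V} (hC : Clos G v C) {w : V} (hw : w ∈ C) :
    gpcHom v b C hC (gen G w) = lt G v b * gen G w * (lt G v b)⁻¹ := by
  simp [gpcHom, hw]
theorem gpcHom_out {v : V} {b : Bool} {C : Set V} (hC : Clos G v C) {w : V} (hw : w ∉ C) :
    gpcHom v b C hC (gen G w) = gen G w := by
  simp [gpcHom, hw]
theorem gpcHom_v {v : V} {b : Bool} {C : Set V} (hC : Clos G v C) (c : Bool) :
    gpcHom v b C hC (lt G v c) = lt G v c := by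
  rw [map_lt, gpcHom_out hC hC.1]; rfl

theorem gpcHom_inv {v : V} {b : Bool} {C : Set V} (hC : Clos G v C) (w : V) :
    gpcHom v (!b) C hC (gpcHom v b C hC (gen G w)) = gen G w := by
  by_cases hw : w ∈ C
  · rw [gpcHom_in hC hw, map_mul, map_mul, map_inv, gpcHom_v, gpcHom_in hC hw, lt_not]; group
  · rw [gpcHom_out hC hw, gpcHom_out hC hw]

noncomputable def gpc (v : V) (b : Bool) (C : Set V) (hC : Clos G v C) : MulAut (RAAG G) :=
  mkAut (gpcHom v b C hC) (gpcHom v (!b) C hC) (gpcHom_inv hC) (by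
    intro w
    have := gpcHom_inv (b := !b) hC w
    rwa [Bool.not_not] at this)

theorem gpc_in {v : V} {b : Bool} {C : Set V} (hC : Clos G v C) {w : V} (hw : w ∈ C) :
    gpc v b C hC (gen G w) = lt G v b * gen G w * (lt G v b)⁻¹ := gpcHom_in hC hw
theorem gpc_out {v : V} {b : Bool} {C : Set V} (hC : Clos G v C) {w : V} (hw : w ∉ C) :
    gpc v b C hC (gen G w) = gen G w := gpcHom_out hC hw
theorem gpc_v {v : V} {b : Bool} {C : Set V} (hC : Clos G v C) (c : Bool) :
    gpc v b C hC (lt G v c) = lt G v c := gpcHom_v hC c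

/-- the component of `c` in `Γ - st v` -/
def compOf (G : SimpleGraph V) (v c : V) (hc : c ∈ stComp G v) : Set V :=
  Subtype.val '' ((G.induce (stComp G v)).connectedComponentMk ⟨c, hc⟩).supp

theorem compOf_isCompOf (v c : V) (hc) : IsCompOf G v (compOf G v c hc) := ⟨_, rfl⟩

theorem mem_compOf {v c d : V} {hc : c ∈ stComp G v} : d ∈ compOf G v c hc ↔
    ∃ hd : d ∈ stComp G v, (G.induce (stComp G v)).Reachable ⟨d, hd⟩ ⟨c, hc⟩ := by
  simp only [compOf, Set.mem_image, SimpleGraph.ConnectedComponent.mem_supp_iff,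
    SimpleGraph.ConnectedComponent.eq]
  constructor
  · rintro ⟨⟨x, hx⟩, h, rfl⟩; exact ⟨hx, h⟩
  · rintro ⟨hd, h⟩; exact ⟨⟨d, hd⟩, h, rfl⟩

theorem compOf_self {v c : V} {hc : c ∈ stComp G v} : c ∈ compOf G v c hc :=
  mem_compOf.2 ⟨hc, SimpleGraph.Reachable.refl _⟩

theorem compOf_adj {v c : V} {hc : c ∈ stComp G v} {x d : V} (hx : x ∈ compOf G v c hc)
    (hd : d ∈ stComp G v) (h : G.Adj x d) : d ∈ compOf G v c hc := by
  obtain ⟨h1, h2⟩ := mem_compOf.1 hx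
  refine mem_compOf.2 ⟨hd, ?_⟩
  have : (G.induce (stComp G v)).Adj ⟨d, hd⟩ ⟨x, h1⟩ := h.symm
  exact this.reachable.trans h2

theorem compOf_ind {v c : V} {hc : c ∈ stComp G v} {p : V → Prop} (h0 : p c)
    (hs : ∀ x d, x ∈ stComp G v → d ∈ stComp G v → G.Adj x d → p x → p d) {d : V}
    (hd : d ∈ compOf G v c hc) : p d := by
  obtain ⟨h1, ⟨W⟩⟩ := mem_compOf.1 hd
  have : ∀ (a b : stComp G v), (G.induce (stComp G v)).Walk a b → p b → p a := by
    intro a b W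
    induction W with
    | nil => exact id
    | @cons x y z h W ih =>
      intro hp
      exact hs y x y.2 x.2 (G.adj_symm h) (ih hp)
  exact this _ _ W h0

theorem isCompOf_clos {v : V} {C : Set V} (h : IsCompOf G v C) : Clos G v C := by
  obtain ⟨c, rfl⟩ := h
  induction c using SimpleGraph.ConnectedComponent.ind with
  | _ x =>
  obtain ⟨x, hx⟩ := x
  change Clos G v (compOf G v x hx)
  refine ⟨?_, ?_⟩
  · intro hv
    obtain ⟨h1, _⟩ := mem_compOf.1 hv
    exact h1 (Set.mem_insert _ _)
  · intro c hc d hd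
    by_cases h : d ∈ star G v
    · exact Or.inr h
    · exact Or.inl (compOf_adj hc h hd)

theorem pc_mem {ψ : MulAut (RAAG G)} {v : V} {C : Set V} (h : IsCompOf G v C) (b : Bool)
    (h1 : ∀ w ∈ C, ψ (gen G w) = lt G v b * gen G w * (lt G v b)⁻¹)
    (h2 : ∀ w ∉ C, ψ (gen G w) = gen G w) : ψ ∈ AutS G := by
  have hv := (isCompOf_clos h).1
  cases b
  · rw [← inv_mem_iff]
    refine Subgroup.subset_closure (Or.inr ⟨v, C, h, ?_, ?_⟩)
    · intro w hw
      apply inv_apply_eq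
      rw [map_mul, map_mul, map_inv, h1 w hw, h2 v hv]; simp [mul_assoc]
    · intro w hw; exact inv_apply_eq (h2 w hw)
  · exact Subgroup.subset_closure (Or.inr ⟨v, C, h, h1, h2⟩)

theorem gpc_mem_aux [Finite V] (v : V) (b : Bool) (n : ℕ) : ∀ (C : Set V) (hC : Clos G v C),
    Disjoint C (star G v) → C.ncard = n → gpc v b C hC ∈ AutS G := by
  induction n using Nat.strong_induction_on with
  | _ n ih =>
    intro C hC hd hn
    by_cases hne : C = ∅
    · have : gpc v b C hC = 1 := by
        apply aut_ext; intro w; rw [gpc_out hC (by simp [hne])]; rfl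
      rw [this]; exact one_mem _
    · obtain ⟨c, hc⟩ := Set.nonempty_iff_ne_empty.2 hne
      have hcs : c ∈ stComp G v := Set.disjoint_left.1 hd hc
      let D := compOf G v c hcs
      have hDC : D ⊆ C := by
        intro d hd'
        refine compOf_ind (p := fun d => d ∈ C) hc ?_ hd'
        intro x d hx hds hxd hxC
        exact (hC.2 x hxC d hxd).resolve_right hds
      have hD : Clos G v D := isCompOf_clos (compOf_isCompOf v c hcs)
      have hE : Clos G v (C \ D) := by
        refine ⟨fun h => hC.1 h.1, ?_⟩
        intro x hx d hxd
        by_cases hds : d ∈ star G v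
        · exact Or.inr hds
        · left
          refine ⟨(hC.2 x hx.1 d hxd).resolve_right hds, fun hdD => hx.2 ?_⟩
          exact compOf_adj hdD (Set.disjoint_left.1 hd hx.1) hxd.symm
      have h1 : gpc v b D hD ∈ AutS G := pc_mem (compOf_isCompOf v c hcs) b
        (fun w hw => gpc_in hD hw) (fun w hw => gpc_out hD hw)
      have h2 : gpc v b (C \ D) hE ∈ AutS G := by
        refine ih _ ?_ _ hE (hd.mono_left Set.diff_subset) rfl
        rw [← hn]
        exact Set.ncard_lt_ncard (Set.ssubset_iff_subset_ne.2 ⟨Set.diff_subset, fun e => by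
          have : c ∈ C \ D := by rw [e]; exact hc
          exact this.2 compOf_self⟩) (Set.toFinite C)
      have : gpc v b C hC = gpc v b D hD * gpc v b (C \ D) hE := by
        apply aut_ext; intro w
        rw [MulAut.mul_apply]
        by_cases hw : w ∈ D
        · rw [gpc_out hE (fun h => h.2 hw), gpc_in hD hw, gpc_in hC (hDC hw)]
        · by_cases hwC : w ∈ C
          · rw [gpc_in hE ⟨hwC, hw⟩, gpc_in hC hwC, map_mul, map_mul, map_inv, gpc_v,
              gpc_out hD hw]
          · rw [gpc_out hE (fun h => hwC h.1), gpc_out hD hw, gpc_out hC hwC]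
      rw [this]; exact mul_mem h1 h2

theorem gpc_mem [Finite V] {ψ : MulAut (RAAG G)} {v : V} {C : Set V} (hC : Clos G v C) (b : Bool)
    (h1 : ∀ w ∈ C, ψ (gen G w) = lt G v b * gen G w * (lt G v b)⁻¹)
    (h2 : ∀ w ∉ C, ψ (gen G w) = gen G w) : ψ ∈ AutS G := by
  have hE : Clos G v (C \ star G v) := by
    refine ⟨fun h => hC.1 h.1, ?_⟩
    intro x hx d hxd
    by_cases hds : d ∈ star G v
    · exact Or.inr hds
    · exact Or.inl ⟨(hC.2 x hx.1 d hxd).resolve_right hds, hds⟩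
  have : ψ = gpc v b (C \ star G v) hE := by
    apply aut_ext; intro w
    by_cases hw : w ∈ C
    · rw [h1 w hw]
      by_cases hs : w ∈ star G v
      · rw [gpc_out hE (fun h => h.2 hs), ← star_comm hs]; simp
      · rw [gpc_in hE ⟨hw, hs⟩]
    · rw [gpc_out hE (fun h => hw h.1), h2 w hw]
  rw [this]
  exact gpc_mem_aux v b _ _ hE Set.disjoint_sdiff_left rfl

theorem conj_mem [Finite V] (x : RAAG G) : MulAut.conj x ∈ AutS G := by
  induction x using ind_left with
  | one => rw [map_one]; exact one_mem _
  | step v b g ih =>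
    rw [map_mul]
    refine mul_mem ?_ ih
    refine gpc_mem (v := v) (C := {v}ᶜ) ⟨by simp, ?_⟩ b ?_ ?_
    · intro c hc d hd
      by_cases h : d = v
      · right; rw [h]; exact Set.mem_insert _ _
      · left; exact h
    · intro w hw; rfl
    · intro w hw
      have : w = v := by simpa using hw
      subst this
      rw [MulAut.conj_apply]
      cases b <;> simp

/-! ### The normalizer -/

abbrev NN (G : SimpleGraph V) : Subgroup (MulAut (RAAG G)) := Subgroup.normalizer (AutS G : Set _)

theorem norm_of {σ : MulAut (RAAG G)}
    (h1 : ∀ τ, IsTransvection τ ∨ IsPartialConj τ → σ * τ * σ⁻¹ ∈ AutS G)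
    (h2 : ∀ τ, IsTransvection τ ∨ IsPartialConj τ → σ⁻¹ * τ * σ ∈ AutS G) : σ ∈ NN G := by
  have key : ∀ ρ : MulAut (RAAG G), (∀ τ, IsTransvection τ ∨ IsPartialConj τ → ρ * τ * ρ⁻¹ ∈ AutS G) →
      ∀ τ ∈ AutS G, ρ * τ * ρ⁻¹ ∈ AutS G := by
    intro ρ h τ hτ
    have : AutS G ≤ (AutS G).comap (MulAut.conj ρ).toMonoidHom := by
      refine (Subgroup.closure_le _).2 ?_
      intro τ hτ
      exact h τ hτ
    exact this hτ
  rw [Subgroup.mem_normalizer_iff]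
  intro τ
  refine ⟨key σ h1 τ, fun h => ?_⟩
  have := key σ⁻¹ (by simpa using h2) _ h
  simpa [mul_assoc] using this

theorem AutS_le_NN : AutS G ≤ NN G := Subgroup.le_normalizer

open Classical in
noncomputable def ivHom (G : SimpleGraph V) (v : V) : RAAG G →* RAAG G :=
  lift (fun w => if w = v then (gen G w)⁻¹ else gen G w) (by
    intro x y h
    have c : Commute (gen G x) (gen G y) := gen_comm h
    show Commute _ _
    by_cases hx : x = v <;> by_cases hy : y = v <;> simp [hx, hy] <;> simp_all)

theorem ivHom_self (v : V) : ivHom G v (gen G v) = (gen G v)⁻¹ := by simp [ivHom]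
theorem ivHom_ne {v w : V} (h : w ≠ v) : ivHom G v (gen G w) = gen G w := by simp [ivHom, h]
theorem ivHom_ivHom (v w : V) : ivHom G v (ivHom G v (gen G w)) = gen G w := by
  by_cases h : w = v
  · subst h; simp [ivHom_self]
  · simp [ivHom_ne h]

noncomputable def iv (G : SimpleGraph V) (v : V) : MulAut (RAAG G) :=
  mkAut (ivHom G v) (ivHom G v) (ivHom_ivHom v) (ivHom_ivHom v)

theorem iv_self (v : V) : iv G v (gen G v) = (gen G v)⁻¹ := ivHom_self v
theorem iv_ne {v w : V} (h : w ≠ v) : iv G v (gen G w) = gen G w := ivHom_ne h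
theorem iv_inv (v : V) : (iv G v)⁻¹ = iv G v := rfl
theorem iv_lt (v w : V) (b : Bool) : ∃ c, iv G v (lt G w b) = lt G w c := by
  by_cases h : w = v
  · subst h; cases b
    · exact ⟨true, by simp [iv_self]⟩
    · exact ⟨false, by simp [iv_self]⟩
  · refine ⟨b, ?_⟩
    cases b <;> simp [iv_ne h]

theorem iv_mem [Finite V] (v : V) : iv G v ∈ NN G := by
  have key : ∀ τ, IsTransvection τ ∨ IsPartialConj τ → iv G v * τ * iv G v ∈ AutS G := by
    rintro τ (⟨a, b, hab, hl, ⟨h1, h2⟩ | ⟨h1, h2⟩⟩ | ⟨a, C, hC, h1, h2⟩)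
    · obtain ⟨c, hc⟩ := iv_lt (G := G) v b true
      rw [lt_true] at hc
      by_cases ha : a = v
      · subst ha
        refine tvL_mem hab hl (!c) ?_ ?_
        · simp only [MulAut.mul_apply, iv_self, map_inv, h1, map_mul, hc, mul_inv_rev, inv_inv, lt_not]
        · intro w hw
          simp only [MulAut.mul_apply, iv_ne hw, h2 w hw]
      · refine tvR_mem hab hl c ?_ ?_
        · simp only [MulAut.mul_apply, iv_ne ha, h1, map_mul, hc]
        · intro w hw
          by_cases hwv : w = v
          · subst hwv; simp only [MulAut.mul_apply, iv_self, map_inv, h2 w hw, inv_inv]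
          · simp only [MulAut.mul_apply, iv_ne hwv, h2 w hw]
    · obtain ⟨c, hc⟩ := iv_lt (G := G) v b true
      rw [lt_true] at hc
      by_cases ha : a = v
      · subst ha
        refine tvR_mem hab hl (!c) ?_ ?_
        · simp only [MulAut.mul_apply, iv_self, map_inv, h1, map_mul, hc, mul_inv_rev, inv_inv, lt_not]
        · intro w hw
          simp only [MulAut.mul_apply, iv_ne hw, h2 w hw]
      · refine tvL_mem hab hl c ?_ ?_
        · simp only [MulAut.mul_apply, iv_ne ha, h1, map_mul, hc]
        · intro w hw
          by_cases hwv : w = v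
          · subst hwv; simp only [MulAut.mul_apply, iv_self, map_inv, h2 w hw, inv_inv]
          · simp only [MulAut.mul_apply, iv_ne hwv, h2 w hw]
    · obtain ⟨c, hc⟩ := iv_lt (G := G) v a true
      rw [lt_true] at hc
      refine gpc_mem (isCompOf_clos hC) c ?_ ?_
      · intro w hw
        by_cases hwv : w = v
        · subst hwv; simp only [MulAut.mul_apply, iv_self, map_inv, map_mul, h1 w hw, inv_inv, hc,
            mul_inv_rev, mul_assoc]
        · simp only [MulAut.mul_apply, iv_ne hwv, map_inv, map_mul, h1 w hw, hc]
      · intro w hw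
        by_cases hwv : w = v
        · subst hwv; simp only [MulAut.mul_apply, iv_self, map_inv, h2 w hw, inv_inv]
        · simp only [MulAut.mul_apply, iv_ne hwv, h2 w hw]
  exact norm_of key key

def gaHom (π : G ≃g G) : RAAG G →* RAAG G :=
  lift (fun w => gen G (π w)) (fun x y h => gen_comm (π.map_adj_iff.2 h))

def ga (π : G ≃g G) : MulAut (RAAG G) :=
  mkAut (gaHom π) (gaHom π.symm) (by intro v; simp [gaHom]) (by intro v; simp [gaHom])

@[simp] theorem ga_gen (π : G ≃g G) (v : V) : ga π (gen G v) = gen G (π v) := by simp [ga, gaHom]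
theorem ga_inv (π : G ≃g G) : (ga π)⁻¹ = ga π.symm := by
  apply aut_ext; intro v
  apply inv_apply_eq; simp

theorem ga_star (π : G ≃g G) {v w : V} : π w ∈ star G (π v) ↔ w ∈ star G v := by
  simp [mem_star, π.map_adj_iff]

theorem ga_mem [Finite V] (π : G ≃g G) : ga π ∈ NN G := by
  have key : ∀ (π : G ≃g G) τ, IsTransvection τ ∨ IsPartialConj τ → ga π * τ * (ga π)⁻¹ ∈ AutS G := by
    intro π τ hτ
    rw [ga_inv]
    have hl' : ∀ a b, LkLeSt G a b → LkLeSt G (π a) (π b) := by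
      intro a b h x hx
      have : π.symm x ∈ star G b := h (by
        have h2 : G.Adj (π a) x := hx
        rw [← π.apply_symm_apply x, π.map_adj_iff] at h2; exact h2)
      rw [← ga_star π, π.apply_symm_apply] at this
      exact this
    rcases hτ with (⟨a, b, hab, hl, ⟨h1, h2⟩ | ⟨h1, h2⟩⟩ | ⟨a, C, hC, h1, h2⟩)
    · refine tvR_mem (a := π a) (b := π b) (by simpa using hab) (hl' a b hl) true ?_ ?_
      · simp [MulAut.mul_apply, h1]
      · intro w hw
        have : π.symm w ≠ a := fun e => hw (by rw [← e]; simp)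
        simp [MulAut.mul_apply, h2 _ this]
    · refine tvL_mem (a := π a) (b := π b) (by simpa using hab) (hl' a b hl) true ?_ ?_
      · simp [MulAut.mul_apply, h1]
      · intro w hw
        have : π.symm w ≠ a := fun e => hw (by rw [← e]; simp)
        simp [MulAut.mul_apply, h2 _ this]
    · have hc := isCompOf_clos hC
      refine gpc_mem (v := π a) (C := {w | π.symm w ∈ C}) ⟨by simpa using hc.1, ?_⟩ true ?_ ?_
      · intro c hcC d hcd
        have := hc.2 _ hcC (π.symm d) (π.symm.map_adj_iff.2 hcd)
        rwa [← ga_star π, π.apply_symm_apply] at this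
      · intro w hw
        have : π.symm w ∈ C := hw
        simp [MulAut.mul_apply, h1 _ this]
      · intro w hw
        have : π.symm w ∉ C := hw
        simp [MulAut.mul_apply, h2 _ this]
  refine norm_of (key π) ?_
  have := key π.symm
  rw [← ga_inv, inv_inv] at this
  exact this

end RG

end

section
namespace RG
open scoped Pointwise
universe u
variable {V : Type u} {G : SimpleGraph V}

theorem par_star_decomp {v : V} {s : RAAG G} (hs : s ∈ par G (star G v)) :
    ∃ k : ℤ, ∃ s' ∈ par G (lk G v), s = gen G v ^ k * s' := by
  refine par_ind (p := fun s => ∃ k : ℤ, ∃ s' ∈ par G (lk G v), s = gen G v ^ k * s')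
    ⟨0, 1, one_mem _, by simp⟩ ?_ hs
  rintro w hw b g hg ⟨k, s', hs', rfl⟩
  rcases hw with rfl | hw
  · cases b
    · exact ⟨k - 1, s', hs', by simp only [lt_false, ← mul_assoc]; congr 1; group⟩
    · exact ⟨k + 1, s', hs', by simp only [lt_true, ← mul_assoc]; congr 1; group⟩
  · refine ⟨k, lt G w b * s', mul_mem (lt_mem hw b) hs', ?_⟩
    have : Commute (lt G w b) (gen G v) := by
      have := lt_comm (G := G) (u := w) (v := v) (SimpleGraph.Adj.symm hw) b true
      rw [lt_true] at this; exact this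
    rw [← mul_assoc, ← mul_assoc, (this.zpow_right k).eq]

theorem par_lk_of_star {v : V} {s : RAAG G} (hs : s ∈ par G (star G v)) (h0 : ex v s = 0) :
    s ∈ par G (lk G v) := by
  obtain ⟨k, s', hs', rfl⟩ := par_star_decomp hs
  have h1 : ex v s' = 0 := ex_par (fun h => G.loopless.irrefl v h) hs'
  have : k = 0 := by simpa [h1] using h0
  subst this; simpa using hs'

theorem cross_split [Finite V] {h : RAAG G} {v : V} {b : Bool} (h1 : (1 : RAAG G) ∉ h • H G v b) :
    ∀ (n : ℕ) (g : RAAG G), len g = n → g ∈ h • H G v b →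
    ∃ x k, g = x * lt G v b * k ∧ len x + len k + 1 ≤ len g ∧ h⁻¹ * x ∈ par G (lk G v) := by
  intro n
  induction n with
  | zero => intro g hg hgE; rw [len_eq_zero] at hg; subst hg; exact absurd hgE h1
  | succ n ih =>
    intro g hg hgE
    have hne : g ≠ 1 := by rintro rfl; rw [len_one] at hg; omega
    obtain ⟨w, c, y, rfl, hl⟩ := exists_last hne
    by_cases hy : y ∈ h • H G v b
    · obtain ⟨x, k, rfl, hk, hx⟩ := ih y (by omega) hy
      refine ⟨x, k * lt G w c, by group, ?_, hx⟩
      have := len_mul_le k (lt G w c)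
      rw [len_lt] at this; omega
    · obtain ⟨rfl, rfl, h3, h4⟩ := hs_cross hy hgE
      exact ⟨y, 1, by simp, by rw [len_one]; omega, h3⟩

section
variable [Finite V]
/-- the conjugators of a conjugating automorphism -/
def CB (φ : MulAut (RAAG G)) (v : V) (h : RAAG G) : Prop := φ (gen G v) = h * gen G v * h⁻¹

theorem CB.map_lt {φ : MulAut (RAAG G)} {v : V} {h : RAAG G} (hh : CB φ v h) (b : Bool) :
    φ (lt G v b) = h * lt G v b * h⁻¹ := by
  have := hh; unfold CB at this
  cases b <;> simp [this, mul_assoc]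

theorem CB.diff {φ : MulAut (RAAG G)} {v : V} {h k : RAAG G} (hh : CB φ v h) (hk : CB φ v k) :
    h⁻¹ * k ∈ par G (star G v) := by
  rw [← cent_iff]
  unfold CB at hh hk
  rw [hh] at hk
  have : gen G v = h⁻¹ * k * gen G v * (k⁻¹ * h) := by
    calc gen G v = h⁻¹ * (h * gen G v * h⁻¹) * h := by group
      _ = _ := by rw [hk]; group
  calc h⁻¹ * k * gen G v = (h⁻¹ * k * gen G v * (k⁻¹ * h)) * (h⁻¹ * k) := by group
    _ = _ := by rw [← this]

theorem CB.mul {φ : MulAut (RAAG G)} {v : V} {h s : RAAG G} (hh : CB φ v h)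
    (hs : s ∈ par G (star G v)) : CB φ v (h * s) := by
  rw [← cent_iff] at hs
  unfold CB at *
  rw [hh]
  calc h * gen G v * h⁻¹ = h * (gen G v * s) * s⁻¹ * h⁻¹ := by group
    _ = _ := by rw [← hs]; group

theorem CB.inter {φ : MulAut (RAAG G)} {c d : V} (ha : G.Adj c d) {h k : RAAG G} (hh : CB φ c h)
    (hk : CB φ d k) : ∃ m, CB φ c m ∧ CB φ d m := by
  set m := h⁻¹ * k with hm
  have h1 : m * gen G d * m⁻¹ ∈ par G (star G c) := by
    rw [← cent_iff]
    have e : φ (gen G d) * φ (gen G c) = φ (gen G c) * φ (gen G d) := by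
      rw [← map_mul, ← map_mul, gen_comm ha]
    rw [show φ (gen G d) = _ from hk, show φ (gen G c) = _ from hh] at e
    calc m * gen G d * m⁻¹ * gen G c = h⁻¹ * (k * gen G d * k⁻¹ * (h * gen G c * h⁻¹)) * h := by
          rw [hm]; group
      _ = _ := by rw [e, hm]; group
  set r := ret G (star G c) m with hr
  have hrm : r ∈ par G (star G c) := ret_mem _ _
  have h2 : r * gen G d * r⁻¹ = m * gen G d * m⁻¹ := by
    rw [← ret_of_mem h1, map_mul, map_mul, map_inv, ret_gen (show d ∈ star G c from Or.inr ha)]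
  have h3 : m⁻¹ * r ∈ par G (star G d) := by
    rw [← cent_iff]
    calc m⁻¹ * r * gen G d = m⁻¹ * (r * gen G d * r⁻¹) * r := by group
      _ = _ := by rw [h2]; group
  refine ⟨h * r, hh.mul hrm, ?_⟩
  have := hk.mul h3
  rwa [hm, show k * ((h⁻¹ * k)⁻¹ * r) = h * r by group] at this

/-- `B_w` is not cut by `v`-walls -/
theorem CB.side {φ : MulAut (RAAG G)} {v w : V} (hw : w ∉ star G v) {E : Set (RAAG G)}
    (hE : IsHS v E) {h k : RAAG G} (hh : CB φ w h) (hk : CB φ w k) : h ∈ E ↔ k ∈ E := by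
  have hs := hh.diff hk
  have hv : v ∉ star G w := by
    rintro (rfl | h)
    · exact hw (Or.inl rfl)
    · exact hw (Or.inr (SimpleGraph.Adj.symm h))
  obtain ⟨g, b, rfl⟩ := hE
  rw [mem_hs, mem_hs, noCross_par hv hs (g⁻¹ * h) b]
  rw [show g⁻¹ * h * (h⁻¹ * k) = g⁻¹ * k by group]

theorem CB.pres {φ : MulAut (RAAG G)} {v w : V} (ha : G.Adj v w) {h k : RAAG G} (hh : CB φ v h)
    (hk : CB φ w k) (b c : Bool) : φ (lt G w c) • h • H G v b = h • H G v b := by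
  rw [stab_hs]
  apply par_lk_of_star
  · rw [← cent_iff]
    have e : φ (lt G w c) * φ (gen G v) = φ (gen G v) * φ (lt G w c) := by
      rw [← map_mul, ← map_mul]
      have := lt_comm (G := G) ha.symm c true
      rw [lt_true] at this; rw [this]
    rw [show φ (gen G v) = _ from hh] at e
    calc h⁻¹ * φ (lt G w c) * h * gen G v = h⁻¹ * (φ (lt G w c) * (h * gen G v * h⁻¹)) * h := by group
      _ = _ := by rw [e]; group
  · rw [hk.map_lt c]
    have : ex v (lt G w c) = 0 := by
      cases c <;> simp [ex_gen_ne ha.ne']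
    simp [this]

theorem pingpong {φ : MulAut (RAAG G)} {g : V → RAAG G} (hg : ∀ v, CB φ v (g v))
    (hmin : ∀ v b, (1 : RAAG G) ∉ g v • H G v b)
    (h0 : ∀ v w b, w ∉ star G v → g w ∉ g v • H G v b) (x : RAAG G) :
    ∀ v b, x ∈ H G v b ↔ φ x ∈ g v • H G v b := by
  induction x using ind_red with
  | one => intro v b; simp only [map_one]; exact iff_of_false (one_notMem v b) (hmin v b)
  | step w c y hd ih =>
    have hin : lt G w c * y ∈ H G w c := H_flip.2 hd
    have hφ : φ (lt G w c * y) ∈ g w • H G w c := by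
      rw [map_mul, (hg w).map_lt, mem_hs]
      rw [show (g w)⁻¹ * (g w * lt G w c * (g w)⁻¹ * φ y) = lt G w c * ((g w)⁻¹ * φ y) by group]
      rw [H_flip, ← mem_hs, ← ih]; exact hd
    intro v b
    by_cases hvw : v = w
    · subst hvw
      constructor
      · intro h; rwa [H_sign h hin]
      · intro h; rw [mem_hs] at h hφ; rwa [H_sign h hφ]
    · by_cases ha : G.Adj v w
      · rw [H_adj ha, ih, map_mul]
        conv_rhs => rw [← (hg v).pres ha (hg w) b c]
        conv_rhs => rw [mem_sm, inv_mul_cancel_left]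
      · have hwv : w ∉ star G v := by rintro (h | h); exacts [hvw h.symm, ha h]
        have hvw' : v ∉ star G w := by rintro (h | h); exacts [hvw h, ha h.symm]
        refine iff_of_false (fun h => H_nadj hvw ha h hin) (fun h => ?_)
        rcases nested ha (E := g v • H G v b) (F := g w • H G w c) ⟨_, _, rfl⟩ ⟨_, _, rfl⟩ with
          h1 | h1 | h1 | h1
        · have h2 := h1 (mem_base _ _ _)
          rw [← IsHS.noCross_lt (Ne.symm hvw) ⟨_, _, rfl⟩] at h2
          exact h0 _ _ _ hvw' h2
        · have h2 := h1 (mem_base _ _ _)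
          rw [← IsHS.noCross_lt hvw ⟨_, _, rfl⟩] at h2
          exact h0 _ _ _ hwv h2
        · exact Set.disjoint_left.1 h1 h hφ
        · have : g w ∈ g v • H G v b ∪ g w • H G w c := h1 ▸ Set.mem_univ _
          exact this.elim (h0 _ _ _ hwv) (notMem_base _ _ _)

end

theorem conj_aut_mem [Fintype V] (n : ℕ) : ∀ (φ : MulAut (RAAG G)) (g : V → RAAG G),
    (∀ v, CB φ v (g v)) → ∑ v, len (g v) = n → φ ∈ AutS G := by
  classical
  induction n using Nat.strong_induction_on with
  | _ n ih =>
  intro φ g hg hn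
  by_cases hmin : ∀ v h, CB φ v h → len (g v) ≤ len h
  swap
  · push Not at hmin
    obtain ⟨v, h, hh, hl⟩ := hmin
    refine ih (∑ w, len (Function.update g v h w)) ?_ φ (Function.update g v h) ?_ rfl
    · rw [← hn]
      apply Finset.sum_lt_sum
      · intro w _
        by_cases hw : w = v
        · subst hw; simpa using hl.le
        · simp [hw]
      · exact ⟨v, Finset.mem_univ _, by simpa using hl⟩
    · intro w
      by_cases hw : w = v
      · subst hw; simpa using hh
      · simpa [hw] using hg w
  have h1n : ∀ v b, (1 : RAAG G) ∉ g v • H G v b := by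
    intro v b h
    rw [mem_hs, mul_one] at h
    have h2 := len_pop h
    have h3 : CB φ v (g v * lt G v b) := (hg v).mul (lt_mem (show v ∈ star G v from Or.inl rfl) b)
    have h4 := hmin v _ h3
    rw [← len_inv (g v), ← len_inv (g v * lt G v b), mul_inv_rev] at h4
    omega
  by_cases h0 : ∃ v w b, w ∉ star G v ∧ g w ∈ g v • H G v b
  · obtain ⟨v, w, b, hw, hwD⟩ := h0
    let C : Set V := {c | c ∉ star G v ∧ g c ∈ g v • H G v b}
    have hC : Clos G v C := by
      refine ⟨fun h => h.1 (Or.inl rfl), ?_⟩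
      intro x hx d hxd
      by_cases hds : d ∈ star G v
      · exact Or.inr hds
      · left
        refine ⟨hds, ?_⟩
        obtain ⟨m, hm1, hm2⟩ := (hg x).inter hxd (hg d)
        rw [← CB.side hds ⟨_, _, rfl⟩ hm2 (hg d), ← CB.side hx.1 ⟨_, _, rfl⟩ (hg x) hm1]
        exact hx.2
    have key : ∀ c, ∃ k, CB (φ * gpc v (!b) C hC) c k ∧ len k ≤ len (g c) ∧
        (c ∈ C → len k < len (g c)) := by
      intro c
      by_cases hc : c ∈ C
      · obtain ⟨x, k, e, hl, hx⟩ := cross_split (h1n v b) _ (g c) rfl hc.2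
        refine ⟨x * k, ?_, ?_, ?_⟩
        · unfold CB
          rw [MulAut.mul_apply, gpc_in hC hc, map_mul, map_mul, map_inv, (hg v).map_lt,
            show φ (gen G c) = _ from hg c]
          have h5 := par_lk_comm hx b
          have h6 : g v * lt G v (!b) * (g v)⁻¹ * g c = x * k := by
            rw [e, lt_not]
            calc g v * (lt G v b)⁻¹ * (g v)⁻¹ * (x * lt G v b * k)
                = g v * (lt G v b)⁻¹ * ((g v)⁻¹ * x * lt G v b) * k := by group
              _ = _ := by rw [h5]; group
          rw [← h6]; group
        · have := len_mul_le x k; omega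
        · intro _; have := len_mul_le x k; omega
      · refine ⟨g c, ?_, le_rfl, fun h => absurd h hc⟩
        unfold CB
        rw [MulAut.mul_apply, gpc_out hC hc]; exact hg c
    choose k hk1 hk2 hk3 using key
    have h7 : φ * gpc v (!b) C hC ∈ AutS G := by
      refine ih (∑ c, len (k c)) ?_ _ k hk1 rfl
      rw [← hn]
      exact Finset.sum_lt_sum (fun c _ => hk2 c) ⟨w, Finset.mem_univ _, hk3 w ⟨hw, hwD⟩⟩
    have h8 : gpc v (!b) C hC ∈ AutS G :=
      gpc_mem hC (!b) (fun w hw => gpc_in hC hw) (fun w hw => gpc_out hC hw)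
    exact (Subgroup.mul_mem_cancel_right _ h8).1 h7
  · push Not at h0
    have pp := pingpong hg h1n (fun v w b => h0 v w b)
    have all1 : ∀ w, g w = 1 := by
      intro w
      by_contra hne
      obtain ⟨y, b, hy⟩ := exists_first hne
      obtain ⟨q, hq⟩ := φ.surjective (lt G y b)
      have hq1 : q ≠ 1 := by
        rintro rfl
        rw [map_one] at hq
        exact one_notMem (G := G) y b (hq ▸ lt_self_mem y b)
      obtain ⟨u', δ, hu⟩ := exists_first hq1
      have h2 := (pp q u' δ).1 hu
      rw [hq, ← one_mul (lt G y b)] at h2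
      obtain ⟨e1, e2, h3, h4⟩ := hs_cross (h1n u' δ) h2
      subst e1; subst e2
      rw [one_smul] at h4
      have hyD : g w ∈ g y • H G y b := by rw [h4]; exact hy
      by_cases hwy : w = y
      · subst hwy; exact notMem_base _ _ _ hyD
      · by_cases ha : G.Adj y w
        · have h5 : CB φ w ((lt G y b)⁻¹ * g w) := by
            have h6 : φ (lt G y b) = lt G y b := by
              rw [(hg y).map_lt]
              have h7 : g y ∈ par G (lk G y) := by simpa using h3
              rw [par_lk_comm h7]; group
            have h8 : lt G y b * φ (gen G w) = φ (gen G w) * lt G y b := by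
              conv_lhs => rw [← h6]
              conv_rhs => rw [← h6]
              rw [← map_mul, ← map_mul]
              have := lt_comm (G := G) ha b true
              rw [lt_true] at this; rw [this]
            unfold CB
            have h9 := hg w
            unfold CB at h9
            calc φ (gen G w) = (lt G y b)⁻¹ * (lt G y b * φ (gen G w)) := by group
              _ = (lt G y b)⁻¹ * (φ (gen G w) * lt G y b) := by rw [h8]
              _ = _ := by rw [h9]; group
          have h10 := hmin w _ h5
          have h11 := len_pop hy
          omega
        · exact h0 y w b (by rintro (h | h); exacts [hwy h, ha h]) hyD
    have : φ = 1 := by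
      apply aut_ext
      intro v
      have := hg v
      unfold CB at this
      rw [all1 v] at this
      simpa using this
    rw [this]; exact one_mem _

/-- conjugating automorphisms are in `Aut*` -/
theorem conj_aut [Fintype V] {φ : MulAut (RAAG G)}
    (h : ∀ v, ∃ k, φ (gen G v) = k * gen G v * k⁻¹) : φ ∈ AutS G := by
  choose k hk using h
  exact conj_aut_mem _ φ k hk rfl

end RG

end

section
namespace RG
open scoped Pointwise
universe u
variable {V : Type u} {G : SimpleGraph V}

/-! ### The tree structure of a free product -/

structure TS {ι : Type u} (G : SimpleGraph V) (blk : V → ι) (K : Set V) : Prop where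
  adj : ∀ u v, G.Adj u v → blk u = blk v
  sing : ∀ x ∈ K, ∀ y, blk y = blk x → y = x

section
variable {ι : Type u} {blk : V → ι} {K : Set V}

open Classical in
noncomputable def dir (blk : V → ι) (K : Set V) (v : V) (b : Bool) : ι × Bool :=
  if v ∈ K then (blk v, b) else (blk v, true)

def Hd (G : SimpleGraph V) (blk : V → ι) (K : Set V) (e : ι × Bool) : Set (RAAG G) :=
  {g | ∃ v b, dir blk K v b = e ∧ g ∈ H G v b}

inductive Syl (G : SimpleGraph V) (blk : V → ι) (K : Set V) : ι × Bool → ι × Bool → RAAG G → Prop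
  | letter (x : V) (b : Bool) : x ∈ K → Syl G blk K (blk x, b) (blk x, !b) (lt G x b)
  | block (i : ι) (s : RAAG G) : (∀ v, blk v = i → v ∉ K) → s ∈ par G {v | blk v = i} → s ≠ 1 →
      Syl G blk K (i, true) (i, true) s

theorem dir_K {x : V} (hx : x ∈ K) (b : Bool) : dir blk K x b = (blk x, b) := by simp [dir, hx]
theorem dir_N {x : V} (hx : x ∉ K) (b : Bool) : dir blk K x b = (blk x, true) := by simp [dir, hx]
theorem dir_fst (x : V) (b : Bool) : (dir blk K x b).1 = blk x := by
  unfold dir; split_ifs <;> rfl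

theorem one_notMem_Hd (e : ι × Bool) : (1 : RAAG G) ∉ Hd G blk K e := by
  rintro ⟨v, b, -, h⟩; exact one_notMem v b h

theorem TS.H_blk (ts : TS G blk K) {g : RAAG G} {v w : V} {b c : Bool} (h1 : g ∈ H G v b)
    (h2 : g ∈ H G w c) : blk v = blk w := by
  by_cases hvw : v = w
  · rw [hvw]
  · by_cases ha : G.Adj v w
    · exact ts.adj _ _ ha
    · exact absurd h2 (H_nadj hvw ha h1)

theorem TS.Hd_unique (ts : TS G blk K) {g : RAAG G} {e e' : ι × Bool} (h1 : g ∈ Hd G blk K e)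
    (h2 : g ∈ Hd G blk K e') : e = e' := by
  obtain ⟨v, b, rfl, hv⟩ := h1
  obtain ⟨w, c, rfl, hw⟩ := h2
  have hb := ts.H_blk hv hw
  by_cases hvK : v ∈ K
  · have := ts.sing v hvK w hb.symm; subst this
    rw [H_sign hv hw]
  · by_cases hwK : w ∈ K
    · have := ts.sing w hwK v hb; exact absurd (this ▸ hwK) hvK
    · rw [dir_N hvK, dir_N hwK, hb]

theorem exists_dir {g : RAAG G} (h : g ≠ 1) : ∃ e, g ∈ Hd G blk K e := by
  obtain ⟨v, b, hv⟩ := exists_first h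
  exact ⟨_, v, b, rfl, hv⟩

theorem TS.Hd_K (ts : TS G blk K) {x : V} (hx : x ∈ K) {b : Bool} {g : RAAG G} :
    g ∈ Hd G blk K (blk x, b) ↔ g ∈ H G x b := by
  constructor
  · rintro ⟨v, c, he, hv⟩
    have h1 := dir_fst (blk := blk) (K := K) v c
    rw [he] at h1
    have := ts.sing x hx v h1.symm; subst this
    rw [dir_K hx] at he
    rwa [← (Prod.mk.inj he).2]
  · exact fun h => ⟨x, b, dir_K hx b, h⟩

theorem Hd_N {i : ι} (hi : ∀ v, blk v = i → v ∉ K) {b : Bool} {g : RAAG G} :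
    g ∈ Hd G blk K (i, b) ↔ b = true ∧ ∃ v c, blk v = i ∧ g ∈ H G v c := by
  constructor
  · rintro ⟨v, c, he, hv⟩
    have h1 := dir_fst (blk := blk) (K := K) v c
    rw [he] at h1
    rw [dir_N (hi v h1.symm)] at he
    exact ⟨(Prod.mk.inj he).2.symm, v, c, h1.symm, hv⟩
  · rintro ⟨rfl, v, c, h1, hv⟩
    exact ⟨v, c, by rw [dir_N (hi v h1), h1], hv⟩

/-- block factor: multiplying by block elements -/
theorem par_prefix {S : Set V} {s g : RAAG G} (hs : s ∈ par G S)
    (hg : ∀ v ∈ S, ∀ c, g ∉ H G v c) : ∀ v ∈ S, ∀ c, s * g ∈ H G v c ↔ s ∈ H G v c := by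
  refine par_ind_red (p := fun s => ∀ v ∈ S, ∀ c, s * g ∈ H G v c ↔ s ∈ H G v c) ?_ ?_ hs
  · intro v hv c
    rw [one_mul]; exact iff_of_false (hg v hv c) (one_notMem v c)
  · intro x hx a s' hd hs' ih v hv c
    have h1 : lt G x a * s' ∈ H G x a := H_flip.2 hd
    have h2 : lt G x a * s' * g ∈ H G x a := by
      rw [mul_assoc, H_flip, ih x hx]; exact hd
    by_cases hxv : v = x
    · subst hxv
      constructor
      · intro h; rwa [H_sign h h2]
      · intro h; rwa [H_sign h h1]
    · by_cases ha : G.Adj v x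
      · rw [mul_assoc, H_adj ha, H_adj ha, ih v hv]
      · exact iff_of_false (fun h => H_nadj hxv ha h h2) (fun h => H_nadj hxv ha h h1)

/-- stripping a block factor -/
theorem par_strip [Finite V] (S : Set V) (n : ℕ) : ∀ g : RAAG G, len g = n →
    ∃ s ∈ par G S, ∃ g', g = s * g' ∧ ∀ v ∈ S, ∀ c, g' ∉ H G v c := by
  induction n using Nat.strong_induction_on with
  | _ n ih =>
  intro g hn
  by_cases h : ∀ v ∈ S, ∀ c, g ∉ H G v c
  · exact ⟨1, one_mem _, g, by simp, h⟩
  · push Not at h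
    obtain ⟨v, hv, c, hg⟩ := h
    have := len_pop hg
    obtain ⟨s, hs, g', e, h'⟩ := ih _ (by omega) ((lt G v c)⁻¹ * g) rfl
    refine ⟨lt G v c * s, mul_mem (lt_mem hv c) hs, g', ?_, h'⟩
    rw [mul_assoc, ← e]; group

theorem Syl.symm {α β : ι × Bool} {s : RAAG G} (h : Syl G blk K α β s) : Syl G blk K β α s⁻¹ := by
  cases h with
  | letter x b hx =>
    rw [lt_inv]
    have := Syl.letter (G := G) (blk := blk) x (!b) hx
    rwa [Bool.not_not] at this
  | block i s h1 h2 h3 => exact Syl.block i _ h1 (inv_mem h2) (inv_ne_one.2 h3)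

theorem TS.S1 (ts : TS G blk K) {α β : ι × Bool} {s g : RAAG G} (h : Syl G blk K α β s)
    (hg : g ∉ Hd G blk K β) : s * g ∈ Hd G blk K α := by
  cases h with
  | letter x b hx => rw [ts.Hd_K hx] at hg ⊢; exact H_flip.2 hg
  | block i s h1 h2 h3 =>
    rw [Hd_N h1] at hg ⊢
    push Not at hg
    obtain ⟨v, c, hv⟩ := exists_first h3
    have hvi := par_H h2 hv
    exact ⟨rfl, v, c, hvi, (par_prefix h2 (fun v hv c => hg rfl v c hv) v hvi c).2 hv⟩

theorem TS.Syl_mem (ts : TS G blk K) {α β : ι × Bool} {s : RAAG G} (h : Syl G blk K α β s) :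
    s ∈ Hd G blk K α := by
  have := ts.S1 h (one_notMem_Hd β); rwa [mul_one] at this

theorem TS.S2 [Finite V] (ts : TS G blk K) {α : ι × Bool} {g : RAAG G} (h : g ∈ Hd G blk K α) :
    ∃ β s g', Syl G blk K α β s ∧ g = s * g' ∧ g' ∉ Hd G blk K β := by
  obtain ⟨v, b, rfl, hv⟩ := h
  by_cases hK : v ∈ K
  · refine ⟨(blk v, !b), lt G v b, (lt G v b)⁻¹ * g, ?_, by group, ?_⟩
    · rw [dir_K hK]; exact Syl.letter v b hK
    · rw [ts.Hd_K hK]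
      intro h'
      rw [H_flip'] at h'; exact h' hv
  · have hi : ∀ w, blk w = blk v → w ∉ K := fun w hw hwK => by
      have := ts.sing w hwK v hw.symm; exact hK (this ▸ hwK)
    obtain ⟨s, hs, g', e, hg'⟩ := par_strip {w | blk w = blk v} _ g rfl
    refine ⟨(blk v, true), s, g', ?_, e, ?_⟩
    · rw [dir_N hK]
      refine Syl.block _ _ hi hs ?_
      rintro rfl
      rw [one_mul] at e; subst e
      exact hg' v rfl b hv
    · rw [Hd_N hi]
      rintro ⟨-, w, c, hw, hhd⟩
      exact hg' w hw c hhd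

/-- uniqueness of decompositions -/
theorem TS.S4 (ts : TS G blk K) {α β β' : ι × Bool} {s s' g g' : RAAG G} (h : Syl G blk K α β s)
    (h' : Syl G blk K α β' s') (hg : g ∉ Hd G blk K β) (hg' : g' ∉ Hd G blk K β')
    (e : s * g = s' * g') : s = s' ∧ β = β' ∧ g = g' := by
  cases h with
  | letter x b hx =>
    generalize hα : (blk x, b) = α at h'
    cases h' with
    | letter x' b' hx' =>
      have h1 := Prod.mk.inj hα
      have := ts.sing x' hx' x h1.1
      subst this
      have := h1.2; subst this
      exact ⟨rfl, rfl, mul_left_cancel e⟩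
    | block i s h1 h2 h3 =>
      exact absurd hx (h1 x (Prod.mk.inj hα).1)
  | block i s h1 h2 h3 =>
    generalize hα : (i, true) = α at h'
    cases h' with
    | letter x' b' hx' => exact absurd hx' (h1 x' (Prod.mk.inj hα).1.symm)
    | block i' s' h1' h2' h3' =>
      have := (Prod.mk.inj hα).1; subst this
      have hs : s = s' := by
        by_contra hne
        have h4 : Syl G blk K (i, true) (i, true) (s'⁻¹ * s) :=
          Syl.block i _ h1 (mul_mem (inv_mem h2') h2) (fun h => hne (inv_mul_eq_one.1 h).symm)
        have h5 := ts.S1 h4 hg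
        rw [mul_assoc, e, inv_mul_cancel_left] at h5
        exact hg' h5
      subst hs
      exact ⟨rfl, rfl, mul_left_cancel e⟩

/-- syllables with the same end direction multiply -/
theorem TS.Syl_mul (ts : TS G blk K) {α β γ : ι × Bool} {s s' : RAAG G} (h : Syl G blk K α β s)
    (h' : Syl G blk K β γ s') : s * s' = 1 ∨ (Syl G blk K α γ (s * s') ∧ γ = β) := by
  cases h with
  | letter x b hx =>
    generalize hα : (blk x, !b) = α at h'
    cases h' with
    | letter x' b' hx' =>
      have h1 := Prod.mk.inj hα
      have := ts.sing x' hx' x h1.1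
      subst this
      have := h1.2; subst this
      left; simp
    | block i s h1 h2 h3 =>
      exact absurd hx (h1 x (Prod.mk.inj hα).1)
  | block i s h1 h2 h3 =>
    generalize hα : (i, true) = α at h'
    cases h' with
    | letter x' b' hx' => exact absurd hx' (h1 x' (Prod.mk.inj hα).1.symm)
    | block i' s' h1' h2' h3' =>
      have := (Prod.mk.inj hα).1; subst this
      by_cases h0 : s * s' = 1
      · exact Or.inl h0
      · exact Or.inr ⟨Syl.block i _ h1 (mul_mem h2 h2') h0, rfl⟩

inductive TL (G : SimpleGraph V) (blk : V → ι) (K : Set V) : RAAG G → ℕ → Prop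
  | one : TL G blk K 1 0
  | cons (α β : ι × Bool) (s g : RAAG G) (n : ℕ) : Syl G blk K α β s → g ∉ Hd G blk K β →
      TL G blk K g n → TL G blk K (s * g) (n + 1)

theorem TL.pop (ts : TS G blk K) {x : RAAG G} {n : ℕ} (h : TL G blk K x n) {α β : ι × Bool}
    {s g : RAAG G} (hs : Syl G blk K α β s) (hg : g ∉ Hd G blk K β) (e : x = s * g) :
    ∃ m, n = m + 1 ∧ TL G blk K g m := by
  have hx := ts.S1 hs hg
  rw [← e] at hx
  cases h with
  | one => exact absurd hx (one_notMem_Hd α)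
  | cons α' β' s' g' n hs' hg' h' =>
    have hx' := ts.S1 hs' hg'
    have := ts.Hd_unique hx hx'; subst this
    obtain ⟨-, -, rfl⟩ := ts.S4 hs' hs hg' hg e
    exact ⟨n, rfl, h'⟩

theorem TL.unique (ts : TS G blk K) {x : RAAG G} {n : ℕ} (h : TL G blk K x n) :
    ∀ {m}, TL G blk K x m → n = m := by
  induction h with
  | one =>
    intro m hm
    generalize hx : (1 : RAAG G) = x at hm
    cases hm with
    | one => rfl
    | cons α β s g n hs hg h' =>
      have := ts.S1 hs hg
      rw [← hx] at this
      exact absurd this (one_notMem_Hd α)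
  | cons α β s g n hs hg h' ih =>
    intro m hm
    obtain ⟨m', rfl, hm'⟩ := hm.pop ts hs hg rfl
    rw [ih hm']

theorem TL.mul (ts : TS G blk K) [Finite V] {x : RAAG G} {n : ℕ} (h : TL G blk K x n)
    {α β : ι × Bool} {s : RAAG G} (hs : Syl G blk K α β s) :
    ∃ m ≤ n + 1, TL G blk K (s * x) m := by
  by_cases hx : x ∈ Hd G blk K β
  · obtain ⟨γ, s', x', hs', rfl, hx'⟩ := ts.S2 hx
    obtain ⟨m, rfl, hm⟩ := h.pop ts hs' hx' rfl
    rcases ts.Syl_mul hs hs' with h1 | ⟨h1, -⟩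
    · refine ⟨m, by omega, ?_⟩
      rwa [← mul_assoc, h1, one_mul]
    · refine ⟨m + 1, by omega, ?_⟩
      rw [← mul_assoc]
      exact TL.cons _ _ _ _ _ h1 hx' hm
  · exact ⟨n + 1, le_rfl, TL.cons _ _ _ _ _ hs hx h⟩

theorem TS.syl_lt (ts : TS G blk K) (v : V) (b : Bool) :
    ∃ α β, Syl G blk K α β (lt G v b) := by
  by_cases hv : v ∈ K
  · exact ⟨_, _, Syl.letter v b hv⟩
  · refine ⟨_, _, Syl.block (blk v) _ ?_ (lt_mem (S := {w | blk w = blk v}) rfl b) ?_⟩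
    · intro w hw hwK
      have := ts.sing w hwK v hw.symm; exact hv (this ▸ hwK)
    · intro h
      exact one_notMem (G := G) v b (h ▸ lt_self_mem v b)

theorem TS.exists_TL (ts : TS G blk K) [Finite V] (x : RAAG G) : ∃ n, TL G blk K x n := by
  induction x using ind_left with
  | one => exact ⟨0, TL.one⟩
  | step v b g ih =>
    obtain ⟨n, hn⟩ := ih
    obtain ⟨α, β, hs⟩ := ts.syl_lt v b
    obtain ⟨m, -, hm⟩ := hn.mul ts hs
    exact ⟨m, hm⟩

open Classical in
noncomputable def tl (G : SimpleGraph V) (blk : V → ι) (K : Set V) (x : RAAG G) : ℕ :=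
  if h : ∃ n, TL G blk K x n then h.choose else 0

theorem TS.tl_spec (ts : TS G blk K) [Finite V] (x : RAAG G) : TL G blk K x (tl G blk K x) := by
  have h := ts.exists_TL x
  unfold tl; rw [dif_pos h]; exact h.choose_spec

theorem TS.tl_eq (ts : TS G blk K) [Finite V] {x : RAAG G} {n : ℕ} (h : TL G blk K x n) :
    tl G blk K x = n := (ts.tl_spec x).unique ts h

theorem TS.tl_one (ts : TS G blk K) [Finite V] : tl G blk K (1 : RAAG G) = 0 := ts.tl_eq TL.one

theorem TS.tl_cons (ts : TS G blk K) [Finite V] {α β : ι × Bool} {s g : RAAG G}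
    (hs : Syl G blk K α β s) (hg : g ∉ Hd G blk K β) : tl G blk K (s * g) = tl G blk K g + 1 :=
  ts.tl_eq (TL.cons _ _ _ _ _ hs hg (ts.tl_spec g))

theorem TS.tl_cons_le (ts : TS G blk K) [Finite V] {α β : ι × Bool} {s : RAAG G} (g : RAAG G)
    (hs : Syl G blk K α β s) : tl G blk K (s * g) ≤ tl G blk K g + 1 := by
  obtain ⟨m, hm, h⟩ := (ts.tl_spec g).mul ts hs
  rw [ts.tl_eq h]; exact hm

theorem TS.tl_syl (ts : TS G blk K) [Finite V] {α β : ι × Bool} {s : RAAG G}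
    (hs : Syl G blk K α β s) : tl G blk K s = 1 := by
  have := ts.tl_cons hs (one_notMem_Hd β)
  rwa [mul_one, ts.tl_one] at this

/-- induction along reduced syllable decompositions -/
theorem TS.ind (ts : TS G blk K) [Finite V] {p : RAAG G → Prop} (one : p 1)
    (step : ∀ α β s g, Syl G blk K α β s → g ∉ Hd G blk K β → p g → p (s * g)) (x : RAAG G) :
    p x := by
  have := ts.tl_spec x
  revert this
  generalize tl G blk K x = n
  intro h
  induction h with
  | one => exact one
  | cons α β s g n hs hg h ih => exact step α β s g hs hg ih

theorem TS.tl_mul_le (ts : TS G blk K) [Finite V] (x y : RAAG G) :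
    tl G blk K (x * y) ≤ tl G blk K x + tl G blk K y := by
  induction x using ts.ind with
  | one => simp [ts.tl_one]
  | step α β s g hs hg ih =>
    rw [ts.tl_cons hs hg, mul_assoc]
    have := ts.tl_cons_le (g * y) hs
    omega

theorem TS.tl_inv_le (ts : TS G blk K) [Finite V] (x : RAAG G) :
    tl G blk K x⁻¹ ≤ tl G blk K x := by
  induction x using ts.ind with
  | one => simp [ts.tl_one]
  | step α β s g hs hg ih =>
    rw [ts.tl_cons hs hg, mul_inv_rev]
    have := ts.tl_mul_le g⁻¹ s⁻¹
    rw [ts.tl_syl hs.symm] at this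
    omega

theorem TS.tl_inv (ts : TS G blk K) [Finite V] (x : RAAG G) :
    tl G blk K x⁻¹ = tl G blk K x :=
  le_antisymm (ts.tl_inv_le x) (by simpa using ts.tl_inv_le x⁻¹)

/-- two elements with no common direction -/
def Jn (G : SimpleGraph V) (blk : V → ι) (K : Set V) (a b : RAAG G) : Prop :=
  ∀ e, a ∈ Hd G blk K e → b ∉ Hd G blk K e

theorem Jn.symm {a b : RAAG G} (h : Jn G blk K a b) : Jn G blk K b a :=
  fun e h1 h2 => h e h2 h1

theorem TS.tl_jn (ts : TS G blk K) [Finite V] (x : RAAG G) : ∀ y, Jn G blk K x y →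
    tl G blk K (x⁻¹ * y) = tl G blk K x + tl G blk K y := by
  induction x using ts.ind with
  | one => intro y _; simp [ts.tl_one]
  | step α β s g hs hg ih =>
    intro y hy
    rw [ts.tl_cons hs hg]
    have h1 : y ∉ Hd G blk K α := hy α (ts.S1 hs hg)
    have h2 := ts.S1 hs.symm h1
    have := ih (s⁻¹ * y) (fun e he he' => by
      have := ts.Hd_unique h2 he'; subst this; exact hg he)
    rw [ts.tl_cons hs.symm h1] at this
    rw [mul_inv_rev, mul_assoc, this]; omega

end
end RG

end

section
namespace RG
open scoped Pointwise
universe u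
variable {V : Type u} {G : SimpleGraph V}

/-! ### Transvections exist -/

open Classical in
noncomputable def tvHom (a : V) (f : RAAG G → RAAG G)
    (hf : ∀ w, G.Adj a w → f (gen G a) * gen G w = gen G w * f (gen G a)) : RAAG G →* RAAG G :=
  lift (fun w => if w = a then f (gen G a) else gen G w) (by
    intro u v huv
    by_cases hu : u = a
    · by_cases hv : v = a
      · subst hu; subst hv; exact absurd huv (G.loopless.irrefl _)
      · subst hu; simpa [hv] using hf v huv
    · by_cases hv : v = a
      · subst hv; simpa [hu] using (hf u huv.symm).symm
      · simpa [hu, hv] using gen_comm huv)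

theorem tvHom_self (a : V) (f : RAAG G → RAAG G) (hf) :
    tvHom (G := G) a f hf (gen G a) = f (gen G a) := by simp [tvHom]
theorem tvHom_ne {a w : V} (f : RAAG G → RAAG G) (hf) (h : w ≠ a) :
    tvHom (G := G) a f hf (gen G w) = gen G w := by simp [tvHom, h]
theorem tvHom_lt {a w : V} (f : RAAG G → RAAG G) (hf) (h : w ≠ a) (c : Bool) :
    tvHom (G := G) a f hf (lt G w c) = lt G w c := by
  rw [map_lt, tvHom_ne _ _ h]; cases c <;> simp

theorem le_comm {a b w : V} (hl : LkLeSt G a b) (c : Bool) (h : G.Adj a w) :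
    gen G w * lt G b c = lt G b c * gen G w := star_comm (hl h) c

theorem exists_tvR {a b : V} (hab : a ≠ b) (hl : LkLeSt G a b) (c : Bool) :
    ∃ ψ : MulAut (RAAG G), ψ (gen G a) = gen G a * lt G b c ∧ ∀ w ≠ a, ψ (gen G w) = gen G w := by
  have key : ∀ c, ∀ w, G.Adj a w → gen G a * lt G b c * gen G w = gen G w * (gen G a * lt G b c) := by
    intro c w h
    rw [mul_assoc, ← le_comm hl c h, ← mul_assoc, gen_comm h, mul_assoc]
  have inv : ∀ c v, tvHom a (fun g => g * lt G b (!c)) (key (!c))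
      (tvHom a (fun g => g * lt G b c) (key c) (gen G v)) = gen G v := by
    intro c v
    by_cases hv : v = a
    · subst hv
      rw [tvHom_self, map_mul, tvHom_self, tvHom_lt _ _ hab.symm]; simp
    · rw [tvHom_ne _ _ hv, tvHom_ne _ _ hv]
  refine ⟨mkAut (tvHom a (fun g => g * lt G b c) (key c)) (tvHom a (fun g => g * lt G b (!c)) (key (!c)))
    (inv c) (fun v => ?_), ?_, ?_⟩
  · have := inv (!c) v
    simp only [Bool.not_not] at this
    exact this
  · rw [mkAut_apply, tvHom_self]
  · intro w hw; rw [mkAut_apply, tvHom_ne _ _ hw]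

theorem exists_tvL {a b : V} (hab : a ≠ b) (hl : LkLeSt G a b) (c : Bool) :
    ∃ ψ : MulAut (RAAG G), ψ (gen G a) = lt G b c * gen G a ∧ ∀ w ≠ a, ψ (gen G w) = gen G w := by
  have key : ∀ c, ∀ w, G.Adj a w → lt G b c * gen G a * gen G w = gen G w * (lt G b c * gen G a) := by
    intro c w h
    rw [mul_assoc, gen_comm h, ← mul_assoc, ← le_comm hl c h, mul_assoc]
  have inv : ∀ c v, tvHom a (fun g => lt G b (!c) * g) (key (!c))
      (tvHom a (fun g => lt G b c * g) (key c) (gen G v)) = gen G v := by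
    intro c v
    by_cases hv : v = a
    · subst hv
      rw [tvHom_self, map_mul, tvHom_self, tvHom_lt _ _ hab.symm]; simp
    · rw [tvHom_ne _ _ hv, tvHom_ne _ _ hv]
  refine ⟨mkAut (tvHom a (fun g => lt G b c * g) (key c)) (tvHom a (fun g => lt G b (!c) * g) (key (!c)))
    (inv c) (fun v => ?_), ?_, ?_⟩
  · have := inv (!c) v
    simp only [Bool.not_not] at this
    exact this
  · rw [mkAut_apply, tvHom_self]
  · intro w hw; rw [mkAut_apply, tvHom_ne _ _ hw]

/-! ### Slides -/

structure PsiHyp {ι : Type u} (G : SimpleGraph V) (blk : V → ι) (K0 : Set V)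
    (Ψ : Subgroup (MulAut (RAAG G))) : Prop where
  tvr : ∀ x ∈ K0, ∀ y ≠ x, ∀ c, ∀ ψ : MulAut (RAAG G), ψ (gen G x) = gen G x * lt G y c →
    (∀ w ≠ x, ψ (gen G w) = gen G w) → ψ ∈ Ψ
  tvl : ∀ x ∈ K0, ∀ y ≠ x, ∀ c, ∀ ψ : MulAut (RAAG G), ψ (gen G x) = lt G y c * gen G x →
    (∀ w ≠ x, ψ (gen G w) = gen G w) → ψ ∈ Ψ
  pc : ∀ C : Set V, (∀ u v, blk u = blk v → u ∈ C → v ∈ C) → ∀ y ∉ C, ∀ c, ∀ ψ : MulAut (RAAG G),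
    (∀ w ∈ C, ψ (gen G w) = lt G y c * gen G w * (lt G y c)⁻¹) →
    (∀ w ∉ C, ψ (gen G w) = gen G w) → ψ ∈ Ψ
  inv : ∀ x ∈ K0, iv G x ∈ Ψ
  swap : ∀ x ∈ K0, ∀ y ∈ K0, ∃ ψ ∈ Ψ, ψ (gen G x) = gen G y ∧ ∀ w, w ∉ K0 ∨ (w ≠ x ∧ w ≠ y) →
    ψ (gen G w) = gen G w

section
variable {ι : Type u} {blk : V → ι} {K K0 : Set V} {Ψ : Subgroup (MulAut (RAAG G))}

theorem TS.isol (ts : TS G blk K) {x : V} (hx : x ∈ K) (w : V) : ¬ G.Adj x w := by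
  intro h
  have := ts.sing x hx w (ts.adj _ _ h).symm
  subst this; exact G.loopless.irrefl _ h

theorem TS.lk_empty (ts : TS G blk K) {x : V} (hx : x ∈ K) : lk G x = ∅ := by
  ext w; simpa using ts.isol hx w

theorem TS.par_lk (ts : TS G blk K) {x : V} (hx : x ∈ K) {g : RAAG G} (hg : g ∈ par G (lk G x)) :
    g = 1 := by
  rw [ts.lk_empty hx, par_empty] at hg; simpa using hg

theorem TS.le (ts : TS G blk K) {x : V} (hx : x ∈ K) (w : V) : LkLeSt G x w := by
  intro y hy; exact absurd hy (ts.isol hx y)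

theorem TS.mono (ts : TS G blk K0) (h : K ⊆ K0) : TS G blk K :=
  ⟨ts.adj, fun x hx y hy => ts.sing x (h hx) y hy⟩

theorem fix_lt {ψ : MulAut (RAAG G)} {w : V} (h : ψ (gen G w) = gen G w) (c : Bool) :
    ψ (lt G w c) = lt G w c := by cases c <;> simp [h]

theorem fix_par {ψ : MulAut (RAAG G)} {S : Set V} (h : ∀ w ∈ S, ψ (gen G w) = gen G w)
    {g : RAAG G} (hg : g ∈ par G S) : ψ g = g := by
  refine par_ind (p := fun g => ψ g = g) (by simp) ?_ hg
  intro v hv b g hg ih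
  rw [map_mul, ih, fix_lt (h v hv)]

theorem multiL (ts : TS G blk K0) (hp : PsiHyp G blk K0 Ψ) (y : V) (b : Bool) (F : Finset V) :
    (↑F ⊆ K0) → y ∉ F → ∃ ψ ∈ Ψ, (∀ x ∈ F, ψ (gen G x) = lt G y b * gen G x) ∧
      ∀ x ∉ F, ψ (gen G x) = gen G x := by
  classical
  induction F using Finset.induction_on with
  | empty => intro _ _; exact ⟨1, one_mem _, by simp, by simp⟩
  | insert a F ha ih =>
    intro hF hy
    rw [Finset.mem_insert, not_or] at hy
    obtain ⟨ψ, h0, h1, h2⟩ := ih (fun x hx => hF (by simp [Finset.mem_coe.1 hx])) hy.2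
    have haK : a ∈ K0 := hF (by simp)
    obtain ⟨χ, c1, c2⟩ := exists_tvL (Ne.symm hy.1) (ts.le haK y) b
    refine ⟨χ * ψ, mul_mem (hp.tvl a haK y hy.1 b χ c1 c2) h0, ?_, ?_⟩
    · intro x hx
      rw [Finset.mem_insert] at hx
      rcases hx with rfl | hx
      · rw [MulAut.mul_apply, h2 _ ha, c1]
      · have : x ≠ a := by rintro rfl; exact ha hx
        rw [MulAut.mul_apply, h1 _ hx, map_mul, c2 _ this, fix_lt (c2 _ hy.1)]
    · intro x hx
      rw [Finset.mem_insert, not_or] at hx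
      rw [MulAut.mul_apply, h2 _ hx.2, c2 _ hx.1]

theorem multiR (ts : TS G blk K0) (hp : PsiHyp G blk K0 Ψ) (y : V) (b : Bool) (F : Finset V) :
    (↑F ⊆ K0) → y ∉ F → ∃ ψ ∈ Ψ, (∀ x ∈ F, ψ (gen G x) = gen G x * lt G y b) ∧
      ∀ x ∉ F, ψ (gen G x) = gen G x := by
  classical
  induction F using Finset.induction_on with
  | empty => intro _ _; exact ⟨1, one_mem _, by simp, by simp⟩
  | insert a F ha ih =>
    intro hF hy
    rw [Finset.mem_insert, not_or] at hy
    obtain ⟨ψ, h0, h1, h2⟩ := ih (fun x hx => hF (by simp [Finset.mem_coe.1 hx])) hy.2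
    have haK : a ∈ K0 := hF (by simp)
    obtain ⟨χ, c1, c2⟩ := exists_tvR (Ne.symm hy.1) (ts.le haK y) b
    refine ⟨χ * ψ, mul_mem (hp.tvr a haK y hy.1 b χ c1 c2) h0, ?_, ?_⟩
    · intro x hx
      rw [Finset.mem_insert] at hx
      rcases hx with rfl | hx
      · rw [MulAut.mul_apply, h2 _ ha, c1]
      · have : x ≠ a := by rintro rfl; exact ha hx
        rw [MulAut.mul_apply, h1 _ hx, map_mul, c2 _ this, fix_lt (c2 _ hy.1)]
    · intro x hx
      rw [Finset.mem_insert, not_or] at hx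
      rw [MulAut.mul_apply, h2 _ hx.2, c2 _ hx.1]

open Classical in
noncomputable def tau (Z : Set (ι × Bool)) (t : RAAG G) (d : ι × Bool) : RAAG G :=
  if d ∈ Z then t else 1

theorem tau_in {Z : Set (ι × Bool)} {t : RAAG G} {d : ι × Bool} (h : d ∈ Z) : tau Z t d = t := by
  simp [tau, h]
theorem tau_out {Z : Set (ι × Bool)} {t : RAAG G} {d : ι × Bool} (h : d ∉ Z) : tau Z t d = 1 := by
  simp [tau, h]
theorem tau_or (Z : Set (ι × Bool)) (t : RAAG G) (d : ι × Bool) : tau Z t d = 1 ∨ tau Z t d = t := by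
  by_cases h : d ∈ Z
  · exact Or.inr (tau_in h)
  · exact Or.inl (tau_out h)

def IsSlide (blk : V → ι) (K : Set V) (Z : Set (ι × Bool)) (t : RAAG G) (ψ : MulAut (RAAG G)) : Prop :=
  ∀ v, ψ (gen G v) = tau Z t (dir blk K v true) * gen G v * (tau Z t (dir blk K v false))⁻¹

theorem slide_lt [Fintype V] (ts : TS G blk K0) (hp : PsiHyp G blk K0 Ψ) (hK : K ⊆ K0) (Z : Set (ι × Bool))
    (y : V) (b : Bool) (h1 : y ∈ K → ((blk y, true) ∈ Z ↔ (blk y, false) ∈ Z))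
    (h2 : y ∉ K → (blk y, true) ∉ Z) : ∃ ψ ∈ Ψ, IsSlide blk K Z (lt G y b) ψ := by
  classical
  obtain ⟨ψ1, m1, a1, b1⟩ := multiL ts hp y b
    (Finset.univ.filter (fun x => x ∈ K ∧ x ≠ y ∧ (blk x, true) ∈ Z))
    (by intro x hx; simp at hx; exact hK hx.1.1) (by simp)
  obtain ⟨ψ2, m2, a2, b2⟩ := multiR ts hp y (!b)
    (Finset.univ.filter (fun x => x ∈ K ∧ x ≠ y ∧ (blk x, false) ∈ Z))
    (by intro x hx; simp at hx; exact hK hx.1.1) (by simp)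
  have tsK := ts.mono hK
  let C : Set V := {v | v ∉ K ∧ (blk v, true) ∈ Z}
  have hyC : y ∉ C := fun h => h2 h.1 h.2
  have hC : ∀ u v, blk u = blk v → u ∈ C → v ∈ C := by
    rintro u v huv ⟨hu1, hu2⟩
    refine ⟨fun hv => ?_, huv ▸ hu2⟩
    have := tsK.sing v hv u huv
    exact hu1 (this ▸ hv)
  have hcl : Clos G y C := ⟨hyC, fun c hc d hd => Or.inl (hC c d (ts.adj _ _ hd) hc)⟩
  have m3 : gpc y b C hcl ∈ Ψ := hp.pc C hC y hyC b _ (fun w hw => gpc_in hcl hw)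
    (fun w hw => gpc_out hcl hw)
  simp only [Finset.mem_filter, Finset.mem_univ, true_and, not_and] at a1 b1 a2 b2
  have f1 : ∀ c, ψ1 (lt G y c) = lt G y c := fun c => fix_lt (b1 y (by tauto)) c
  have f2 : ∀ c, ψ2 (lt G y c) = lt G y c := fun c => fix_lt (b2 y (by tauto)) c
  refine ⟨gpc y b C hcl * (ψ1 * ψ2), mul_mem m3 (mul_mem m1 m2), ?_⟩
  intro v
  rw [MulAut.mul_apply, MulAut.mul_apply]
  by_cases hv : v ∈ K
  · have hvC : v ∉ C := fun h => h.1 hv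
    rw [dir_K hv, dir_K hv]
    by_cases hvy : v = y
    · subst hvy
      rw [b2 v (by tauto), b1 v (by tauto), gpc_out hcl hvC]
      by_cases hZ : (blk v, true) ∈ Z
      · rw [tau_in hZ, tau_in ((h1 hv).1 hZ)]; cases b <;> simp
      · rw [tau_out hZ, tau_out (fun h => hZ ((h1 hv).2 h))]; simp
    · have e2 : ψ2 (gen G v) = gen G v * (tau Z (lt G y b) (blk v, false))⁻¹ := by
        by_cases hZ : (blk v, false) ∈ Z
        · rw [a2 v ⟨hv, hvy, hZ⟩, tau_in hZ, lt_inv]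
        · rw [b2 v (by tauto), tau_out hZ]; simp
      have e1 : ψ1 (gen G v) = tau Z (lt G y b) (blk v, true) * gen G v := by
        by_cases hZ : (blk v, true) ∈ Z
        · rw [a1 v ⟨hv, hvy, hZ⟩, tau_in hZ]
        · rw [b1 v (by tauto), tau_out hZ]; simp
      have e3 : ∀ (χ : MulAut (RAAG G)) d, (∀ c, χ (lt G y c) = lt G y c) →
          χ (tau Z (lt G y b) d) = tau Z (lt G y b) d := by
        intro χ d h
        rcases tau_or Z (lt G y b) d with h' | h' <;> rw [h']
        · simp
        · exact h b
      rw [e2, map_mul, map_inv, e1, e3 _ _ f1, map_mul, map_mul, map_inv, e3 _ _ (gpc_v hcl),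
        e3 _ _ (gpc_v hcl), gpc_out hcl hvC]
  · rw [dir_N hv, dir_N hv, b2 v (by tauto), b1 v (by tauto)]
    by_cases hZ : (blk v, true) ∈ Z
    · rw [tau_in hZ, gpc_in hcl (show v ∈ C from ⟨hv, hZ⟩)]
    · rw [tau_out hZ, gpc_out hcl (fun h => hZ h.2)]; simp

theorem slide_block [Fintype V] (ts : TS G blk K0) (hp : PsiHyp G blk K0 Ψ) (hK : K ⊆ K0)
    (Z : Set (ι × Bool)) (j : ι) (hj : ∀ v, blk v = j → v ∉ K) (hZ : (j, true) ∉ Z) {t : RAAG G}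
    (ht : t ∈ par G {v | blk v = j}) : ∃ ψ ∈ Ψ, IsSlide blk K Z t ψ := by
  refine par_ind (p := fun t => ∃ ψ ∈ Ψ, IsSlide blk K Z t ψ) ?_ ?_ ht
  · refine ⟨1, one_mem _, fun v => ?_⟩
    have : ∀ d, tau Z (1 : RAAG G) d = 1 := fun d => by unfold tau; split_ifs <;> rfl
    simp [this]
  · intro w hw b g hg ih
    obtain ⟨ψ2, m2, s2⟩ := ih
    obtain ⟨ψ1, m1, s1⟩ := slide_lt ts hp hK Z w b (fun h => absurd h (hj w hw)) (fun _ => by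
      rw [show blk w = j from hw]; exact hZ)
    refine ⟨ψ2 * ψ1, mul_mem m2 m1, fun v => ?_⟩
    have hfix : ψ2 (lt G w b) = lt G w b := by
      apply fix_lt
      rw [s2 w, dir_N (hj w hw), dir_N (hj w hw), show blk w = j from hw, tau_out hZ]; simp
    have e : ∀ d, ψ2 (tau Z (lt G w b) d) * tau Z g d = tau Z (lt G w b * g) d := by
      intro d
      by_cases hd : d ∈ Z
      · rw [tau_in hd, tau_in hd, tau_in hd, hfix]
      · rw [tau_out hd, tau_out hd, tau_out hd]; simp
    rw [MulAut.mul_apply, s1 v, map_mul, map_mul, map_inv, s2 v, ← e, ← e]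
    group

theorem IsSlide.syl {Z : Set (ι × Bool)} {t : RAAG G} {ψ : MulAut (RAAG G)}
    (h : IsSlide blk K Z t ψ) {α β : ι × Bool} {s : RAAG G} (hs : Syl G blk K α β s) :
    ψ s = tau Z t α * s * (tau Z t β)⁻¹ := by
  cases hs with
  | letter x b hx =>
    cases b
    · simp only [lt_false, Bool.not_false]
      rw [map_inv, h x, dir_K hx, dir_K hx]; group
    · simp only [lt_true, Bool.not_true]
      rw [h x, dir_K hx, dir_K hx]
  | block i _ h1 h2 h3 =>
    clear h3
    refine par_ind (p := fun s => ψ s = tau Z t (i, true) * s * (tau Z t (i, true))⁻¹) (by simp) ?_ h2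
    · intro v hv b g hg ih
      have : ψ (lt G v b) = tau Z t (i, true) * lt G v b * (tau Z t (i, true))⁻¹ := by
        have h3 := h v
        rw [dir_N (h1 v hv), dir_N (h1 v hv), show blk v = i from hv] at h3
        cases b
        · simp only [lt_false]; rw [map_inv, h3]; group
        · simpa using h3
      rw [map_mul, this, ih]; group

end
end RG

end

section
namespace RG
open scoped Pointwise
universe u
variable {V : Type u} {G : SimpleGraph V}

/-! ### Whitehead moves -/
section
variable {ι : Type u} {blk : V → ι} {K K0 : Set V} {Ψ : Subgroup (MulAut (RAAG G))}

def inZ (G : SimpleGraph V) (blk : V → ι) (K : Set V) (Z : Set (ι × Bool)) (g : RAAG G) : Prop :=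
  ∃ d ∈ Z, g ∈ Hd G blk K d

theorem TS.inZ_iff (ts : TS G blk K) {Z : Set (ι × Bool)} {g : RAAG G} {d : ι × Bool}
    (h : g ∈ Hd G blk K d) : inZ G blk K Z g ↔ d ∈ Z := by
  constructor
  · rintro ⟨d', h1, h2⟩; rwa [ts.Hd_unique h h2]
  · intro h'; exact ⟨d, h', h⟩

theorem not_inZ_one (Z : Set (ι × Bool)) : ¬ inZ G blk K Z 1 := by
  rintro ⟨d, -, h⟩; exact one_notMem_Hd d h

open Classical in
noncomputable def that (blk : V → ι) (K : Set V) (Z : Set (ι × Bool)) (t g : RAAG G) : RAAG G :=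
  if inZ G blk K Z g then t else 1

theorem TS.that_eq (ts : TS G blk K) {Z : Set (ι × Bool)} (t : RAAG G) {g : RAAG G} {d : ι × Bool}
    (h : g ∈ Hd G blk K d) : that blk K Z t g = tau Z t d := by
  by_cases h' : d ∈ Z
  · rw [tau_in h']; unfold that; rw [if_pos ((ts.inZ_iff h).2 h')]
  · rw [tau_out h']; unfold that; rw [if_neg (fun h2 => h' ((ts.inZ_iff h).1 h2))]

theorem that_one (Z : Set (ι × Bool)) (t : RAAG G) : that blk K Z t 1 = 1 := by
  simp [that, not_inZ_one]

theorem that_congr {Z : Set (ι × Bool)} (t : RAAG G) {g h : RAAG G}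
    (e : inZ G blk K Z g ↔ inZ G blk K Z h) : that blk K Z t g = that blk K Z t h := by
  unfold that
  by_cases h' : inZ G blk K Z g
  · rw [if_pos h', if_pos (e.1 h')]
  · rw [if_neg h', if_neg (fun h2 => h' (e.2 h2))]

theorem that_or (Z : Set (ι × Bool)) (t g : RAAG G) :
    that blk K Z t g = 1 ∨ that blk K Z t g = t := by
  unfold that; split_ifs <;> simp

def NB (G : SimpleGraph V) (blk : V → ι) (K : Set V) (Z : Set (ι × Bool)) (e : ι × Bool)
    (w : RAAG G) : Prop :=
  ∀ z z', z ∉ Hd G blk K e → z' ∉ Hd G blk K e → w = z⁻¹ * z' →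
    (inZ G blk K Z z ↔ inZ G blk K Z z')

theorem NB.inv {Z : Set (ι × Bool)} {e : ι × Bool} {w : RAAG G} (h : NB G blk K Z e w) :
    NB G blk K Z e w⁻¹ := by
  intro z z' hz hz' e'
  exact (h z' z hz' hz (by rw [← inv_inj, e']; group)).symm

open Classical in
noncomputable def sig (blk : V → ι) (K : Set V) (Z : Set (ι × Bool)) (e : ι × Bool) (t a b : RAAG G) :
    RAAG G :=
  if a ∈ Hd G blk K e then that blk K Z t b else that blk K Z t a

theorem sig_in {Z : Set (ι × Bool)} {e : ι × Bool} {t a b : RAAG G} (h : a ∈ Hd G blk K e) :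
    sig blk K Z e t a b = that blk K Z t b := by simp [sig, h]
theorem sig_out {Z : Set (ι × Bool)} {e : ι × Bool} {t a b : RAAG G} (h : a ∉ Hd G blk K e) :
    sig blk K Z e t a b = that blk K Z t a := by simp [sig, h]
theorem sig_or (Z : Set (ι × Bool)) (e : ι × Bool) (t a b : RAAG G) :
    sig blk K Z e t a b = 1 ∨ sig blk K Z e t a b = t := by
  by_cases h : a ∈ Hd G blk K e
  · rw [sig_in h]; exact that_or _ _ _
  · rw [sig_out h]; exact that_or _ _ _

theorem sig_symm {Z : Set (ι × Bool)} {e : ι × Bool} {t a b : RAAG G} (hj : Jn G blk K a b)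
    (hn : NB G blk K Z e (a⁻¹ * b)) : sig blk K Z e t a b = sig blk K Z e t b a := by
  by_cases ha : a ∈ Hd G blk K e
  · rw [sig_in ha, sig_out (hj e ha)]
  · by_cases hb : b ∈ Hd G blk K e
    · rw [sig_in hb, sig_out ha]
    · rw [sig_out ha, sig_out hb]; exact that_congr t (hn a b ha hb rfl)

/-- the factor condition -/
def HF (G : SimpleGraph V) (blk : V → ι) (K : Set V) (Z : Set (ι × Bool)) (e : ι × Bool) (t : RAAG G) :
    Prop :=
  ∀ α β s, Syl G blk K α β s → ∀ x y, (x = 1 ∨ x = t) → (y = 1 ∨ y = t) →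
    (α ≠ e → x = tau Z t α) → (β ≠ e → y = tau Z t β) →
    tl G blk K (x⁻¹ * tau Z t α * s * (tau Z t β)⁻¹ * y) ≤ 1

theorem TS.claimC [Finite V] (ts : TS G blk K) {Z : Set (ι × Bool)} {e : ι × Bool} {t : RAAG G}
    (hf : HF G blk K Z e t) {ψ : MulAut (RAAG G)} (hψ : IsSlide blk K Z t ψ) (w : RAAG G) :
    ∀ q, Jn G blk K q⁻¹ w → NB G blk K Z e (q * w) →
      tl G blk K ((sig blk K Z e t q⁻¹ w)⁻¹ * ψ w) ≤ tl G blk K w := by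
  induction w using ts.ind with
  | one =>
    intro q hj hn
    have : sig blk K Z e t q⁻¹ 1 = 1 := by
      by_cases hq : q⁻¹ ∈ Hd G blk K e
      · rw [sig_in hq, that_one]
      · rw [sig_out hq, ← that_one (blk := blk) (K := K) Z t]
        exact that_congr t (hn _ _ hq (one_notMem_Hd e) (by group))
    rw [this]; simp
  | step α β s g hs hg ih =>
    intro q hj hn
    have hsg : s * g ∈ Hd G blk K α := ts.S1 hs hg
    have hqα : q⁻¹ ∉ Hd G blk K α := fun h => hj α h hsg
    have hq' : (q * s)⁻¹ ∈ Hd G blk K β := by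
      rw [mul_inv_rev]; exact ts.S1 hs.symm hqα
    have hj' : Jn G blk K (q * s)⁻¹ g := by
      intro d hd hgd
      rw [ts.Hd_unique hd hq'] at hgd; exact hg hgd
    have h1 := ih (q * s) hj' (by rwa [mul_assoc])
    have h2 := hf α β s hs (sig blk K Z e t q⁻¹ (s * g)) (sig blk K Z e t (q * s)⁻¹ g)
      (sig_or _ _ _ _ _) (sig_or _ _ _ _ _) (by
        intro hα
        have hsge : s * g ∉ Hd G blk K e := fun h => hα (ts.Hd_unique hsg h)
        rw [← ts.that_eq t hsg]
        by_cases hq : q⁻¹ ∈ Hd G blk K e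
        · rw [sig_in hq]
        · rw [sig_out hq]
          exact that_congr t (hn _ _ hq hsge (by group))) (by
        intro hβ
        have : (q * s)⁻¹ ∉ Hd G blk K e := fun h => hβ (ts.Hd_unique hq' h)
        rw [sig_out this, ts.that_eq t hq'])
    rw [ts.tl_cons hs hg]
    have e1 : (sig blk K Z e t q⁻¹ (s * g))⁻¹ * ψ (s * g) =
      ((sig blk K Z e t q⁻¹ (s * g))⁻¹ * tau Z t α * s * (tau Z t β)⁻¹ * sig blk K Z e t (q * s)⁻¹ g) *
      ((sig blk K Z e t (q * s)⁻¹ g)⁻¹ * ψ g) := by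
      rw [map_mul, hψ.syl hs]; group
    rw [e1]
    refine (ts.tl_mul_le _ _).trans ?_
    omega

theorem TS.slide_le [Finite V] (ts : TS G blk K) {Z : Set (ι × Bool)} {e : ι × Bool} {t : RAAG G}
    (hf : HF G blk K Z e t) {ψ : MulAut (RAAG G)} (hψ : IsSlide blk K Z t ψ) {w : RAAG G}
    (hn : NB G blk K Z e w) : tl G blk K (ψ w) ≤ tl G blk K w := by
  have := ts.claimC hf hψ w 1 (by intro d hd; exact absurd hd (by simpa using one_notMem_Hd d))
    (by simpa using hn)
  rw [inv_one, sig_out (one_notMem_Hd e), that_one] at this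
  simpa using this

theorem TS.slide_lt [Finite V] (ts : TS G blk K) {Z : Set (ι × Bool)} {e : ι × Bool} {t : RAAG G}
    (hf : HF G blk K Z e t) {ψ : MulAut (RAAG G)} (hψ : IsSlide blk K Z t ψ) {α β : ι × Bool}
    {z s g : RAAG G} (hs : Syl G blk K α β s) (hz : z ∉ Hd G blk K α) (hg : g ∉ Hd G blk K β)
    (hn : NB G blk K Z e (z⁻¹ * (s * g)))
    (h1 : (sig blk K Z e t z (s * g))⁻¹ * tau Z t α * s * (tau Z t β)⁻¹ *
      sig blk K Z e t (s⁻¹ * z) g = 1) :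
    tl G blk K (ψ (z⁻¹ * (s * g))) < tl G blk K (z⁻¹ * (s * g)) := by
  have hsg : s * g ∈ Hd G blk K α := ts.S1 hs hg
  have hj : Jn G blk K z (s * g) := by
    intro d hd h
    rw [ts.Hd_unique h hsg] at hd; exact hz hd
  have hz' : s⁻¹ * z ∈ Hd G blk K β := ts.S1 hs.symm hz
  have hj' : Jn G blk K (s⁻¹ * z) g := by
    intro d hd h
    rw [ts.Hd_unique hd hz'] at h; exact hg h
  have c1 := ts.claimC hf hψ g (z⁻¹ * s) (by simpa using hj') (by rwa [mul_assoc])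
  have c2 := ts.claimC hf hψ z (s * g)⁻¹ (by simpa using hj.symm) (by
    have := hn.inv
    rwa [show (z⁻¹ * (s * g))⁻¹ = (s * g)⁻¹ * z by group] at this)
  rw [inv_inv, ← sig_symm hj hn] at c2
  rw [show (z⁻¹ * s)⁻¹ = s⁻¹ * z by group] at c1
  rw [ts.tl_jn z _ hj, ts.tl_cons hs hg]
  have e1 : ψ (z⁻¹ * (s * g)) = ((sig blk K Z e t z (s * g))⁻¹ * ψ z)⁻¹ *
     ((sig blk K Z e t z (s * g))⁻¹ * tau Z t α * s * (tau Z t β)⁻¹ *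
      sig blk K Z e t (s⁻¹ * z) g) * ((sig blk K Z e t (s⁻¹ * z) g)⁻¹ * ψ g) := by
    rw [map_mul, map_mul, hψ.syl hs, map_inv]; group
  rw [e1, h1, mul_one]
  refine lt_of_le_of_lt (ts.tl_mul_le _ _) ?_
  rw [ts.tl_inv]; omega

/-- connectivity of the Cayley graph for the images of the generators -/
theorem edge (φ : MulAut (RAAG G)) {Y : Set (RAAG G)} {a b : RAAG G} (ha : a ∈ Y) (hb : b ∉ Y) :
    ∃ v z z', z ∈ Y ∧ z' ∉ Y ∧ (φ (gen G v) = z⁻¹ * z' ∨ (φ (gen G v))⁻¹ = z⁻¹ * z') := by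
  by_contra hcon
  push Not at hcon
  have key : ∀ x : RAAG G, ∀ z, z ∈ Y → z * φ x ∈ Y := by
    intro x
    induction x using ind_left with
    | one => intro z hz; simpa using hz
    | step v b g ih =>
      intro z hz
      rw [map_mul, ← mul_assoc]
      apply ih
      by_contra h
      have := hcon v z _ hz h
      cases b
      · apply this.2; simp
      · apply this.1; simp
  apply hb
  have := key (φ⁻¹ (a⁻¹ * b)) a ha
  simpa using this

theorem TS.sum_lt [Fintype V] (ts : TS G blk K) {Z : Set (ι × Bool)} {e : ι × Bool} {t : RAAG G}
    (hf : HF G blk K Z e t) {ψ : MulAut (RAAG G)} (hψ : IsSlide blk K Z t ψ) {φ : MulAut (RAAG G)}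
    (hn : ∀ v, NB G blk K Z e (φ (gen G v))) {v : V} {α β : ι × Bool}
    {z s g : RAAG G} (hs : Syl G blk K α β s) (hz : z ∉ Hd G blk K α) (hg : g ∉ Hd G blk K β)
    (he : φ (gen G v) = z⁻¹ * (s * g) ∨ (φ (gen G v))⁻¹ = z⁻¹ * (s * g))
    (h1 : (sig blk K Z e t z (s * g))⁻¹ * tau Z t α * s * (tau Z t β)⁻¹ *
      sig blk K Z e t (s⁻¹ * z) g = 1) :
    ∑ v, tl G blk K (ψ (φ (gen G v))) < ∑ v, tl G blk K (φ (gen G v)) := by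
  apply Finset.sum_lt_sum
  · intro v _; exact ts.slide_le hf hψ (hn v)
  · refine ⟨v, Finset.mem_univ _, ?_⟩
    rcases he with he | he
    · have hn' := hn v
      rw [he] at hn' ⊢
      exact ts.slide_lt hf hψ hs hz hg hn' h1
    · have hn' := (hn v).inv
      rw [← ts.tl_inv (ψ _), ← ts.tl_inv (φ _), ← map_inv, he]
      rw [he] at hn'
      exact ts.slide_lt hf hψ hs hz hg hn' h1

theorem bool_ne {c b : Bool} (h : c ≠ b) : c = !b := by cases c <;> cases b <;> simp_all

/-- Whitehead lemma for a letter direction -/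
theorem whitehead_K [Fintype V] (ts : TS G blk K0) (hp : PsiHyp G blk K0 Ψ) (hK : K ⊆ K0)
    {S : Set (ι × Bool)} {y : V} {b : Bool} (hy : y ∈ K) (heS : (blk y, b) ∉ S) {z0 : RAAG G}
    (hz0 : inZ G blk K S z0) {φ : MulAut (RAAG G)}
    (hn : ∀ v, NB G blk K S (blk y, b) (φ (gen G v))) :
    ∃ ψ ∈ Ψ, (∃ Z t, IsSlide blk K Z t ψ) ∧
      ∑ v, tl G blk K (ψ (φ (gen G v))) < ∑ v, tl G blk K (φ (gen G v)) := by
  have tsK := ts.mono hK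
  -- shape of syllables in direction `e`
  have hsh : ∀ α β s, Syl G blk K α β s → ∀ c, (α = (blk y, c) → β = (blk y, !c) ∧ s = lt G y c) ∧
      (β = (blk y, c) → α = (blk y, !c) ∧ s = lt G y (!c)) := by
    intro α β s hs c
    cases hs with
    | letter x d hx =>
      constructor
      · intro h
        rw [Prod.mk.injEq] at h
        obtain rfl := tsK.sing y hy x h.1
        rw [h.2]; simp
      · intro h
        rw [Prod.mk.injEq] at h
        obtain rfl := tsK.sing y hy x h.1
        rw [← h.2]; simp
    | block i _ h1 h2 h3 =>
      constructor <;>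
      · intro h
        rw [Prod.mk.injEq] at h
        exact absurd hy (h1 y h.1.symm)
  have hbb : (blk y, !b) ≠ (blk y, b) := by simp
  have hs0 : Syl G blk K (blk y, b) (blk y, !b) (lt G y b) := Syl.letter y b hy
  have hlt : lt G y b ∈ Hd G blk K (blk y, b) := tsK.Syl_mem hs0
  have key : ∀ (Z : Set (ι × Bool)) (t τe : RAAG G), (∀ d, d ≠ (blk y, b) → (d ∈ Z ↔ d ∈ S)) →
      (∀ c, tau Z t (blk y, c) = τe) → (τe = 1 ∧ t = lt G y b ∨ τe = t ∧ t = lt G y (!b)) →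
      (∃ a, a ∉ Hd G blk K (blk y, b) ∧ that blk K Z t a ≠ τe) →
      (∃ ψ ∈ Ψ, IsSlide blk K Z t ψ) → ∃ ψ ∈ Ψ, (∃ Z t, IsSlide blk K Z t ψ) ∧
      ∑ v, tl G blk K (ψ (φ (gen G v))) < ∑ v, tl G blk K (φ (gen G v)) := by
    rintro Z t τe hZS hτ hcase ⟨a, ha1, ha2⟩ ⟨ψ, hψ1, hψ2⟩
    have hin : ∀ z, z ∉ Hd G blk K (blk y, b) → (inZ G blk K Z z ↔ inZ G blk K S z) := by
      intro z hz
      constructor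
      · rintro ⟨d, h1, h2⟩
        exact ⟨d, (hZS d (by rintro rfl; exact hz h2)).1 h1, h2⟩
      · rintro ⟨d, h1, h2⟩
        exact ⟨d, (hZS d (by rintro rfl; exact hz h2)).2 h1, h2⟩
    have hn' : ∀ v, NB G blk K Z (blk y, b) (φ (gen G v)) := by
      intro v z z' hz hz' e'
      rw [hin z hz, hin z' hz']; exact hn v z z' hz hz' e'
    have hstep : ∀ x, (x = 1 ∨ x = t) → x⁻¹ * τe * lt G y b = 1 ∨ x⁻¹ * τe * lt G y b = lt G y b := by
      rintro x hx
      rcases hcase with ⟨h1, h2⟩ | ⟨h1, h2⟩ <;> rcases hx with rfl | rfl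
      · right; rw [h1]; simp
      · left; rw [h1, h2]; simp
      · left; rw [h1, h2]; cases b <;> simp
      · right; rw [h1]; simp
    have hf : HF G blk K Z (blk y, b) t := by
      intro α β s hs x x' hx hx' h1 h2
      by_cases hα : α = (blk y, b)
      · obtain ⟨hβ, rfl⟩ := (hsh α β s hs b).1 hα
        rw [h2 (by rw [hβ]; exact hbb), hα, hβ, hτ, hτ]
        rw [inv_mul_cancel_right]
        rcases hstep x hx with h | h
        · rw [h, tsK.tl_one]; omega
        · rw [h, tsK.tl_syl hs]
      · rw [h1 hα]
        by_cases hβ : β = (blk y, b)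
        · obtain ⟨hα', rfl⟩ := (hsh α β s hs b).2 hβ
          rw [hα', hβ, hτ, hτ]
          rw [← tsK.tl_inv]
          rw [show (τe⁻¹ * τe * lt G y (!b) * τe⁻¹ * x')⁻¹ = x'⁻¹ * τe * lt G y b by
            rw [← lt_inv]; group]
          rcases hstep x' hx' with h | h
          · rw [h, tsK.tl_one]; omega
          · rw [h, tsK.tl_syl hs0]
        · rw [h2 hβ]
          rw [show (tau Z t α)⁻¹ * tau Z t α * s * (tau Z t β)⁻¹ * tau Z t β = s by group, tsK.tl_syl hs]
    obtain ⟨v, z, z', hz, hz', hv⟩ := edge φ (Y := {z | z ∉ Hd G blk K (blk y, b) ∧ that blk K Z t z ≠ τe})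
      (show a ∈ _ from ⟨ha1, ha2⟩) (show lt G y b ∉ _ from fun h => h.1 hlt)
    have hz'e : z' ∈ Hd G blk K (blk y, b) := by
      by_contra hc
      apply hz'
      refine ⟨hc, ?_⟩
      have : inZ G blk K Z z ↔ inZ G blk K Z z' := by
        rcases hv with hv | hv
        · exact hn' v z z' hz.1 hc hv
        · exact (hn' v).inv z z' hz.1 hc hv
      rw [← that_congr t this]; exact hz.2
    obtain ⟨β, s, g, hs, rfl, hg⟩ := tsK.S2 hz'e
    obtain ⟨rfl, rfl⟩ := (hsh _ _ _ hs b).1 rfl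
    refine ⟨ψ, hψ1, ⟨Z, t, hψ2⟩, tsK.sum_lt hf hψ2 hn' hs hz.1 hg hv ?_⟩
    have hz2 : (lt G y b)⁻¹ * z ∈ Hd G blk K (blk y, !b) := tsK.S1 hs.symm hz.1
    rw [sig_out hz.1, sig_out (fun h => hbb (tsK.Hd_unique hz2 h)), tsK.that_eq t hz2, hτ, hτ]
    rw [inv_mul_cancel_right]
    have h3 := hz.2
    rcases hcase with ⟨h1, h2⟩ | ⟨h1, h2⟩ <;> rcases that_or (blk := blk) (K := K) Z t z with h4 | h4
    · rw [h4, h1] at h3; exact absurd rfl h3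
    · rw [h4, h1, h2]; simp
    · rw [h4, h1, h2]; cases b <;> simp
    · rw [h4, h1] at h3; exact absurd rfl h3
  have hz0e : z0 ∉ Hd G blk K (blk y, b) := fun h => heS ((tsK.inZ_iff h).1 hz0)
  by_cases hē : (blk y, !b) ∈ S
  · have hm : ∀ c, (blk y, c) ∈ insert (blk y, b) S := by
      intro c
      by_cases hc : c = b
      · simp [hc]
      · right; rwa [bool_ne hc]
    refine key (insert (blk y, b) S) (lt G y (!b)) (lt G y (!b)) (fun d hd => by simp [hd])
      (fun c => tau_in (hm c)) (Or.inr ⟨rfl, rfl⟩) ⟨1, one_notMem_Hd _, ?_⟩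
      (slide_lt ts hp hK _ y _ (fun _ => by simp only [hm]) (fun h => absurd hy h))
    rw [that_one]
    intro h
    have := lt_self_mem (G := G) y (!b)
    rw [← h] at this; exact one_notMem _ _ this
  · have hm : ∀ c, (blk y, c) ∉ S := by
      intro c
      by_cases hc : c = b
      · rwa [hc]
      · rwa [bool_ne hc]
    refine key S (lt G y b) 1 (fun d hd => Iff.rfl)
      (fun c => tau_out (hm c)) (Or.inl ⟨rfl, rfl⟩) ⟨z0, hz0e, ?_⟩
      (slide_lt ts hp hK _ y _ (fun _ => by simp only [hm]) (fun h => absurd hy h))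
    unfold that
    rw [if_pos hz0]
    intro h
    have := lt_self_mem (G := G) y b
    rw [h] at this; exact one_notMem _ _ this

theorem whitehead_N [Fintype V] (ts : TS G blk K0) (hp : PsiHyp G blk K0 Ψ) (hK : K ⊆ K0)
    {S : Set (ι × Bool)} {j : ι} (hj : ∀ v, blk v = j → v ∉ K) (heS : (j, true) ∉ S) {z0 : RAAG G}
    (hz0 : inZ G blk K S z0) {φ : MulAut (RAAG G)}
    (hn : ∀ v, NB G blk K S (j, true) (φ (gen G v))) :
    ∃ ψ ∈ Ψ, (∃ Z t, IsSlide blk K Z t ψ) ∧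
      ∑ v, tl G blk K (ψ (φ (gen G v))) < ∑ v, tl G blk K (φ (gen G v)) := by
  have tsK := ts.mono hK
  have hsh : ∀ α β s, Syl G blk K α β s → (α = (j, true) ∨ β = (j, true)) →
      α = (j, true) ∧ β = (j, true) ∧ s ∈ par G {v | blk v = j} := by
    intro α β s hs h
    cases hs with
    | letter x d hx => exact absurd hx (hj x (by rcases h with h | h <;> exact (Prod.mk.inj h).1))
    | block i _ h1 h2 h3 =>
      have : i = j := by rcases h with h | h <;> exact (Prod.mk.inj h).1
      subst this; exact ⟨rfl, rfl, h2⟩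
  have hP : ∀ p ∈ par G {v | blk v = j}, ¬ inZ G blk K S p := by
    intro p hp h
    by_cases h1 : p = 1
    · subst h1; exact not_inZ_one _ h
    · have := tsK.Syl_mem (Syl.block (K := K) j p hj hp h1)
      exact heS ((tsK.inZ_iff this).1 h)
  obtain ⟨v, x, x', hx, hx', hv⟩ := edge φ (Y := {x | ∃ p ∈ par G {v | blk v = j}, inZ G blk K S (p * x)})
      (show z0 ∈ _ from ⟨1, one_mem _, by simpa using hz0⟩) (show (1 : RAAG G) ∉ _ by
        rintro ⟨p, hp, h⟩
        rw [mul_one] at h; exact hP p hp h)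
  obtain ⟨p, hpj, hpx⟩ := hx
  have hv' : φ (gen G v) = (p * x)⁻¹ * (p * x') ∨ (φ (gen G v))⁻¹ = (p * x)⁻¹ * (p * x') := by
    rwa [show (p * x)⁻¹ * (p * x') = x⁻¹ * x' by group]
  have hx'' : ¬ ∃ p' ∈ par G {v | blk v = j}, inZ G blk K S (p' * (p * x')) := by
    rintro ⟨p', h1, h2⟩
    exact hx' ⟨p' * p, mul_mem h1 hpj, by rwa [mul_assoc]⟩
  revert hv' hx'' hpx
  generalize p * x = z
  generalize p * x' = z'
  intro hzS hv hz'
  have hze : z ∉ Hd G blk K (j, true) := fun h => heS ((tsK.inZ_iff h).1 hzS)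
  have hz'S : ¬ inZ G blk K S z' := fun h => hz' ⟨1, one_mem _, by simpa using h⟩
  have hz'e : z' ∈ Hd G blk K (j, true) := by
    by_contra hc
    rcases hv with hv | hv
    · exact hz'S ((hn v z z' hze hc hv).1 hzS)
    · exact hz'S (((hn v).inv z z' hze hc hv).1 hzS)
  obtain ⟨β, s, g, hs, rfl, hg⟩ := tsK.S2 hz'e
  obtain ⟨-, rfl, hsj⟩ := hsh _ _ _ hs (Or.inl rfl)
  have hgS : ¬ inZ G blk K S g := fun h => hz' ⟨s⁻¹, inv_mem hsj, by simpa using h⟩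
  obtain ⟨ψ, hψ1, hψ2⟩ := slide_block ts hp hK S j hj heS hsj
  have hf : HF G blk K S (j, true) s := by
    intro α β r hr x y hx hy h1 h2
    by_cases hα : α = (j, true) ∨ β = (j, true)
    · obtain ⟨rfl, rfl, hrj⟩ := hsh _ _ _ hr hα
      rw [tau_out heS]
      have hxj : ∀ x, (x = 1 ∨ x = s) → x ∈ par G {v | blk v = j} := by
        rintro x (rfl | rfl)
        · exact one_mem _
        · exact hsj
      have hm : x⁻¹ * 1 * r * 1⁻¹ * y ∈ par G {v | blk v = j} :=
        mul_mem (by simpa using mul_mem (inv_mem (hxj x hx)) hrj) (hxj y hy)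
      by_cases h : x⁻¹ * 1 * r * 1⁻¹ * y = 1
      · rw [h, tsK.tl_one]; omega
      · exact (tsK.tl_syl (Syl.block j _ hj hm h)).le
    · push Not at hα
      rw [h1 hα.1, h2 hα.2, show (tau S s α)⁻¹ * tau S s α * r * (tau S s β)⁻¹ * tau S s β = r by group,
        tsK.tl_syl hr]
  refine ⟨ψ, hψ1, ⟨S, s, hψ2⟩, tsK.sum_lt hf hψ2 hn hs hze hg hv ?_⟩
  have hz2 : s⁻¹ * z ∈ Hd G blk K (j, true) := tsK.S1 hs.symm hze
  rw [sig_out hze, sig_in hz2, tau_out heS]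
  unfold that
  rw [if_pos hzS, if_neg hgS]; simp

theorem whitehead [Fintype V] (ts : TS G blk K0) (hp : PsiHyp G blk K0 Ψ) (hK : K ⊆ K0)
    {S : Set (ι × Bool)} {e : ι × Bool} {g0 : RAAG G} (he : g0 ∈ Hd G blk K e) (heS : e ∉ S) {z0 : RAAG G}
    (hz0 : inZ G blk K S z0) {φ : MulAut (RAAG G)}
    (hn : ∀ v, NB G blk K S e (φ (gen G v))) :
    ∃ ψ ∈ Ψ, (∃ Z t, IsSlide blk K Z t ψ) ∧
      ∑ v, tl G blk K (ψ (φ (gen G v))) < ∑ v, tl G blk K (φ (gen G v)) := by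
  obtain ⟨y, b, rfl, -⟩ := he
  by_cases hy : y ∈ K
  · rw [dir_K hy] at *
    exact whitehead_K ts hp hK hy heS hz0 hn
  · rw [dir_N hy] at *
    refine whitehead_N ts hp hK (fun v hv hvK => ?_) heS hz0 hn
    exact hy (((ts.mono hK).sing v hvK y hv.symm) ▸ hvK)
end
end RG

end

section
namespace RG
open scoped Pointwise
universe u
variable {V : Type u} {G : SimpleGraph V}

section
variable {ι : Type u} {blk : V → ι} {K K0 : Set V} {Ψ : Subgroup (MulAut (RAAG G))}

/-- automorphisms conjugating each block -/
def BC (G : SimpleGraph V) (blk : V → ι) (K : Set V) : Subgroup (MulAut (RAAG G)) where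
  carrier := {ψ | ∀ i, (∀ v, blk v = i → v ∉ K) → ∃ k, ∀ g ∈ par G {v | blk v = i}, ψ g = k * g * k⁻¹}
  one_mem' := by intro i _; exact ⟨1, by simp⟩
  mul_mem' := by
    intro a b ha hb i hi
    obtain ⟨k, hk⟩ := ha i hi
    obtain ⟨l, hl⟩ := hb i hi
    refine ⟨a l * k, fun g hg => ?_⟩
    rw [MulAut.mul_apply, hl g hg, map_mul, map_mul, map_inv, hk g hg]; group
  inv_mem' := by
    intro a ha i hi
    obtain ⟨k, hk⟩ := ha i hi
    refine ⟨(a⁻¹ k)⁻¹, fun g hg => ?_⟩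
    apply inv_apply_eq
    rw [map_mul, map_mul, map_inv, inv_inv, hk g hg]
    simp [mul_assoc]

theorem IsSlide.mem_BC {Z : Set (ι × Bool)} {t : RAAG G} {ψ : MulAut (RAAG G)}
    (h : IsSlide blk K Z t ψ) : ψ ∈ BC G blk K := by
  intro i hi
  refine ⟨tau Z t (i, true), fun g hg => ?_⟩
  by_cases h1 : g = 1
  · subst h1; simp
  · exact h.syl (Syl.block i g hi hg h1)

theorem fix_mem_BC {ψ : MulAut (RAAG G)} (h : ∀ v ∉ K, ψ (gen G v) = gen G v) : ψ ∈ BC G blk K := by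
  intro i hi
  refine ⟨1, fun g hg => ?_⟩
  rw [fix_par (fun w hw => h w (hi w hw)) hg]; simp

def QK (G : SimpleGraph V) (blk : V → ι) (K : Set V) (φ : MulAut (RAAG G)) : Prop :=
  ∀ i, (∀ v, blk v = i → v ∉ K) → ∃ a, ∀ g ∈ par G {v | blk v = i}, φ⁻¹ (a⁻¹ * g * a) ∈ par G Kᶜ

theorem QK.mul {φ ψ : MulAut (RAAG G)} (h : QK G blk K φ) (hψ : ψ ∈ BC G blk K) : QK G blk K (ψ * φ) := by
  intro i hi
  obtain ⟨a, ha⟩ := h i hi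
  obtain ⟨k, hk⟩ := inv_mem hψ i hi
  refine ⟨ψ (k * a), fun g hg => ?_⟩
  have : (ψ * φ)⁻¹ ((ψ (k * a))⁻¹ * g * ψ (k * a)) = φ⁻¹ (a⁻¹ * g * a) := by
    rw [mul_inv_rev, MulAut.mul_apply]
    congr 1
    rw [map_mul, map_mul, hk g hg, map_inv]
    simp
    group
  rw [this]; exact ha g hg

theorem QK.nice [Finite V] (ts : TS G blk K) {φ : MulAut (RAAG G)} (h : QK G blk K φ) (i : ι)
    (hi : ∀ v, blk v = i → v ∉ K) : ∃ a, a ∉ Hd G blk K (i, true) ∧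
      ∀ g ∈ par G {v | blk v = i}, φ⁻¹ (a⁻¹ * g * a) ∈ par G Kᶜ := by
  obtain ⟨a, ha⟩ := h i hi
  by_cases h1 : a ∈ Hd G blk K (i, true)
  · obtain ⟨β, s, a', hs, rfl, ha'⟩ := ts.S2 h1
    have : β = (i, true) ∧ s ∈ par G {v | blk v = i} := by
      generalize hα : ((i, true) : ι × Bool) = α at hs
      cases hs with
      | letter x b hx => exact absurd hx (hi x (Prod.mk.inj hα).1.symm)
      | block j _ h1 h2 h3 => 
        have := (Prod.mk.inj hα).1
        subst this; exact ⟨rfl, h2⟩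
    obtain ⟨rfl, hsi⟩ := this
    refine ⟨a', ha', fun g hg => ?_⟩
    have := ha (s * g * s⁻¹) (mul_mem (mul_mem hsi hg) (inv_mem hsi))
    rwa [show (s * a')⁻¹ * (s * g * s⁻¹) * (s * a') = a'⁻¹ * g * a' by group] at this
  · exact ⟨a, h1, ha⟩

/-! colour -/

def col (φ : MulAut (RAAG G)) (x0 : V) (g : RAAG G) : Prop := φ⁻¹ g ∈ H G x0 true

theorem TS.col_cross (ts : TS G blk K) {x0 : V} (hx : x0 ∈ K) (φ : MulAut (RAAG G)) {h : RAAG G} {v : V}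
    (hc : ¬ (col φ x0 h ↔ col φ x0 (h * φ (gen G v)))) : h = 1 ∧ v = x0 := by
  unfold col at hc
  have e : φ⁻¹ (h * φ (gen G v)) = φ⁻¹ h * lt G v true := by simp
  rw [e] at hc
  by_cases h1 : φ⁻¹ h ∈ H G x0 true
  · have h2 : φ⁻¹ h * lt G v true ∉ H G x0 true := by tauto
    have := (cross_out h1 h2).2.1
    simp at this
  · have h2 : φ⁻¹ h * lt G v true ∈ H G x0 true := by tauto
    obtain ⟨h3, -, h4⟩ := cross_in _ _ _ _ _ h1 h2
    have := ts.par_lk hx h4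
    refine ⟨?_, h3⟩
    simpa using this

theorem TS.col_fin (ts : TS G blk K) {x0 : V} (hx : x0 ∈ K) (m : RAAG G) :
    {x : RAAG G | ¬ (x ∈ H G x0 true ↔ x * m ∈ H G x0 true)}.Finite := by
  induction m using ind_left with
  | one => simp
  | step v b g ih =>
    have h1 : {x : RAAG G | ¬ (x ∈ H G x0 true ↔ x * lt G v b ∈ H G x0 true)} ⊆ {1, (lt G v b)⁻¹} := by
      intro x hx'
      by_cases h1 : x ∈ H G x0 true
      · have h2 : x * lt G v b ∉ H G x0 true := by
          intro h; exact hx' ⟨fun _ => h, fun _ => h1⟩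
        have := ts.par_lk hx (cross_out h1 h2).2.2
        right; exact eq_inv_of_mul_eq_one_left this
      · have h2 : x * lt G v b ∈ H G x0 true := by
          by_contra h; exact hx' ⟨fun h' => absurd h' h1, fun h' => absurd h' h⟩
        left; exact ts.par_lk hx (cross_in _ _ _ _ _ h1 h2).2.2
    have h2 : ((fun x => x * lt G v b) ⁻¹' {x : RAAG G | ¬ (x ∈ H G x0 true ↔ x * g ∈ H G x0 true)}).Finite :=
      ih.preimage (fun a _ b _ h => mul_right_cancel h)
    refine ((Set.toFinite _).subset h1 |>.union h2).subset ?_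
    intro x hx'
    by_contra hc
    simp only [Set.mem_union, Set.mem_setOf_eq, Set.mem_preimage, not_or, not_not] at hc hx'
    rw [← mul_assoc] at hx'
    exact hx' (hc.1.trans hc.2)

theorem TS.col_bound [Finite V] (ts : TS G blk K) {x0 : V} (hx : x0 ∈ K) (φ : MulAut (RAAG G)) :
    ∃ N : ℕ, ∀ (w : V) (b : Bool) (h : RAAG G), N ≤ tl G blk K h →
      (col φ x0 h ↔ col φ x0 (h * lt G w b)) := by
  have hfin : (⋃ w : V, ⋃ b : Bool, {h : RAAG G | ¬ (col φ x0 h ↔ col φ x0 (h * lt G w b))}).Finite := by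
    refine Set.finite_iUnion fun w => Set.finite_iUnion fun b => ?_
    have := (ts.col_fin hx (φ⁻¹ (lt G w b))).preimage (f := fun x => φ⁻¹ x) (fun a _ b _ h => (φ⁻¹).injective h)
    refine this.subset ?_
    intro h hh
    simpa [col, map_mul] using hh
  obtain ⟨N, hN⟩ := (hfin.image (tl G blk K)).bddAbove
  refine ⟨N + 1, fun w b h hh => ?_⟩
  by_contra hc
  have := hN ⟨h, Set.mem_iUnion.2 ⟨w, Set.mem_iUnion.2 ⟨b, hc⟩⟩, rfl⟩
  omega

theorem TS.base [Finite V] (ts : TS G blk K) {x0 : V} (hx : x0 ∈ K) (φ : MulAut (RAAG G)) {N : ℕ}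
    (hN : ∀ (w : V) (b : Bool) (h : RAAG G), N ≤ tl G blk K h →
      (col φ x0 h ↔ col φ x0 (h * lt G w b))) (z : RAAG G) :
    ∀ p, Jn G blk K p⁻¹ z → N ≤ tl G blk K p → (col φ x0 (p * z) ↔ col φ x0 p) := by
  induction z using ts.ind with
  | one => intro p _ _; simp
  | step α β s g hs hg ih =>
    intro p hj hp
    have hsg : s * g ∈ Hd G blk K α := ts.S1 hs hg
    have hpα : p⁻¹ ∉ Hd G blk K α := fun h => hj α h hsg
    have hq' : (p * s)⁻¹ ∈ Hd G blk K β := by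
      rw [mul_inv_rev]; exact ts.S1 hs.symm hpα
    have hj' : Jn G blk K (p * s)⁻¹ g := by
      intro d hd hgd
      rw [ts.Hd_unique hd hq'] at hgd; exact hg hgd
    have hlen : ∀ r α' β', Syl G blk K α' β' r → α' = α → N ≤ tl G blk K (p * r) := by
      intro r α' β' hr h
      subst h
      have := ts.tl_jn p⁻¹ r (by
        intro d hd hd'
        rw [ts.Hd_unique hd' (ts.Syl_mem hr)] at hd; exact hpα hd)
      rw [inv_inv, ts.tl_inv] at this
      omega
    rw [← mul_assoc, ih (p * s) hj' (hlen s α β hs rfl)]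
    cases hs with
    | letter x b hx' => exact (hN x b p hp).symm
    | block i _ h1 h2 h3 =>
      have key : ∀ r ∈ par G {v | blk v = i}, (col φ x0 (p * r⁻¹) ↔ col φ x0 p) := by
        intro r hr
        refine par_ind (p := fun r => (col φ x0 (p * r⁻¹) ↔ col φ x0 p)) (by simp) ?_ hr
        intro v hv b g hg ih
        rw [mul_inv_rev, ← mul_assoc, lt_inv, ← hN v (!b) _ ?_, ih]
        by_cases hg1 : g = 1
        · subst hg1; simpa using hp
        · exact hlen _ _ _ (Syl.block i g⁻¹ h1 (inv_mem hg) (by simpa using hg1)) rfl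
      have := key s⁻¹ (inv_mem h2)
      rwa [inv_inv] at this

theorem QK.col {φ : MulAut (RAAG G)} {x0 : V} (hx : x0 ∈ K) {g a : RAAG G}
    (h : φ⁻¹ (a⁻¹ * g * a) ∈ par G Kᶜ) (p : RAAG G) : col φ x0 (p * g * a) ↔ col φ x0 (p * a) := by
  unfold RG.col
  have e : φ⁻¹ (p * g * a) = φ⁻¹ (p * a) * φ⁻¹ (a⁻¹ * g * a) := by
    rw [← map_mul]; congr 1; group
  rw [e]
  exact (noCross_par (by simpa using hx) h _ _).symm

/-- branches are monochrome, given monochromaticity further out -/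
theorem TS.branch [Finite V] (ts : TS G blk K) {x0 : V} (hx : x0 ∈ K) {φ : MulAut (RAAG G)}
    (hQ : QK G blk K φ) {p : RAAG G}
    (ih : ∀ q e, tl G blk K q = tl G blk K p + 1 → q⁻¹ ∈ Hd G blk K e → ∀ z, z ∉ Hd G blk K e →
      (RG.col φ x0 (q * z) ↔ RG.col φ x0 q)) {d : ι × Bool} (hd : p⁻¹ ∉ Hd G blk K d) {z z' : RAAG G}
    (hz : z ∈ Hd G blk K d) (hz' : z' ∈ Hd G blk K d) : 
    RG.col φ x0 (p * z) ↔ RG.col φ x0 (p * z') := by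
  have h0 : ∀ β s, Syl G blk K d β s → ∀ g, g ∉ Hd G blk K β →
      (RG.col φ x0 (p * (s * g)) ↔ RG.col φ x0 (p * s)) := by
    intro β s hs g hg
    rw [← mul_assoc]
    refine ih (p * s) β ?_ ?_ g hg
    · have := ts.tl_jn p⁻¹ s (by
        intro d' hd1 hd2
        rw [ts.Hd_unique hd2 (ts.Syl_mem hs)] at hd1; exact hd hd1)
      rw [inv_inv, ts.tl_inv, ts.tl_syl hs] at this
      exact this
    · rw [mul_inv_rev]; exact ts.S1 hs.symm hd
  obtain ⟨β, s, g, hs, rfl, hg⟩ := ts.S2 hz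
  obtain ⟨β', s', g', hs', rfl, hg'⟩ := ts.S2 hz'
  rw [h0 β s hs g hg, h0 β' s' hs' g' hg']
  clear hz hz'
  cases hs with
  | letter x b hxK =>
    generalize hα : ((blk x, b) : ι × Bool) = α at hs'
    cases hs' with
    | letter y c hyK =>
      have h := Prod.mk.inj hα
      obtain rfl := ts.sing y hyK x h.1
      rw [h.2]
    | block i _ h1 h2 h3 => exact absurd hxK (h1 x (Prod.mk.inj hα).1)
  | block i _ h1 h2 h3 =>
    obtain ⟨a, ha1, ha2⟩ := hQ.nice ts i h1
    have key : ∀ β r, Syl G blk K (i, true) β r → (RG.col φ x0 (p * r) ↔ RG.col φ x0 (p * a)) := by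
      intro β r hr
      have : β = (i, true) ∧ r ∈ par G {v | blk v = i} := by
        generalize hα : ((i, true) : ι × Bool) = α at hr
        cases hr with
        | letter x b hx => exact absurd hx (h1 x (Prod.mk.inj hα).1.symm)
        | block j _ h1 h2 h3 => 
          have := (Prod.mk.inj hα).1
          subst this; exact ⟨rfl, h2⟩
      obtain ⟨rfl, hri⟩ := this
      rw [← h0 _ r hr a ha1, ← mul_assoc]
      exact QK.col hx (ha2 r hri) p
    rw [key _ _ (Syl.block i s h1 h2 h3), key _ _ hs']

theorem core [Fintype V] (ts0 : TS G blk K0) (hp : PsiHyp G blk K0 Ψ) (hK : K ⊆ K0) {x0 : V} (hx : x0 ∈ K)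
    {φ : MulAut (RAAG G)} (hQ : QK G blk K φ)
    (hmin : ∀ ψ ∈ Ψ ⊓ BC G blk K, ∑ v, tl G blk K (φ (gen G v)) ≤ ∑ v, tl G blk K (ψ (φ (gen G v)))) :
    ∃ y ∈ K, ∃ b, ∀ g, RG.col φ x0 g ↔ g ∈ H G y b := by
  have ts := ts0.mono hK
  have wh : ∀ {S : Set (ι × Bool)} {e : ι × Bool} {g0 : RAAG G} (he : g0 ∈ Hd G blk K e) (heS : e ∉ S)
    {z0 : RAAG G} (hz0 : inZ G blk K S z0) (hn : ∀ v, NB G blk K S e (φ (gen G v))), False := by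
    intro S e g0 he heS z0 hz0 hn
    obtain ⟨ψ, h1, ⟨Z, t, h2⟩, h3⟩ := whitehead ts0 hp hK he heS hz0 hn
    have := hmin ψ ⟨h1, h2.mem_BC⟩
    omega
  obtain ⟨N, hN⟩ := ts.col_bound hx φ
  have M : ∀ n : ℕ, ∀ p, N ≤ tl G blk K p + n → ∀ e, p⁻¹ ∈ Hd G blk K e → ∀ z, z ∉ Hd G blk K e →
      (RG.col φ x0 (p * z) ↔ RG.col φ x0 p) := by
    intro n
    induction n with
    | zero =>
      intro p hpN e he z hz
      refine ts.base hx φ hN z p ?_ hpN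
      intro d hd hd'
      rw [ts.Hd_unique hd he] at hd'; exact hz hd'
    | succ n ih =>
      intro p hpN e he
      have br := fun d (hd : p⁻¹ ∉ Hd G blk K d) z z' => ts.branch (z := z) (z' := z') hx hQ
        (fun q e' hq => ih q (by omega) e') hd
      let S : Set (ι × Bool) := {d | d ≠ e ∧ ∃ z ∈ Hd G blk K d, ¬ (RG.col φ x0 (p * z) ↔ RG.col φ x0 p)}
      have hS : ∀ z, z ∉ Hd G blk K e → (inZ G blk K S z ↔ ¬ (RG.col φ x0 (p * z) ↔ RG.col φ x0 p)) := by
        intro z hz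
        by_cases hz1 : z = 1
        · subst hz1
          simp [not_inZ_one]
        · obtain ⟨d, hd⟩ := exists_dir (blk := blk) (K := K) hz1
          rw [ts.inZ_iff hd]
          have hde : d ≠ e := by rintro rfl; exact hz hd
          constructor
          · rintro ⟨-, z', hz', h⟩
            rwa [br d (fun h => hde (ts.Hd_unique h he)) z z' hd hz']
          · intro h; exact ⟨hde, z, hd, h⟩
      intro z hz
      by_contra hc
      refine wh (S := S) he (fun h => h.1 rfl) ((hS z hz).2 hc) ?_
      intro v z1 z2 h1 h2 e12
      rw [hS z1 h1, hS z2 h2]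
      have : RG.col φ x0 (p * z1) ↔ RG.col φ x0 (p * z2) := by
        by_contra hcc
        have e3 : p * z2 = p * z1 * φ (gen G v) := by rw [e12]; group
        rw [e3] at hcc
        have := (ts.col_cross hx φ hcc).1
        have : z1 = p⁻¹ := eq_inv_of_mul_eq_one_right this
        exact h1 (this ▸ he)
      rw [this]
  have br := fun d z z' => ts.branch (p := 1) (d := d) (z := z) (z' := z') hx hQ
        (fun q e' hq => M N q (by omega) e') (by simpa using one_notMem_Hd d)
  simp only [one_mul] at br
  let S : Set (ι × Bool) := {d | ∃ z ∈ Hd G blk K d, RG.col φ x0 z}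
  have c1 : ¬ RG.col φ x0 1 := by simpa [RG.col] using one_notMem (G := G) x0 true
  have cx : RG.col φ x0 (φ (gen G x0)) := by
    simpa [RG.col] using lt_self_mem (G := G) x0 true
  obtain ⟨e, he⟩ := exists_dir (G := G) (blk := blk) (K := K) (g := φ (gen G x0)) (by
    intro h; rw [h] at cx; exact c1 cx)
  have hall : ∀ g, RG.col φ x0 g ↔ g ∈ Hd G blk K e := by
    let S' : Set (ι × Bool) := {d | d ≠ e ∧ ∃ z ∈ Hd G blk K d, RG.col φ x0 z}
    have hS : ∀ z, z ∉ Hd G blk K e → (inZ G blk K S' z ↔ RG.col φ x0 z) := by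
      intro z hz
      by_cases hz1 : z = 1
      · subst hz1
        simp [not_inZ_one, c1]
      · obtain ⟨d, hd⟩ := exists_dir (blk := blk) (K := K) hz1
        rw [ts.inZ_iff hd]
        have hde : d ≠ e := by rintro rfl; exact hz hd
        constructor
        · rintro ⟨-, z', hz', h⟩
          rwa [br d z z' hd hz']
        · intro h; exact ⟨hde, z, hd, h⟩
    intro g
    constructor
    · intro hg
      by_contra hc
      refine wh (S := S') he (fun h => h.1 rfl) ((hS g hc).2 hg) ?_
      intro v z1 z2 h1 h2 e12
      rw [hS z1 h1, hS z2 h2]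
      by_contra hcc
      have e3 : z2 = z1 * φ (gen G v) := by rw [e12]; group
      rw [e3] at hcc
      obtain ⟨rfl, rfl⟩ := ts.col_cross hx φ hcc
      rw [e3, one_mul] at h2
      exact h2 he
    · intro hg; exact (br e g _ hg he).2 cx
  obtain ⟨y, b, hyb, hy2⟩ := he
  by_cases hyK : y ∈ K
  · refine ⟨y, hyK, b, fun g => ?_⟩
    rw [hall g, ← hyb, dir_K hyK, ts.Hd_K hyK]
  · exfalso
    rw [dir_N hyK] at hyb
    subst hyb
    have hi : ∀ v, blk v = blk y → v ∉ K := fun v hv hvK => hyK ((ts.sing v hvK y hv.symm) ▸ hvK)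
    obtain ⟨a, ha1, ha2⟩ := hQ.nice ts (blk y) hi
    have hm : gen G y ∈ par G {v | blk v = blk y} := gen_mem rfl
    have h1 := QK.col hx (ha2 _ hm) 1
    rw [one_mul, one_mul, hall, hall] at h1
    exact ha1 (h1.1 (ts.S1 (Syl.block (blk y) _ hi hm (gen_ne_one y)) ha1))
end
end RG

end

section
namespace RG
open scoped Pointwise
universe u
variable {V : Type u} {G : SimpleGraph V}

theorem nat_min {α : Type*} [Nonempty α] (f : α → ℕ) : ∃ a, ∀ b, f a ≤ f b := by
  obtain ⟨n, ⟨a, rfl⟩, h⟩ := WellFounded.has_min (wellFounded_lt (α := ℕ)) (Set.range f) (Set.range_nonempty f)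
  exact ⟨a, fun b => not_lt.1 (h _ ⟨b, rfl⟩)⟩

section
variable {ι : Type u} {blk : V → ι} {K K0 : Set V} {Ψ : Subgroup (MulAut (RAAG G))}

theorem transR (ts : TS G blk K0) (hp : PsiHyp G blk K0 Ψ) {y : V} (hy : y ∈ K0) {g : RAAG G}
    (hg : g ∈ par G {y}ᶜ) : ∃ ψ ∈ Ψ, ψ (gen G y) = gen G y * g ∧ ∀ w ≠ y, ψ (gen G w) = gen G w := by
  refine par_ind (p := fun g => ∃ ψ ∈ Ψ, ψ (gen G y) = gen G y * g ∧ ∀ w ≠ y, ψ (gen G w) = gen G w)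
    ⟨1, one_mem _, by simp, by simp⟩ ?_ hg
  rintro v hv b g hg ⟨ψ, h1, h2, h3⟩
  obtain ⟨χ, c1, c2⟩ := exists_tvR (Ne.symm hv) (ts.le hy v) b
  refine ⟨χ * ψ, mul_mem (hp.tvr y hy v hv b χ c1 c2) h1, ?_, ?_⟩
  · rw [MulAut.mul_apply, h2, map_mul, c1, fix_par (S := {y}ᶜ) (fun w hw => c2 w hw) hg, mul_assoc]
  · intro w hw; rw [MulAut.mul_apply, h3 w hw, c2 w hw]

theorem transL (ts : TS G blk K0) (hp : PsiHyp G blk K0 Ψ) {y : V} (hy : y ∈ K0) {g : RAAG G}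
    (hg : g ∈ par G {y}ᶜ) : ∃ ψ ∈ Ψ, ψ (gen G y) = g * gen G y ∧ ∀ w ≠ y, ψ (gen G w) = gen G w := by
  refine par_ind (p := fun g => ∃ ψ ∈ Ψ, ψ (gen G y) = g * gen G y ∧ ∀ w ≠ y, ψ (gen G w) = gen G w)
    ⟨1, one_mem _, by simp, by simp⟩ ?_ hg
  rintro v hv b g hg ⟨ψ, h1, h2, h3⟩
  obtain ⟨χ, c1, c2⟩ := exists_tvL (Ne.symm hv) (ts.le hy v) b
  refine ⟨ψ * χ, mul_mem h1 (hp.tvl y hy v hv b χ c1 c2), ?_, ?_⟩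
  · rw [MulAut.mul_apply, c1, map_mul, h2, fix_lt (h3 v hv), mul_assoc]
  · intro w hw; rw [MulAut.mul_apply, c2 w hw, h3 w hw]

theorem stage [Fintype V] (ts0 : TS G blk K0) (hp : PsiHyp G blk K0 Ψ) (hK : K ⊆ K0) {x0 : V} (hx : x0 ∈ K)
    {φ : MulAut (RAAG G)} (hQ : QK G blk K φ)
    (hc : ∀ x ∈ K0 \ K, ∃ k, φ (gen G x) = k * gen G x * k⁻¹) :
    ∃ β ∈ Ψ, QK G blk (K \ {x0}) (β * φ) ∧
      ∀ x ∈ K0 \ (K \ {x0}), ∃ k, (β * φ) (gen G x) = k * gen G x * k⁻¹ := by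
  have ts := ts0.mono hK
  suffices h : ∃ β ∈ Ψ ⊓ BC G blk K, β (φ (gen G x0)) = gen G x0 by
    obtain ⟨β, hβ, hβx⟩ := h
    have hQ' := hQ.mul hβ.2
    refine ⟨β, hβ.1, ?_, ?_⟩
    · intro i hi
      by_cases hix : i = blk x0
      · subst hix
        refine ⟨1, fun g hg => ?_⟩
        have hfix : (β * φ)⁻¹ g = g := by
          refine fix_par (S := {v | blk v = blk x0}) (fun w hw => ?_) hg
          have := ts.sing x0 hx w hw
          subst this
          exact inv_apply_eq hβx
        rw [inv_one, one_mul, mul_one, hfix]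
        refine par_mono ?_ hg
        intro w hw
        have := ts.sing x0 hx w hw
        subst this; simp
      · obtain ⟨a, ha⟩ := hQ' i (fun v hv hvK => hi v hv ⟨hvK, by
          rintro rfl; exact hix hv.symm⟩)
        refine ⟨a, fun g hg => par_mono ?_ (ha g hg)⟩
        intro w hw; exact fun h => hw h.1
    · intro x hx'
      by_cases hxx : x = x0
      · subst hxx; exact ⟨1, by rw [MulAut.mul_apply, hβx]; simp⟩
      · have hxK : x ∉ K := fun h => hx'.2 ⟨h, hxx⟩
        obtain ⟨k, hk⟩ := hc x ⟨hx'.1, hxK⟩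
        obtain ⟨l, hl⟩ := hβ.2 (blk x) (fun v hv hvK => hxK ((ts.sing v hvK x hv.symm) ▸ hvK))
        refine ⟨β k * l, ?_⟩
        rw [MulAut.mul_apply, hk, map_mul, map_mul, map_inv, hl _ (gen_mem rfl)]; group
  obtain ⟨⟨ψ, hψ⟩, hmin⟩ := nat_min (fun ψ : (Ψ ⊓ BC G blk K : Subgroup _) =>
    ∑ v, tl G blk K (ψ.1 (φ (gen G v))))
  have hQ1 := hQ.mul hψ.2
  obtain ⟨y, hy, b, hyb⟩ := core ts0 hp hK hx hQ1 (fun χ hχ => by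
    have := hmin ⟨χ * ψ, mul_mem hχ hψ⟩
    simpa using this)
  set φ1 := ψ * φ with hφ1
  -- φ1 x0 = lt y b * g1
  have hcross : ∀ h, RG.col φ1 x0 (h * φ1 (gen G x0)) ↔ RG.col φ1 x0 (h * lt G y b) := by
    intro h
    by_cases h1 : h = 1
    · subst h1
      rw [one_mul, one_mul]
      have a1 : RG.col φ1 x0 (φ1 (gen G x0)) := by
        simpa [RG.col] using lt_self_mem (G := G) x0 true
      have a2 : RG.col φ1 x0 (lt G y b) := (hyb _).2 (lt_self_mem y b)
      exact ⟨fun _ => a2, fun _ => a1⟩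
    · have e1 : RG.col φ1 x0 h ↔ RG.col φ1 x0 (h * φ1 (gen G x0)) := by
        by_contra hcc
        exact h1 (ts.col_cross hx φ1 hcc).1
      rw [← e1, hyb, hyb]
      by_contra hcc
      by_cases h2 : h ∈ H G y b
      · have h3 : h * lt G y b ∉ H G y b := fun h3 => hcc ⟨fun _ => h3, fun _ => h2⟩
        have := (cross_out h2 h3).2.1
        cases b <;> simp at this
      · have h3 : h * lt G y b ∈ H G y b := by
          by_contra h3; exact hcc ⟨fun h => absurd h h2, fun h => absurd h h3⟩
        exact h1 (ts.par_lk hy (cross_in _ _ _ _ _ h2 h3).2.2)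
  obtain ⟨g1, hg1⟩ : ∃ g1, φ1 (gen G x0) = lt G y b * g1 := ⟨(lt G y b)⁻¹ * φ1 (gen G x0), by simp⟩
  have hb : ∀ h, h ∈ H G y b ↔ h * g1 ∈ H G y b := by
    intro h
    have := hcross (h * (lt G y b)⁻¹)
    rw [hg1, ← mul_assoc, inv_mul_cancel_right, hyb, hyb] at this
    exact this.symm
  have hpar : g1 ∈ par G {y}ᶜ := by
    rw [mem_par_iff]
    intro v hv
    have : v = y := by simpa using hv
    subst this
    intro h c
    by_cases hcb : c = b
    · rw [hcb]; exact hb h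
    · rw [bool_ne hcb]
      have := hb (lt G v b * h)
      rw [mul_assoc, H_flip, H_flip, not_iff_not] at this
      exact this
  have hy0 := hK hy
  obtain ⟨χ, m1, hχ1, hχ2⟩ : ∃ χ ∈ Ψ, χ (lt G y b * g1) = lt G y b ∧ ∀ w ≠ y, χ (gen G w) = gen G w := by
    cases b
    · obtain ⟨χ, m1, h1, h2⟩ := transL ts0 hp hy0 hpar
      refine ⟨χ, m1, ?_, h2⟩
      rw [map_mul, lt_false, map_inv, h1, fix_par (S := {y}ᶜ) (fun w hw => h2 w hw) hpar]; group
    · obtain ⟨χ, m1, h1, h2⟩ := transR ts0 hp hy0 (inv_mem hpar)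
      refine ⟨χ, m1, ?_, h2⟩
      rw [map_mul, lt_true, h1, fix_par (S := {y}ᶜ) (fun w hw => h2 w hw) hpar]; group
  obtain ⟨ω, m2, hω1, hω2⟩ : ∃ ω ∈ Ψ, ω (lt G y b) = gen G y ∧ ∀ w ≠ y, ω (gen G w) = gen G w := by
    cases b
    · exact ⟨iv G y, hp.inv y hy0, by rw [lt_false, map_inv, iv_self, inv_inv], fun w hw => iv_ne hw⟩
    · exact ⟨1, one_mem _, by simp, by simp⟩
  obtain ⟨ρ, m3, hρ1, hρ2⟩ := hp.swap y hy0 x0 (hK hx)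
  have hne : ∀ v ∉ K, v ≠ y ∧ v ≠ x0 := fun v hv =>
    ⟨by rintro rfl; exact hv hy, by rintro rfl; exact hv hx⟩
  refine ⟨ρ * (ω * (χ * ψ)), mul_mem ⟨m3, fix_mem_BC (fun v hv => hρ2 v (Or.inr (hne v hv)))⟩
    (mul_mem ⟨m2, fix_mem_BC (fun v hv => hω2 v (hne v hv).1)⟩
      (mul_mem ⟨m1, fix_mem_BC (fun v hv => hχ2 v (hne v hv).1)⟩ hψ)), ?_⟩
  have : ψ (φ (gen G x0)) = lt G y b * g1 := hg1
  rw [MulAut.mul_apply, MulAut.mul_apply, MulAut.mul_apply, this, hχ1, hω1, hρ1]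

theorem delta_aux [Fintype V] (ts0 : TS G blk K0) (hp : PsiHyp G blk K0 Ψ) (n : ℕ) : ∀ K : Set V, K ⊆ K0 →
    K.ncard = n → ∀ φ : MulAut (RAAG G), QK G blk K φ →
    (∀ x ∈ K0 \ K, ∃ k, φ (gen G x) = k * gen G x * k⁻¹) →
    ∃ β ∈ Ψ, ∀ x ∈ K0, ∃ k, (β * φ) (gen G x) = k * gen G x * k⁻¹ := by
  induction n with
  | zero =>
    intro K hK hn φ hQ hc
    have : K = ∅ := by rwa [Set.ncard_eq_zero (Set.toFinite _)] at hn
    subst this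
    exact ⟨1, one_mem _, fun x hx => by simpa using hc x ⟨hx, by simp⟩⟩
  | succ n ih =>
    intro K hK hn φ hQ hc
    obtain ⟨x0, hx⟩ : K.Nonempty := by
      rw [← Set.ncard_pos (Set.toFinite _)]; omega
    obtain ⟨β, h1, h2, h3⟩ := stage ts0 hp hK hx hQ hc
    obtain ⟨β', h1', h2'⟩ := ih (K \ {x0}) (fun x hx => hK hx.1) (by
      rw [Set.ncard_sdiff_singleton_of_mem hx]; omega) (β * φ) h2 h3
    exact ⟨β' * β, mul_mem h1' h1, by simpa [mul_assoc] using h2'⟩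

theorem delta [Fintype V] (ts0 : TS G blk K0) (hp : PsiHyp G blk K0 Ψ) {φ : MulAut (RAAG G)}
    (hQ : QK G blk K0 φ) :
    ∃ β ∈ Ψ, ∀ x ∈ K0, ∃ k, β (φ (gen G x)) = k * gen G x * k⁻¹ :=
  delta_aux ts0 hp _ K0 subset_rfl rfl φ hQ (fun x hx => absurd hx.1 hx.2)
end

/-- the elliptic criterion -/
theorem elliptic [Fintype V] {K : Set V} (hK : ∀ x ∈ K, ∀ w, ¬ G.Adj x w) (α : MulAut (RAAG G)) (D : Set V)
    (h : ∀ (g : RAAG G), ∀ u ∈ K, ∀ b, (∀ d ∈ D, Disjoint (α (gen G d) • g • H G u b) (g • H G u b)) ∨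
      (∀ d ∈ D, (α (gen G d) • g • H G u b) ∪ (g • H G u b) = Set.univ)) :
    ∃ a, ∀ g ∈ par G D, a⁻¹ * α g * a ∈ par G Kᶜ := by
  classical
  rcases D.eq_empty_or_nonempty with rfl | ⟨d0, hd0⟩
  · refine ⟨1, fun g hg => ?_⟩
    rw [par_empty, Subgroup.mem_bot] at hg
    subst hg; simp
  let blk : V → Option V := fun v => if v ∈ K then some v else none
  have hbK : ∀ {v}, v ∈ K → blk v = some v := fun hv => by simp [blk, hv]
  have hbN : ∀ {v}, v ∉ K → blk v = none := fun hv => by simp [blk, hv]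
  have hbn : ∀ v, blk v = none ↔ v ∉ K := fun v => by
    by_cases hv : v ∈ K
    · simp [hbK hv, hv]
    · simp [hbN hv, hv]
  have ts : TS G blk K := by
    refine ⟨fun u v huv => ?_, fun x hx y hy => ?_⟩
    · rw [hbN (fun h => hK u h v huv), hbN (fun h => hK v h u huv.symm)]
    · by_contra hne
      rw [hbK hx] at hy
      by_cases hyK : y ∈ K
      · rw [hbK hyK] at hy; exact hne (Option.some.inj hy)
      · rw [hbN hyK] at hy; cases hy
  have hset : {v | blk v = none} = Kᶜ := by ext v; exact hbn v
  have stay : ∀ {w : RAAG G} {u : V} {b : Bool}, w ∈ H G u b → w * lt G u b ∈ H G u b := by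
    intro w u b hw
    by_contra hc
    have := (cross_out hw hc).2.1
    cases b <;> simp at this
  -- split off the initial block
  have split : ∀ w : RAAG G, w ∉ par G Kᶜ → ∃ g1 ∈ par G Kᶜ, ∃ w1, w = g1 * w1 ∧
      tl G blk K (w1 * g1) ≤ tl G blk K w ∧ ∃ u ∈ K, ∃ b, w1 ∈ H G u b := by
    intro w hw
    obtain ⟨g1, hg1, w1, rfl, hw1⟩ := par_strip Kᶜ (len w) w rfl
    have hw1' : w1 ∉ Hd G blk K (none, true) := by
      rw [Hd_N (fun v hv => (hbn v).1 hv)]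
      rintro ⟨-, v, c, hv, h⟩
      exact hw1 v ((hbn v).1 hv) c h
    refine ⟨g1, hg1, w1, rfl, ?_, ?_⟩
    · by_cases h1 : g1 = 1
      · subst h1; simp
      · have hs : Syl G blk K (none, true) (none, true) g1 :=
          Syl.block none g1 (fun v hv => (hbn v).1 hv) (by rwa [hset]) h1
        rw [ts.tl_cons hs hw1']
        refine (ts.tl_mul_le _ _).trans ?_
        rw [ts.tl_syl hs]
    · have hne : w1 ≠ 1 := by rintro rfl; exact hw (by simpa using hg1)
      obtain ⟨u, b, hu⟩ := exists_first hne
      refine ⟨u, ?_, b, hu⟩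
      by_contra hc; exact hw1 u hc b hu
  obtain ⟨a, ha⟩ := nat_min (fun a : RAAG G => tl G blk K (a⁻¹ * α (gen G d0) * a))
  have h0 : a⁻¹ * α (gen G d0) * a ∈ par G Kᶜ := by
    by_contra hw
    obtain ⟨g1, hg1, w1, hw1, htl, u, hu, b, hub⟩ := split _ hw
    have hm : w1 * g1 ∈ H G u b := (noCross_par (by simpa using hu) hg1 _ _).1 hub
    have hαd : α (gen G d0) = (a * g1) * (w1 * g1) * (a * g1)⁻¹ := by
      have : α (gen G d0) = a * (a⁻¹ * α (gen G d0) * a) * a⁻¹ := by group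
      rw [this, hw1]; group
    rcases h (a * g1) u hu b with h' | h'
    · have := h' d0 hd0
      have hA : (a * g1) * ((w1 * g1) * lt G u b) ∈ α (gen G d0) • (a * g1) • H G u b := by
        rw [mem_sm, mem_hs, hαd]
        have : (a * g1)⁻¹ * ((a * g1 * (w1 * g1) * (a * g1)⁻¹)⁻¹ * (a * g1 * (w1 * g1 * lt G u b)))
          = lt G u b := by group
        rw [this]; exact lt_self_mem u b
      have hB : (a * g1) * ((w1 * g1) * lt G u b) ∈ (a * g1) • H G u b := by
        rw [mem_hs, inv_mul_cancel_left]; exact stay hm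
      exact Set.disjoint_left.1 this hA hB
    · have := h' d0 hd0
      have h1 : a * g1 ∈ (α (gen G d0) • (a * g1) • H G u b) ∪ ((a * g1) • H G u b) := by
        rw [this]; trivial
      rcases h1 with h1 | h1
      · rw [mem_sm, mem_hs, hαd] at h1
        rw [show (a * g1)⁻¹ * ((a * g1 * (w1 * g1) * (a * g1)⁻¹)⁻¹ * (a * g1)) = (w1 * g1)⁻¹ by group] at h1
        -- contradiction with minimality
        generalize hw' : w1 * g1 = w' at *
        have hs : Syl G blk K (blk u, b) (blk u, !b) (lt G u b) := Syl.letter u b hu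
        have e1 : tl G blk K w' = tl G blk K ((lt G u b)⁻¹ * w') + 1 := by
          conv_lhs => rw [show w' = lt G u b * ((lt G u b)⁻¹ * w') by group]
          refine ts.tl_cons hs ?_
          rw [ts.Hd_K hu, H_flip']; exact fun h => h hm
        have h2 : ((lt G u b)⁻¹ * w')⁻¹ ∈ H G u b := by
          by_contra hc
          have h3 : ((lt G u b)⁻¹ * w')⁻¹ * lt G u (!b) ∈ H G u b := by
            rw [← lt_inv, mul_inv_rev, inv_inv, mul_inv_cancel_right]; exact h1
          have := (cross_in _ _ _ _ _ hc h3).2.1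
          cases b <;> simp at this
        have e2 : tl G blk K ((lt G u b)⁻¹ * w')⁻¹ = tl G blk K ((lt G u b)⁻¹ * ((lt G u b)⁻¹ * w')⁻¹) + 1 := by
          conv_lhs => rw [show ((lt G u b)⁻¹ * w')⁻¹ = lt G u b * ((lt G u b)⁻¹ * ((lt G u b)⁻¹ * w')⁻¹) by group]
          refine ts.tl_cons hs ?_
          rw [ts.Hd_K hu, H_flip']; exact fun h => h h2
        rw [ts.tl_inv] at e2
        have h4 := ha (a * g1 * lt G u b)
        rw [show (a * g1 * lt G u b)⁻¹ * α (gen G d0) * (a * g1 * lt G u b) =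
          ((lt G u b)⁻¹ * ((lt G u b)⁻¹ * w')⁻¹)⁻¹ by rw [hαd]; group, ts.tl_inv] at h4
        omega
      · exact notMem_base _ _ _ h1
  have hd : ∀ d ∈ D, a⁻¹ * α (gen G d) * a ∈ par G Kᶜ := by
    intro d hd
    by_contra hw
    obtain ⟨g1, hg1, w1, hw1, htl, u, hu, b, hub⟩ := split _ hw
    have hm : w1 * g1 ∈ H G u b := (noCross_par (by simpa using hu) hg1 _ _).1 hub
    have hαd : α (gen G d) = (a * g1) * (w1 * g1) * (a * g1)⁻¹ := by
      have : α (gen G d) = a * (a⁻¹ * α (gen G d) * a) * a⁻¹ := by group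
      rw [this, hw1]; group
    rcases h (a * g1) u hu b with h' | h'
    · have := h' d hd
      have hA : (a * g1) * ((w1 * g1) * lt G u b) ∈ α (gen G d) • (a * g1) • H G u b := by
        rw [mem_sm, mem_hs, hαd]
        have : (a * g1)⁻¹ * ((a * g1 * (w1 * g1) * (a * g1)⁻¹)⁻¹ * (a * g1 * (w1 * g1 * lt G u b)))
          = lt G u b := by group
        rw [this]; exact lt_self_mem u b
      have hB : (a * g1) * ((w1 * g1) * lt G u b) ∈ (a * g1) • H G u b := by
        rw [mem_hs, inv_mul_cancel_left]; exact stay hm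
      exact Set.disjoint_left.1 this hA hB
    · have := h' d0 hd0
      have h1 : a * g1 ∈ (α (gen G d0) • (a * g1) • H G u b) ∪ ((a * g1) • H G u b) := by
        rw [this]; trivial
      rcases h1 with h1 | h1
      · rw [mem_sm, mem_hs] at h1
        have h2 : (a * g1)⁻¹ * ((α (gen G d0))⁻¹ * (a * g1)) ∈ par G Kᶜ := by
          have := mul_mem (mul_mem (inv_mem hg1) (inv_mem h0)) hg1
          rwa [show g1⁻¹ * (a⁻¹ * α (gen G d0) * a)⁻¹ * g1 =
            (a * g1)⁻¹ * ((α (gen G d0))⁻¹ * (a * g1)) by group] at this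
        exact par_H h2 h1 hu
      · exact notMem_base _ _ _ h1
  refine ⟨a, fun g hg => ?_⟩
  refine par_ind (p := fun g => a⁻¹ * α g * a ∈ par G Kᶜ) (by simp) ?_ hg
  intro v hv b g hg ih
  have : a⁻¹ * α (lt G v b) * a ∈ par G Kᶜ := by
    cases b
    · have := inv_mem (hd v hv)
      rwa [show (a⁻¹ * α (gen G v) * a)⁻¹ = a⁻¹ * α (lt G v false) * a by rw [lt_false, map_inv]; group] at this
    · simpa using hd v hv
  have := mul_mem this ih
  rwa [show a⁻¹ * α (lt G v b) * a * (a⁻¹ * α g * a) = a⁻¹ * α (lt G v b * g) * a by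
    rw [map_mul]; group] at this
end RG

end

section
namespace RG
open scoped Pointwise
universe u
variable {V : Type u} {G : SimpleGraph V}

theorem ex_gen [DecidableEq V] (t v : V) : ex t (gen G v) = if t = v then 1 else 0 := by
  split_ifs with h
  · subst h; simp
  · exact ex_gen_ne (fun e => h e.symm)

theorem ex_expand [Fintype V] (α : MulAut (RAAG G)) (t : V) (y : RAAG G) :
    ex t (α y) = ∑ s, ex s y * ex t (α (gen G s)) := by
  classical
  induction y using ind_left with
  | one => simp
  | step v b g ih =>
    rw [map_mul, ex_mul, ih]
    simp only [ex_mul, add_mul, Finset.sum_add_distrib]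
    congr 1
    cases b
    · simp [ex_gen]
    · simp [ex_gen]

/-- automorphisms acting trivially on the abelianization -/
def IA (φ : MulAut (RAAG G)) : Prop := ∀ t y, ex t (φ y) = ex t y

theorem IA.of_gen [Fintype V] {φ : MulAut (RAAG G)} (h : ∀ t v, ex t (φ (gen G v)) = ex t (gen G v)) :
    IA φ := by
  classical
  intro t y
  rw [ex_expand]
  simp [h, ex_gen]

theorem IA.inv {φ : MulAut (RAAG G)} (h : IA φ) : IA φ⁻¹ := by
  intro t y
  conv_rhs => rw [← MulAut.apply_inv_self _ φ y]
  rw [h]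

theorem IA.mul {φ ψ : MulAut (RAAG G)} (h : IA φ) (h' : IA ψ) : IA (φ * ψ) := by
  intro t y
  rw [MulAut.mul_apply, h, h']

theorem IA.conj (x : RAAG G) : IA (MulAut.conj x) := by
  intro t y
  simp

theorem le_of_gen {S : Set V} {P : Subgroup (RAAG G)} {f : RAAG G →* RAAG G}
    (h : ∀ w ∈ S, f (gen G w) ∈ P) {g : RAAG G} (hg : g ∈ par G S) : f g ∈ P := by
  refine par_ind (p := fun g => f g ∈ P) (by simp) ?_ hg
  intro w hw b g _ ih
  rw [map_mul]
  refine mul_mem ?_ ih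
  cases b
  · simpa using h w hw
  · simpa using h w hw

theorem lk_push [Finite V] {φ : MulAut (RAAG G)} (hφ : IA φ) (v : V) :
    ∃ h, ∀ g ∈ par G (lk G v), h⁻¹ * φ g * h ∈ par G (lk G v) := by
  obtain ⟨m, E, hE, hm⟩ := exists_axis (v := v) (g := φ (gen G v)) (by rw [hφ]; simp)
  obtain ⟨h, b, rfl⟩ := id hE
  have hm0 : m ≠ 0 := by
    rintro rfl
    simp at hm
  refine ⟨h, fun g hg => ?_⟩
  have key := le_of_gen (S := lk G v) (P := par G (lk G v)) (f := (MulAut.conj h⁻¹ * φ : MulAut (RAAG G)).toMonoidHom) ?_ hg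
  · simpa using key
  intro w hw
  have hw' : G.Adj v w := hw
  have hc : Commute (φ (gen G w)) (φ (gen G v) ^ m) := by
    refine Commute.zpow_right ?_ m
    show φ (gen G w) * φ (gen G v) = φ (gen G v) * φ (gen G w)
    rw [← map_mul, ← map_mul, gen_comm hw']
  obtain ⟨n, k, hk⟩ := axis hE hm hc
  have h1 := stab_hs.1 hk
  have h2 := ex_par (v := v) (fun h => G.loopless.irrefl v h) h1
  have h3 : k * m = 0 := by
    have hwv : w ≠ v := hw'.ne'
    simpa [hφ v, ex_gen_ne hwv] using h2
  have hk0 : k = 0 := by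
    rcases mul_eq_zero.1 h3 with h | h
    · exact h
    · exact absurd h hm0
  subst hk0
  rw [zpow_zero, mul_one] at hk
  have := stab_hs.1 (axis_stab hE hm hc hk)
  simpa using this

theorem lk_fix [Finite V] {φ : MulAut (RAAG G)} (hφ : IA φ) (v : V) :
    ∃ h, ∀ φ1 : MulAut (RAAG G), φ1 = MulAut.conj h * φ → (∀ g ∈ par G (lk G v), φ1 g ∈ par G (lk G v)) ∧
      (∀ g ∈ par G (lk G v), φ1⁻¹ g ∈ par G (lk G v)) := by
  obtain ⟨h, hh⟩ := lk_push hφ v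
  refine ⟨h⁻¹, ?_⟩
  rintro φ1 rfl
  set φ1 := MulAut.conj h⁻¹ * φ with hφ1
  have h1 : ∀ g ∈ par G (lk G v), φ1 g ∈ par G (lk G v) := by
    intro g hg; simpa [hφ1] using hh g hg
  refine ⟨h1, fun g hg => ?_⟩
  have hIA : IA φ1 := (IA.conj _).mul hφ
  obtain ⟨h', hh'⟩ := lk_push hIA.inv v
  set x := φ1 h' with hx
  set r := ret G (lk G v) x with hr
  have hrm : r ∈ par G (lk G v) := ret_mem _ _
  have key : ∀ g ∈ par G (lk G v), ∃ p ∈ par G (lk G v), φ1 p = r⁻¹ * g * r := by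
    intro g hg
    refine ⟨_, hh' g hg, ?_⟩
    have e : φ1 (h'⁻¹ * φ1⁻¹ g * h') = x⁻¹ * g * x := by simp [hx]
    have := ret_of_mem (h1 _ (hh' g hg))
    rw [← this, e, map_mul, map_mul, map_inv, ret_of_mem hg]
  obtain ⟨p, hp, hpe⟩ := key (r * g * r⁻¹) (mul_mem (mul_mem hrm hg) (inv_mem hrm))
  have : φ1 p = g := by rw [hpe]; group
  rw [inv_apply_eq this]; exact hp

/-- vertices whose link contains the link of `v` -/
def UU (G : SimpleGraph V) (v : V) : Set V := {x | ∀ w, G.Adj v w → G.Adj x w}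
def KK (G : SimpleGraph V) (v : V) : Set V := {x | ∀ w, G.Adj x w ↔ G.Adj v w}

theorem KK_sub {v x : V} (h : x ∈ KK G v) : x ∈ UU G v := fun w hw => (h w).2 hw
theorem UU_lk {v x : V} (h : x ∈ UU G v) : ¬ G.Adj v x := fun hx => G.loopless.irrefl x (h x hx)
theorem UU_comm {v : V} {g p : RAAG G} (hg : g ∈ par G (UU G v)) (hp : p ∈ par G (lk G v)) :
    g * p = p * g := by
  refine par_ind (p := fun g => g * p = p * g) (by simp) ?_ hg
  intro x hx b g _ ih
  have : p * lt G x b = lt G x b * p := par_lk_comm (par_mono (fun w hw => hx w hw) hp) b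
  rw [mul_assoc, ih, ← mul_assoc, ← this, mul_assoc]

theorem U_fix [Finite V] {φ : MulAut (RAAG G)} (hφ : IA φ) {v : V}
    (h : ∀ g ∈ par G (lk G v), φ⁻¹ g ∈ par G (lk G v)) :
    ∀ g ∈ par G (UU G v), φ g ∈ par G (UU G v) := by
  intro g hg
  refine le_of_gen (f := φ.toMonoidHom) ?_ hg
  intro x hx
  show φ (gen G x) ∈ _
  have hst : ∀ w, G.Adj v w → φ (gen G x) ∈ par G (star G w) := by
    intro w hw
    rw [← cent_iff]
    have := UU_comm (gen_mem hx) (h _ (gen_mem (S := lk G v) hw))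
    have := congrArg φ this
    simpa using this
  rw [mem_par_iff]
  intro t ht
  have : ∃ w, G.Adj v w ∧ ¬ G.Adj t w := by
    simpa [UU] using ht
  obtain ⟨w, hw, htw⟩ := this
  by_cases e : t = w
  · subst e
    have hne : x ≠ t := fun e => UU_lk hx (e ▸ hw)
    have := par_lk_of_star (hst t hw) (by rw [hφ]; exact ex_gen_ne hne)
    exact noCross_par (fun h => G.loopless.irrefl t h) this
  · refine noCross_par ?_ (hst w hw)
    rw [mem_star]; rintro (h | h)
    · exact e h
    · exact htw h.symm

section geom
variable [Finite V]

theorem stabU {v u : V} (hu : u ∈ KK G v) {g y : RAAG G} (hg : g ∈ par G (UU G v)) {b : Bool}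
    (h : y • g • H G u b = g • H G u b) : y ∈ par G (lk G v) := by
  have h1 := stab_hs.1 h
  have e : lk G u = lk G v := by ext w; exact hu w
  rw [e] at h1
  have := UU_comm hg h1
  have e2 : y = g * (g⁻¹ * y * g) * g⁻¹ := by group
  rw [e2, this]; simpa [mul_assoc] using h1

theorem no_hyp {θ : MulAut (RAAG G)} {v u : V} (hθ' : ∀ g ∈ par G (lk G v), θ⁻¹ g ∈ par G (lk G v))
    (hu : u ∈ KK G v) {g : RAAG G} (hg : g ∈ par G (UU G v)) {b : Bool} {y z : RAAG G}
    (hc : z * y = y * z)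
    (hex : ∀ (n : ℕ) (k : ℤ), ∃ s, ¬ G.Adj v s ∧ ex s (z ^ (n + 1) * y ^ k) ≠ 0) :
    ¬ (θ y • g • H G u b ⊂ g • H G u b) := by
  intro h
  obtain ⟨n, k, hk⟩ := axis (E := g • H G u b) (z := θ z) ⟨g, b, rfl⟩ h (by rw [← map_mul, ← map_mul, hc])
  have h1 := hθ' _ (stabU hu hg hk)
  rw [← map_pow, ← map_zpow, ← map_mul, MulAut.inv_apply_self] at h1
  obtain ⟨s, hs, h⟩ := hex n k
  exact h (ex_par hs h1)

theorem type_or {θ : MulAut (RAAG G)} {v u : V} (hθ' : ∀ g ∈ par G (lk G v), θ⁻¹ g ∈ par G (lk G v))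
    (hu : u ∈ KK G v) {g : RAAG G} (hg : g ∈ par G (UU G v)) {b : Bool} {c d : V}
    (hcd : G.Adj c d) (hc : ¬ G.Adj v c) (hd : ¬ G.Adj v d) :
    Disjoint (θ (gen G c) • g • H G u b) (g • H G u b) ∨
      (θ (gen G c) • g • H G u b) ∪ (g • H G u b) = Set.univ := by
  have hE : IsHS u (g • H G u b) := ⟨g, b, rfl⟩
  have hne : θ (gen G c) • g • H G u b ≠ g • H G u b := by
    intro h
    have h1 := hθ' _ (stabU hu hg h)
    rw [MulAut.inv_apply_self, gen_mem_par_iff] at h1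
    exact hc h1
  have hx : ∀ ε : ℤ, ∀ (n : ℕ) (k : ℤ), ∃ s, ¬ G.Adj v s ∧ ex s ((gen G d) ^ (n + 1) * (gen G c ^ ε) ^ k) ≠ 0 := by
    intro ε n k
    refine ⟨d, hd, ?_⟩
    simp [ex_gen_ne hcd.ne]
    omega
  have hcm : ∀ ε : ℤ, gen G d * gen G c ^ ε = gen G c ^ ε * gen G d := fun ε =>
    Commute.zpow_right (show Commute _ _ from gen_comm hcd.symm) ε
  rcases nested (G.loopless.irrefl u) (hE.smul (θ (gen G c))) hE with h | h | h | h
  · have := no_hyp hθ' hu hg (b := b) (hcm 1) (hx 1)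
    rw [zpow_one] at this
    exact absurd (h.ssubset_of_ne hne) this
  · have := no_hyp hθ' hu hg (b := b) (hcm (-1)) (hx (-1))
    exfalso; apply this
    have h2 := ssub_smul (θ (gen G c))⁻¹ (h.ssubset_of_ne hne.symm)
    simpa [zpow_neg_one] using h2
  · exact Or.inl h
  · exact Or.inr h

theorem type_adj {θ : MulAut (RAAG G)} {v u : V} (hθ' : ∀ g ∈ par G (lk G v), θ⁻¹ g ∈ par G (lk G v))
    (hu : u ∈ KK G v) {g : RAAG G} (hg : g ∈ par G (UU G v)) {b : Bool} {c d : V}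
    (hcd : G.Adj c d) (hc : ¬ G.Adj v c) (hd : ¬ G.Adj v d)
    (h1 : Disjoint (θ (gen G c) • g • H G u b) (g • H G u b))
    (h2 : (θ (gen G d) • g • H G u b) ∪ (g • H G u b) = Set.univ) : False := by
  have hE : IsHS u (g • H G u b) := ⟨g, b, rfl⟩
  have hs : θ (gen G c) • g • H G u b ⊂ θ (gen G d) • g • H G u b := by
    have a0 : θ (gen G c) • g • H G u b ⊆ (g • H G u b)ᶜ := fun x hx => Set.disjoint_left.1 h1 hx
    have a1 : θ (gen G c) • g • H G u b ⊂ (g • H G u b)ᶜ := a0.ssubset_of_ne (no_inv hE)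
    refine a1.trans_subset ?_
    intro x hx
    have : x ∈ (θ (gen G d) • g • H G u b) ∪ (g • H G u b) := h2 ▸ Set.mem_univ x
    rcases this with h | h
    · exact h
    · exact absurd h hx
  have hs' := ssub_smul (θ (gen G d))⁻¹ hs
  rw [inv_smul_smul, smul_smul, ← map_inv, ← map_mul] at hs'
  have hcom : Commute (gen G c) (gen G d) := gen_comm hcd
  refine no_hyp hθ' hu hg (z := gen G c) ?_ ?_ hs'
  · exact ((hcom.inv_right).mul_right (Commute.refl _)).eq
  · intro n k
    by_cases hk : k = 0
    · refine ⟨c, hc, ?_⟩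
      simp [hk]; omega
    · refine ⟨d, hd, ?_⟩
      simp [ex_gen_ne hcd.ne, hk]

end geom
end RG

end

section
namespace RG
open scoped Pointwise
universe u
variable {V : Type u} {G : SimpleGraph V}

/-! ### Induced subgraphs -/
section emb
variable {U : Set V}

def em (G : SimpleGraph V) (U : Set V) : RAAG (G.induce U) →* RAAG G :=
  lift (fun x => gen G x.1) (fun x y h => gen_comm h)

@[simp] theorem em_gen (x : U) : em G U (gen _ x) = gen G x.1 := by simp [em]

theorem em_lt (x : U) (b : Bool) : em G U (lt _ x b) = lt G x.1 b := by cases b <;> simp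

open Classical in
noncomputable def rh (G : SimpleGraph V) (U : Set V) : RAAG G →* RAAG (G.induce U) :=
  lift (fun x => if h : x ∈ U then gen _ ⟨x, h⟩ else 1) (fun x y h => by
    by_cases hx : x ∈ U <;> by_cases hy : y ∈ U <;> simp [hx, hy]
    exact gen_comm (G := G.induce U) h)

theorem rh_gen (x : U) : rh G U (gen G x.1) = gen _ x := by simp [rh]

theorem rh_em (g : RAAG (G.induce U)) : rh G U (em G U g) = g := by
  have : (rh G U).comp (em G U) = MonoidHom.id _ := hom_ext (fun x => by simp [rh_gen])
  exact DFunLike.congr_fun this g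

theorem em_inj : Function.Injective (em G U) := Function.LeftInverse.injective rh_em

theorem em_mem (g : RAAG (G.induce U)) : em G U g ∈ par G U := by
  induction g using ind_left with
  | one => simp
  | step x b g ih => rw [map_mul, em_lt]; exact mul_mem (lt_mem x.2 b) ih

theorem em_rh {g : RAAG G} (hg : g ∈ par G U) : em G U (rh G U g) = g := by
  refine par_ind (p := fun g => em G U (rh G U g) = g) (by simp) ?_ hg
  intro x hx b g _ ih
  rw [map_mul, map_mul, ih]
  congr 1
  cases b
  · simp [rh_gen (G := G) ⟨x, hx⟩]
  · simp [rh_gen (G := G) ⟨x, hx⟩]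

theorem st_em (g : RAAG (G.induce U)) (x : U) : st (em G U g) x.1 = st g x := by
  induction g using ind_left generalizing x with
  | one => simp [st_one]
  | step y b g ih =>
    rw [map_mul, em_lt, st_mul, st_mul]
    unfold act
    rw [ih y]
    split_ifs with h
    · unfold pop; rw [ih x]
      by_cases ha : G.Adj y.1 x.1
      · rw [if_pos ha, if_pos (show (G.induce U).Adj y x from ha)]
      · rw [if_neg ha, if_neg (show ¬ (G.induce U).Adj y x from ha)]
    · unfold push; rw [ih x]
      by_cases e : x = y
      · rw [if_pos (congrArg Subtype.val e), if_pos e]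
      · rw [if_neg (fun h => e (Subtype.ext h)), if_neg e]
        by_cases ha : G.Adj y.1 x.1
        · rw [if_pos ha, if_pos (show (G.induce U).Adj y x from ha)]
        · rw [if_neg ha, if_neg (show ¬ (G.induce U).Adj y x from ha)]

theorem H_em {g : RAAG (G.induce U)} {x : U} {b : Bool} : em G U g ∈ H G x.1 b ↔ g ∈ H (G.induce U) x b := by
  rw [mem_H, mem_H, st_em]

/-- restriction of an automorphism -/
theorem exists_restr {φ : MulAut (RAAG G)} (h1 : ∀ g ∈ par G U, φ g ∈ par G U)
    (h2 : ∀ g ∈ par G U, φ⁻¹ g ∈ par G U) :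
    ∃ α : MulAut (RAAG (G.induce U)), (∀ g, em G U (α g) = φ (em G U g)) ∧
      ∀ g, em G U (α⁻¹ g) = φ⁻¹ (em G U g) := by
  have e1 : ∀ g, em G U (rh G U (φ (em G U g))) = φ (em G U g) := fun g => em_rh (h1 _ (em_mem g))
  have e2 : ∀ g, em G U (rh G U (φ⁻¹ (em G U g))) = φ⁻¹ (em G U g) := fun g => em_rh (h2 _ (em_mem g))
  let f : RAAG (G.induce U) →* RAAG (G.induce U) := (rh G U).comp (φ.toMonoidHom.comp (em G U))
  let f' : RAAG (G.induce U) →* RAAG (G.induce U) := (rh G U).comp (φ⁻¹.toMonoidHom.comp (em G U))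
  have hf : ∀ g, em G U (f g) = φ (em G U g) := e1
  have hf' : ∀ g, em G U (f' g) = φ⁻¹ (em G U g) := e2
  have a1 : ∀ g, f' (f g) = g := by
    intro g; apply em_inj; rw [hf', hf]; simp
  have a2 : ∀ g, f (f' g) = g := by
    intro g; apply em_inj; rw [hf, hf']; simp
  refine ⟨mkAut f f' (fun v => a1 _) (fun v => a2 _), hf, fun g => ?_⟩
  rw [← hf']; congr 1

end emb

/-! ### Blocks -/
section blocks
variable {v : V}

noncomputable def bk (G : SimpleGraph V) (v : V) (x : UU G v) : (G.induce (lk G v)ᶜ).ConnectedComponent :=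
  SimpleGraph.connectedComponentMk _ ⟨x.1, UU_lk x.2⟩

def KU (G : SimpleGraph V) (v : V) : Set (UU G v) := {x | x.1 ∈ KK G v}

theorem KK_reach {x : V} (hx : x ∈ KK G v) (y : ((lk G v)ᶜ : Set V)) (h : (G.induce (lk G v)ᶜ).Reachable ⟨x, UU_lk (KK_sub hx)⟩ y) :
    y.1 = x := by
  obtain ⟨p⟩ := h
  cases p with
  | nil => rfl
  | cons ha q =>
    rename_i z
    exact absurd ((hx z.1).1 ha) z.2

theorem tsU : TS (G.induce (UU G v)) (bk G v) (KU G v) where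
  adj x y h := by
    unfold bk
    rw [SimpleGraph.ConnectedComponent.eq]
    refine SimpleGraph.Adj.reachable ?_
    exact h
  sing x hx y h := by
    unfold bk at h
    rw [SimpleGraph.ConnectedComponent.eq] at h
    exact Subtype.ext (KK_reach hx _ h.symm)

/-- automorphisms conjugating the generators outside the class of `v` that extend -/
def cj (α : MulAut (RAAG G)) (w : V) : Prop := ∃ k, α (gen G w) = k * gen G w * k⁻¹

theorem cj.mul {α β : MulAut (RAAG G)} {w : V} (h : cj α w) (h' : cj β w) : cj (α * β) w := by
  obtain ⟨k, hk⟩ := h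
  obtain ⟨k', hk'⟩ := h'
  refine ⟨α k' * k, ?_⟩
  rw [MulAut.mul_apply, hk', map_mul, map_mul, hk, map_inv]
  group

theorem cj.inv {α : MulAut (RAAG G)} {w : V} (h : cj α w) : cj α⁻¹ w := by
  obtain ⟨k, hk⟩ := h
  refine ⟨(α⁻¹ k)⁻¹, ?_⟩
  apply inv_apply_eq
  simp [hk]
  group

theorem cj.ex {α : MulAut (RAAG G)} {w : V} (h : cj α w) (t : V) : ex t (α (gen G w)) = ex t (gen G w) := by
  obtain ⟨k, hk⟩ := h
  rw [hk]; simp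

def PsiU [Finite V] (G : SimpleGraph V) (v : V) : Subgroup (MulAut (RAAG (G.induce (UU G v)))) where
  carrier := {β | ∃ γ ∈ NN G, (∀ x, γ (em G (UU G v) x) = em G (UU G v) (β x)) ∧ ∀ w ∉ KK G v, cj γ w}
  mul_mem' := by
    rintro β β' ⟨γ, h1, h2, h3⟩ ⟨γ', h1', h2', h3'⟩
    refine ⟨γ * γ', mul_mem h1 h1', fun x => ?_, fun w hw => (h3 w hw).mul (h3' w hw)⟩
    rw [MulAut.mul_apply, h2', h2, MulAut.mul_apply]
  one_mem' := ⟨1, one_mem _, fun x => rfl, fun w _ => ⟨1, by simp⟩⟩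
  inv_mem' := by
    rintro β ⟨γ, h1, h2, h3⟩
    refine ⟨γ⁻¹, inv_mem h1, fun x => ?_, fun w hw => (h3 w hw).inv⟩
    apply inv_apply_eq
    rw [h2, MulAut.apply_inv_self]

theorem mem_PsiU [Finite V] {β : MulAut (RAAG (G.induce (UU G v)))} {γ : MulAut (RAAG G)} (h1 : γ ∈ NN G)
    (h2 : ∀ x, γ (gen G x.1) = em G (UU G v) (β (gen _ x))) (h3 : ∀ w ∉ KK G v, cj γ w) : β ∈ PsiU G v := by
  refine ⟨γ, h1, fun x => ?_, h3⟩
  have : (γ.toMonoidHom.comp (em G (UU G v))) = (em G (UU G v)).comp β.toMonoidHom := by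
    apply hom_ext; intro x; simpa using h2 x
  exact DFunLike.congr_fun this x

theorem cj_of_eq {α : MulAut (RAAG G)} {w : V} (h : α (gen G w) = gen G w) : cj α w := ⟨1, by simpa using h⟩

noncomputable def swapIso [DecidableEq V] {x y : V} (hx : x ∈ KK G v) (hy : y ∈ KK G v) : G ≃g G where
  toEquiv := Equiv.swap x y
  map_rel_iff' := by
    intro a b
    have key : ∀ a b, G.Adj a b → G.Adj (Equiv.swap x y a) (Equiv.swap x y b) := by
      have hlk : ∀ a b, G.Adj a b → G.Adj (Equiv.swap x y a) b := by
        intro a b h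
        rw [Equiv.swap_apply_def]
        split_ifs with h1 h2
        · subst h1; exact (hy b).2 ((hx b).1 h)
        · subst h2; exact (hx b).2 ((hy b).1 h)
        · exact h
      intro a b h
      exact (hlk _ _ (hlk _ _ h).symm).symm
    refine ⟨fun h => ?_, key a b⟩
    have := key _ _ h
    simpa using this

theorem psiHyp [Finite V] : PsiHyp (G.induce (UU G v)) (bk G v) (KU G v) (PsiU G v) where
  tvr x hx y hy c ψ h1 h2 := by
    have hxy : x.1 ≠ y.1 := fun e => hy (Subtype.ext e.symm)
    have hl : LkLeSt G x.1 y.1 := fun w hw => Or.inr (y.2 w ((hx w).1 hw))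
    obtain ⟨γ, g1, g2⟩ := exists_tvR hxy hl c
    refine mem_PsiU (AutS_le_NN (tvR_mem hxy hl c g1 g2)) ?_ (fun w hw => cj_of_eq (g2 w (fun e => hw (e ▸ hx))))
    intro z
    by_cases hz : z = x
    · subst hz; rw [g1, h1, map_mul, em_lt, em_gen]
    · rw [g2 _ (fun e => hz (Subtype.ext e)), h2 z hz, em_gen]
  tvl x hx y hy c ψ h1 h2 := by
    have hxy : x.1 ≠ y.1 := fun e => hy (Subtype.ext e.symm)
    have hl : LkLeSt G x.1 y.1 := fun w hw => Or.inr (y.2 w ((hx w).1 hw))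
    obtain ⟨γ, g1, g2⟩ := exists_tvL hxy hl c
    refine mem_PsiU (AutS_le_NN (tvL_mem hxy hl c g1 g2)) ?_ (fun w hw => cj_of_eq (g2 w (fun e => hw (e ▸ hx))))
    intro z
    by_cases hz : z = x
    · subst hz; rw [g1, h1, map_mul, em_lt, em_gen]
    · rw [g2 _ (fun e => hz (Subtype.ext e)), h2 z hz, em_gen]
  pc C hC y hy c ψ h1 h2 := by
    let D : Set V := {w | ∃ hw : w ∈ (lk G v)ᶜ, ∃ u ∈ C, bk G v u = SimpleGraph.connectedComponentMk _ ⟨w, hw⟩}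
    have hDU : ∀ z : UU G v, z.1 ∈ D ↔ z ∈ C := by
      intro z
      constructor
      · rintro ⟨hw, u, hu, e⟩
        exact hC u z e hu
      · intro hz
        exact ⟨UU_lk z.2, z, hz, rfl⟩
    have hcl : Clos G y.1 D := by
      refine ⟨fun h => hy ((hDU y).1 h), ?_⟩
      rintro w ⟨hw, u, hu, e⟩ d hd
      by_cases hdl : G.Adj v d
      · exact Or.inr (Or.inr (y.2 d hdl))
      · refine Or.inl ⟨hdl, u, hu, ?_⟩
        rw [e, SimpleGraph.ConnectedComponent.eq]
        refine SimpleGraph.Adj.reachable ?_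
        exact hd
    refine mem_PsiU (γ := gpc y.1 c D hcl) (AutS_le_NN (gpc_mem hcl c (fun w hw => gpc_in hcl hw) (fun w hw => gpc_out hcl hw))) ?_ ?_
    · intro z
      by_cases hz : z ∈ C
      · rw [gpc_in hcl ((hDU z).2 hz), h1 z hz]; simp [em_lt]
      · rw [gpc_out hcl (fun h => hz ((hDU z).1 h)), h2 z hz]; simp
    · intro w _
      by_cases hw : w ∈ D
      · exact ⟨_, gpc_in hcl hw⟩
      · exact cj_of_eq (gpc_out hcl hw)
  inv x hx := by
    refine mem_PsiU (iv_mem x.1) ?_ (fun w hw => cj_of_eq (iv_ne (fun e => hw (e ▸ hx))))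
    intro z
    by_cases hz : z = x
    · subst hz; simp [iv_self]
    · rw [iv_ne hz, iv_ne (fun e => hz (Subtype.ext e)), em_gen]
  swap x hx y hy := by
    classical
    let π := swapIso (G := G) hx hy
    let π' := swapIso (G := G.induce (UU G v)) (v := x) (x := x) (y := y) (fun w => Iff.rfl)
      (fun w => by
        show G.Adj y.1 w.1 ↔ G.Adj x.1 w.1
        rw [hx w.1, hy w.1])
    have hπ : ∀ z, π z = Equiv.swap x.1 y.1 z := fun _ => rfl
    have hπ' : ∀ z, π' z = Equiv.swap x y z := fun _ => rfl
    refine ⟨ga π', mem_PsiU (ga_mem π) ?_ ?_, ?_, ?_⟩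
    · intro z
      rw [ga_gen, ga_gen, em_gen, hπ, hπ', Equiv.swap_apply_def, Equiv.swap_apply_def]
      simp only [Subtype.ext_iff]
      split_ifs <;> rfl
    · intro w hw
      apply cj_of_eq
      rw [ga_gen, hπ, Equiv.swap_apply_of_ne_of_ne]
      · rintro rfl; exact hw hx
      · rintro rfl; exact hw hy
    · rw [ga_gen, hπ', Equiv.swap_apply_left]
    · intro w hw
      rw [ga_gen, hπ', Equiv.swap_apply_of_ne_of_ne]
      · rintro rfl; rcases hw with h | h
        · exact h hx
        · exact h.1 rfl
      · rintro rfl; rcases hw with h | h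
        · exact h hy
        · exact h.2 rfl

end blocks
end RG

end

section
namespace RG
open scoped Pointwise
universe u
variable {V : Type u} {G : SimpleGraph V}

theorem QU [Fintype V] {φ : MulAut (RAAG G)} {v : V}
    (h1 : ∀ g ∈ par G (lk G v), φ g ∈ par G (lk G v))
    {α : MulAut (RAAG (G.induce (UU G v)))}
    (hα : ∀ g, em G (UU G v) (α⁻¹ g) = φ⁻¹ (em G (UU G v) g)) :
    QK (G.induce (UU G v)) (bk G v) (KU G v) α := by
  classical
  intro i hi
  have main := elliptic (G := G.induce (UU G v)) (K := KU G v) (fun x hx w => tsU.isol hx w) α⁻¹ {x | bk G v x = i} ?_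
  · obtain ⟨a, ha⟩ := main
    refine ⟨α a, fun g hg => ?_⟩
    have := ha g hg
    simpa using this
  intro g u hu b
  have hg := em_mem g
  set E := em G (UU G v) g • H G u.1 b with hE
  have hpre : ∀ (y x : RAAG (G.induce (UU G v))), x ∈ α⁻¹ y • g • H (G.induce (UU G v)) u b ↔
      em G (UU G v) x ∈ φ⁻¹ (em G (UU G v) y) • E := by
    intro y x
    rw [mem_sm, mem_hs, hE, mem_sm, mem_hs, ← hα, ← map_inv (em G (UU G v)), ← map_inv (em G (UU G v)), ← map_mul, ← map_mul, H_em]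
  have hpre1 : ∀ (x : RAAG (G.induce (UU G v))), x ∈ g • H (G.induce (UU G v)) u b ↔
      em G (UU G v) x ∈ E := by
    intro x
    rw [mem_hs, hE, mem_hs, ← map_inv, ← map_mul, H_em]
  -- transfer
  suffices hs : (∀ d : UU G v, bk G v d = i → Disjoint (φ⁻¹ (gen G d.1) • E) E) ∨
      (∀ d : UU G v, bk G v d = i → (φ⁻¹ (gen G d.1) • E) ∪ E = Set.univ) by
    rcases hs with hs | hs
    · left; intro d hd
      rw [Set.disjoint_left]
      intro x hx hx'
      rw [hpre] at hx; rw [hpre1] at hx'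
      rw [em_gen] at hx
      exact Set.disjoint_left.1 (hs d hd) hx hx'
    · right; intro d hd
      rw [Set.eq_univ_iff_forall]
      intro x
      have := Set.eq_univ_iff_forall.1 (hs d hd) (em G (UU G v) x)
      rcases this with h | h
      · left; rw [hpre, em_gen]; exact h
      · right; rw [hpre1]; exact h
  by_cases hne : ∃ d0 : UU G v, bk G v d0 = i
  swap
  · left; intro d hd; exact absurd ⟨d, hd⟩ hne
  obtain ⟨d0, hd0⟩ := hne
  have hd0K : d0.1 ∉ KK G v := hi d0 hd0
  have hinv : ∀ g ∈ par G (lk G v), (φ⁻¹)⁻¹ g ∈ par G (lk G v) := by simpa using h1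
  -- each vertex in the component has a neighbour
  have hnb0 : ∃ e, G.Adj d0.1 e ∧ ¬ G.Adj v e := by
    by_contra hcon
    push Not at hcon
    exact hd0K (fun w => ⟨fun h => hcon w h, fun h => d0.2 w h⟩)
  have hnb : ∀ c : ((lk G v)ᶜ : Set V), (G.induce (lk G v)ᶜ).Reachable c ⟨d0.1, UU_lk d0.2⟩ →
      ∃ e, G.Adj c.1 e ∧ ¬ G.Adj v e := by
    rintro c ⟨p⟩
    cases p with
    | nil => exact hnb0
    | cons ha q => rename_i z; exact ⟨z.1, ha, z.2⟩
  have hty : ∀ c : ((lk G v)ᶜ : Set V), (G.induce (lk G v)ᶜ).Reachable c ⟨d0.1, UU_lk d0.2⟩ →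
      (Disjoint (φ⁻¹ (gen G c.1) • E) E ∨ (φ⁻¹ (gen G c.1) • E) ∪ E = Set.univ) := by
    intro c hc
    obtain ⟨e, he, he'⟩ := hnb c hc
    exact type_or hinv hu hg he c.2 he'
  have hadj : ∀ c d : ((lk G v)ᶜ : Set V), G.Adj c.1 d.1 →
      (G.induce (lk G v)ᶜ).Reachable c ⟨d0.1, UU_lk d0.2⟩ →
      Disjoint (φ⁻¹ (gen G d.1) • E) E → Disjoint (φ⁻¹ (gen G c.1) • E) E := by
    intro c d hcd hc h
    rcases hty c hc with h' | h'
    · exact h'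
    · exact absurd h' (fun h' => type_adj hinv hu hg hcd.symm d.2 c.2 h h')
  have hadj' : ∀ c d : ((lk G v)ᶜ : Set V), G.Adj c.1 d.1 →
      (G.induce (lk G v)ᶜ).Reachable c ⟨d0.1, UU_lk d0.2⟩ →
      (φ⁻¹ (gen G d.1) • E) ∪ E = Set.univ → (φ⁻¹ (gen G c.1) • E) ∪ E = Set.univ := by
    intro c d hcd hc h
    rcases hty c hc with h' | h'
    · exact absurd h (fun h => type_adj hinv hu hg hcd c.2 d.2 h' h)
    · exact h'
  have prop : ∀ p : V → Prop, p d0.1 → (∀ c d : ((lk G v)ᶜ : Set V), G.Adj c.1 d.1 →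
      (G.induce (lk G v)ᶜ).Reachable c ⟨d0.1, UU_lk d0.2⟩ → p d.1 → p c.1) →
      ∀ d : UU G v, bk G v d = i → p d.1 := by
    intro p p0 hp d hd
    have hr : (G.induce (lk G v)ᶜ).Reachable ⟨d.1, UU_lk d.2⟩ ⟨d0.1, UU_lk d0.2⟩ := by
      have : bk G v d = bk G v d0 := hd.trans hd0.symm
      unfold bk at this
      rwa [SimpleGraph.ConnectedComponent.eq] at this
    have walk : ∀ (a b : ((lk G v)ᶜ : Set V)) (q : (G.induce (lk G v)ᶜ).Walk a b), b = ⟨d0.1, UU_lk d0.2⟩ → p a.1 := by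
      intro a b q
      induction q with
      | nil => rintro rfl; exact p0
      | cons ha q ih =>
        intro hb
        refine hp _ _ ha ?_ (ih hb)
        rw [← hb]
        exact ⟨SimpleGraph.Walk.cons ha q⟩
    obtain ⟨q⟩ := hr
    exact walk _ _ q rfl
  rcases hty ⟨d0.1, UU_lk d0.2⟩ (SimpleGraph.Reachable.refl _) with h | h
  · left
    exact prop (fun c => Disjoint (φ⁻¹ (gen G c) • E) E) h hadj
  · right
    exact prop (fun c => (φ⁻¹ (gen G c) • E) ∪ E = Set.univ) h hadj'

theorem cj_conj (x : RAAG G) (w : V) : cj (MulAut.conj x) w := ⟨x, by simp⟩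

theorem IA_step [Fintype V] {φ : MulAut (RAAG G)} (hφ : IA φ) (v : V) :
    ∃ β ∈ NN G, IA (β * φ) ∧ cj (β * φ) v ∧ ∀ w, cj φ w → cj (β * φ) w := by
  classical
  obtain ⟨h, hh⟩ := lk_fix hφ v
  obtain ⟨hP1, hP2⟩ := hh _ rfl
  set φ1 := MulAut.conj h * φ with hφ1
  have hIA : IA φ1 := (IA.conj _).mul hφ
  have hU1 := U_fix hIA hP2
  have hU2 := U_fix (φ := φ1⁻¹) hIA.inv (v := v) (by simpa using hP1)
  obtain ⟨α, ha1, ha2⟩ := exists_restr hU1 hU2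
  have hQ := QU hP1 ha2
  obtain ⟨β, ⟨γ, g1, g2, g3⟩, hβ⟩ := delta tsU psiHyp hQ
  have hK : ∀ x ∈ KK G v, cj (γ * φ1) x := by
    intro x hx
    obtain ⟨k, hk⟩ := hβ ⟨x, KK_sub hx⟩ hx
    refine ⟨em G _ k, ?_⟩
    have := congrArg (em G _) hk
    rw [← g2, ha1] at this
    simpa using this
  have hnK : ∀ w ∉ KK G v, cj φ w → cj (γ * φ1) w := by
    intro w hw hc
    exact (g3 w hw).mul ((cj_conj h w).mul hc)
  refine ⟨γ * MulAut.conj h, mul_mem g1 (AutS_le_NN (conj_mem h)), ?_, ?_, ?_⟩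
  · rw [mul_assoc]
    apply IA.of_gen
    intro t w
    by_cases hw : w ∈ KK G v
    · exact (hK w hw).ex t
    · rw [MulAut.mul_apply, ex_expand]
      simp only [← hφ1]
      simp only [hIA _ (gen G w)]
      simp only [ex_gen]
      simp [(g3 w hw).ex t, ex_gen]
  · rw [mul_assoc]; exact hK v (fun w => Iff.rfl)
  · intro w hc
    rw [mul_assoc]
    by_cases hw : w ∈ KK G v
    · exact hK w hw
    · exact hnK w hw hc

theorem IA_mem [Fintype V] {φ : MulAut (RAAG G)} (hφ : IA φ) : φ ∈ NN G := by
  classical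
  have : ∀ S : Finset V, ∃ β ∈ NN G, IA (β * φ) ∧ ∀ w ∈ S, cj (β * φ) w := by
    intro S
    induction S using Finset.induction_on with
    | empty => exact ⟨1, one_mem _, by simpa using hφ, by simp⟩
    | insert v S _ ih =>
      obtain ⟨β, h1, h2, h3⟩ := ih
      obtain ⟨β', h1', h2', h3', h4'⟩ := IA_step h2 v
      refine ⟨β' * β, mul_mem h1' h1, by rwa [mul_assoc], ?_⟩
      intro w hw
      rw [mul_assoc]
      rcases Finset.mem_insert.1 hw with rfl | hw
      · exact h3'
      · exact h4' w (h3 w hw)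
  obtain ⟨β, h1, h2, h3⟩ := this Finset.univ
  have := AutS_le_NN (conj_aut (φ := β * φ) (fun v => h3 v (Finset.mem_univ v)))
  exact (Subgroup.mul_mem_cancel_left _ h1).1 this

end RG

end

section
namespace RG
open scoped Pointwise
universe u
variable {V : Type u} {G : SimpleGraph V}

/-! ### The Heisenberg relation -/
def hX : Equiv.Perm (ℤ × ℤ) where
  toFun p := (p.1, p.2 + p.1)
  invFun p := (p.1, p.2 - p.1)
  left_inv p := by simp
  right_inv p := by simp

def hY : Equiv.Perm (ℤ × ℤ) where
  toFun p := (p.1 + 1, p.2)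
  invFun p := (p.1 - 1, p.2)
  left_inv p := by simp
  right_inv p := by simp

theorem heis {i j : V} (hij : i ≠ j) (ha : ¬ G.Adj i j) {x y : RAAG G} (hxy : x * y = y * x) :
    ex i x * ex j y = ex j x * ex i y := by
  classical
  let f : RAAG G →* Equiv.Perm (ℤ × ℤ) := lift (fun w => if w = i then hX else if w = j then hY else 1) (by
    intro u v huv
    by_cases h1 : u = i
    · subst h1
      have h2 : v ≠ u := huv.ne'
      have h3 : v ≠ j := fun e => ha (e ▸ huv)
      simp [h2, h3]
    · by_cases h2 : u = j
      · subst h2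
        have h3 : v ≠ u := huv.ne'
        have h4 : v ≠ i := fun e => ha (e ▸ huv).symm
        simp [h3, h4]
      · simp [h1, h2])
  have key : ∀ g : RAAG G, ∃ c : ℤ, ∀ q r : ℤ, f g (q, r) = (q + ex j g, r + ex i g * q + c) := by
    intro g
    induction g using ind_left with
    | one => exact ⟨0, by simp⟩
    | step v b g ih =>
      obtain ⟨c, hc⟩ := ih
      by_cases h1 : v = i
      · subst h1
        cases b
        · refine ⟨c - ex j g, fun q r => ?_⟩
          have e : f (gen G v)⁻¹ = hX⁻¹ := by simp [f]
          rw [map_mul, Equiv.Perm.mul_apply, hc, lt_false, e, ex_mul, ex_mul, ex_inv, ex_inv, ex_gen_ne hij, ex_gen_self]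
          show ((q + ex j g, r + ex v g * q + c - (q + ex j g)) : ℤ × ℤ) = _
          ext <;> simp; ring
        · refine ⟨c + ex j g, fun q r => ?_⟩
          have e : f (gen G v) = hX := by simp [f]
          rw [map_mul, Equiv.Perm.mul_apply, hc, lt_true, e, ex_mul, ex_mul, ex_gen_ne hij, ex_gen_self]
          show ((q + ex j g, r + ex v g * q + c + (q + ex j g)) : ℤ × ℤ) = _
          ext <;> simp; ring
      · by_cases h2 : v = j
        · subst h2
          cases b
          · refine ⟨c, fun q r => ?_⟩
            have e : f (gen G v)⁻¹ = hY⁻¹ := by simp [f, h1]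
            rw [map_mul, Equiv.Perm.mul_apply, hc, lt_false, e, ex_mul, ex_mul, ex_inv, ex_inv, ex_gen_ne hij.symm, ex_gen_self]
            show ((q + ex v g - 1, r + ex i g * q + c) : ℤ × ℤ) = _
            ext <;> simp; ring
          · refine ⟨c, fun q r => ?_⟩
            have e : f (gen G v) = hY := by simp [f, h1]
            rw [map_mul, Equiv.Perm.mul_apply, hc, lt_true, e, ex_mul, ex_mul, ex_gen_ne hij.symm, ex_gen_self]
            show ((q + ex v g + 1, r + ex i g * q + c) : ℤ × ℤ) = _
            ext <;> simp; ring
        · refine ⟨c, fun q r => ?_⟩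
          have e : f (lt G v b) = 1 := by cases b <;> simp [f, h1, h2]
          rw [map_mul, Equiv.Perm.mul_apply, hc, e]
          cases b <;> simp [ex_gen_ne h1, ex_gen_ne h2]
  obtain ⟨c, hc⟩ := key x
  obtain ⟨d, hd⟩ := key y
  have h1 : f (x * y) (0, 0) = f (y * x) (0, 0) := by rw [hxy]
  rw [map_mul, map_mul, Equiv.Perm.mul_apply, Equiv.Perm.mul_apply, hc, hd, hc, hd] at h1
  have := congrArg Prod.snd h1
  simp at this
  linarith

/-! ### Preorder -/
theorem le_rfl' (a : V) : LkLeSt G a a := fun x hx => Or.inr hx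

theorem le_trans' {a b c : V} (h1 : LkLeSt G a b) (h2 : LkLeSt G b c) : LkLeSt G a c := by
  intro x hx
  have hx' : G.Adj a x := hx
  rcases h1 hx with h | h
  · have h3 : x = b := h
    subst h3
    rcases h2 (show a ∈ G.neighborSet x from hx'.symm) with h | h
    · have : a = c := h
      subst this; exact Or.inr hx'
    · have h4 : G.Adj c a := h
      rcases h1 (show c ∈ G.neighborSet a from h4.symm) with h | h
      · exact Or.inl (show x = c from (show c = x from h).symm)
      · exact Or.inr (show G.Adj c x from (show G.Adj x c from h).symm)
  · exact h2 h

/-! ### Linear algebra -/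
theorem sub_lin [Fintype V] (A : Matrix V V ℚ) (P Q : Finset V)
    (h : ∀ a : V → ℚ, (∀ w ∉ P, a w = 0) → (∀ j ∈ Q, ∑ w, A j w * a w = 0) → a = 0) :
    P.card ≤ Q.card ∧ (P.card = Q.card → ∀ f : V → ℚ, ∃ a : V → ℚ, (∀ w ∉ P, a w = 0) ∧
      ∀ j ∈ Q, ∑ w, A j w * a w = f j) := by
  classical
  let T : (P → ℚ) →ₗ[ℚ] (Q → ℚ) := (A.submatrix (fun j : Q => j.1) (fun w : P => w.1)).mulVecLin
  let e : (P → ℚ) → V → ℚ := fun a w => if hw : w ∈ P then a ⟨w, hw⟩ else 0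
  have he : ∀ (a : P → ℚ) (j : Q), ∑ w, A j.1 w * e a w = T a j := by
    intro a j
    have : ∑ w, A j.1 w * e a w = ∑ w ∈ P, A j.1 w * e a w := by
      symm
      apply Finset.sum_subset (Finset.subset_univ _)
      intro w _ hw
      simp [e, hw]
    rw [this, ← Finset.sum_coe_sort]
    show _ = ∑ w : P, A j.1 w.1 * a w
    apply Finset.sum_congr rfl
    intro w _
    simp [e]
  have h0 : ∀ (a : P → ℚ), ∀ w ∉ P, e a w = 0 := by
    intro a w hw; simp [e, hw]
  have hT : Function.Injective T := by
    rw [← LinearMap.ker_eq_bot, LinearMap.ker_eq_bot']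
    intro a ha
    have := h (e a) (h0 a) (fun j hj => by rw [he a ⟨j, hj⟩, ha]; rfl)
    ext w
    have h2 := congrFun this w.1
    simpa [e] using h2
  constructor
  · have := LinearMap.finrank_le_finrank_of_injective hT
    simpa using this
  · intro hc f
    have hs : Function.Surjective T := (LinearMap.injective_iff_surjective_of_finrank_eq_finrank (by simpa using hc)).1 hT
    obtain ⟨a, ha⟩ := hs (fun j => f j.1)
    refine ⟨e a, h0 a, fun j hj => ?_⟩
    rw [he a ⟨j, hj⟩, ha]

noncomputable def mm (φ : MulAut (RAAG G)) (t v : V) : ℤ := ex t (φ (gen G v))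

theorem mm_mul [Fintype V] (φ ψ : MulAut (RAAG G)) (t v : V) :
    mm (φ * ψ) t v = ∑ s, mm φ t s * mm ψ s v := by
  unfold mm
  rw [MulAut.mul_apply, ex_expand]
  exact Finset.sum_congr rfl (fun s _ => mul_comm _ _)

theorem mm_one [DecidableEq V] (t v : V) : mm (1 : MulAut (RAAG G)) t v = if t = v then 1 else 0 := by
  unfold mm; rw [MulAut.one_apply, ex_gen]

theorem mm_inj [Fintype V] (φ : MulAut (RAAG G)) (a : V → ℚ) (h : ∀ t, ∑ w, (mm φ t w : ℚ) * a w = 0) : a = 0 := by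
  classical
  let A : Matrix V V ℚ := fun t v => (mm φ t v : ℚ)
  let B : Matrix V V ℚ := fun t v => (mm φ⁻¹ t v : ℚ)
  have hBA : B * A = 1 := by
    ext t v
    have := mm_mul φ⁻¹ φ t v
    rw [inv_mul_cancel, mm_one] at this
    rw [Matrix.mul_apply, Matrix.one_apply]
    simp only [A, B]
    exact_mod_cast this.symm
  have h1 : A.mulVec a = 0 := by
    ext t; exact h t
  have : (B * A).mulVec a = 0 := by rw [← Matrix.mulVec_mulVec, h1, Matrix.mulVec_zero]
  rwa [hBA, Matrix.one_mulVec] at this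

theorem exists_perm [Fintype V] (φ : MulAut (RAAG G)) : ∃ π : Equiv.Perm V, ∀ v, mm φ (π v) v ≠ 0 := by
  classical
  let A : Matrix V V ℤ := fun t v => mm φ t v
  let B : Matrix V V ℤ := fun t v => mm φ⁻¹ t v
  have hBA : B * A = 1 := by
    ext t v
    have := mm_mul φ⁻¹ φ t v
    rw [inv_mul_cancel, mm_one] at this
    rw [Matrix.mul_apply, Matrix.one_apply]
    exact this.symm
  have hd : A.det ≠ 0 := by
    intro h
    have := congrArg Matrix.det hBA
    rw [Matrix.det_mul, h] at this
    simp at this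
  rw [Matrix.det_apply] at hd
  obtain ⟨π, -, hπ⟩ := Finset.exists_ne_zero_of_sum_ne_zero hd
  refine ⟨π, fun v hv => hπ ?_⟩
  have : ∏ i, A (π i) i = 0 := Finset.prod_eq_zero (Finset.mem_univ v) hv
  rw [this, smul_zero]

theorem mm_heis {φ : MulAut (RAAG G)} {v w : V} (hvw : G.Adj v w) {i j : V} (hij : i ≠ j) (ha : ¬ G.Adj i j) :
    mm φ i v * mm φ j w = mm φ j v * mm φ i w :=
  heis hij ha (by rw [← map_mul, ← map_mul, gen_comm hvw])

open Classical in
noncomputable def stF [Fintype V] (G : SimpleGraph V) (v : V) : Finset V := Finset.univ.filter (fun w => w ∈ star G v)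

theorem mem_stF [Fintype V] {v w : V} : w ∈ stF G v ↔ w = v ∨ G.Adj v w := by
  simp [stF, mem_star]

theorem Zrel [Fintype V] {φ : MulAut (RAAG G)} {v : V} {a : V → ℚ} (ha : ∀ w ∉ stF G v, a w = 0)
    {i j : V} (hij : i ≠ j) (hn : ¬ G.Adj i j) :
    (mm φ i v : ℚ) * ∑ w, (mm φ j w : ℚ) * a w = (mm φ j v : ℚ) * ∑ w, (mm φ i w : ℚ) * a w := by
  rw [Finset.mul_sum, Finset.mul_sum]
  apply Finset.sum_congr rfl
  intro w _
  by_cases hw : w ∈ stF G v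
  · have : mm φ i v * mm φ j w = mm φ j v * mm φ i w := by
      rcases mem_stF.1 hw with rfl | h
      · ring
      · exact mm_heis h hij hn
    have h2 : (mm φ i v : ℚ) * mm φ j w = mm φ j v * mm φ i w := by exact_mod_cast this
    rw [← mul_assoc, h2, mul_assoc]
  · rw [ha w hw]; simp

theorem st_inj [Fintype V] {φ : MulAut (RAAG G)} {s v : V} (hsv : mm φ s v ≠ 0) (a : V → ℚ)
    (ha : ∀ w ∉ stF G v, a w = 0) (h : ∀ j ∈ stF G s, ∑ w, (mm φ j w : ℚ) * a w = 0) : a = 0 := by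
  apply mm_inj φ
  intro t
  by_cases ht : t ∈ stF G s
  · exact h t ht
  · rw [mem_stF] at ht; push Not at ht
    have := Zrel (φ := φ) ha (i := s) (j := t) (Ne.symm ht.1) ht.2
    rw [h s (mem_stF.2 (Or.inl rfl)), mul_zero] at this
    rcases mul_eq_zero.1 this with h | h
    · exact absurd (by exact_mod_cast h) hsv
    · exact h

theorem card_eq [Fintype V] {φ : MulAut (RAAG G)} {π : Equiv.Perm V} (hπ : ∀ v, mm φ (π v) v ≠ 0) (v : V) :
    (stF G v).card = (stF G (π v)).card := by
  have hle : ∀ v ∈ (Finset.univ : Finset V), (stF G v).card ≤ (stF G (π v)).card := fun v _ =>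
    (sub_lin (fun t v => (mm φ t v : ℚ)) _ _ (st_inj (hπ v))).1
  have hsum : ∑ v, (stF G v).card = ∑ v, (stF G (π v)).card :=
    (Equiv.sum_comp π (fun v => (stF G v).card)).symm
  exact (Finset.sum_eq_sum_iff_of_le hle).1 hsum v (Finset.mem_univ v)

theorem supp_le [Fintype V] {φ : MulAut (RAAG G)} {π : Equiv.Perm V} (hπ : ∀ v, mm φ (π v) v ≠ 0) {v t : V}
    (ht : mm φ t v ≠ 0) : LkLeSt G (π v) t := by
  classical
  intro j hj
  by_contra hjt
  have hj' : G.Adj (π v) j := hj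
  rw [mem_star] at hjt; push Not at hjt
  obtain ⟨a, ha, haf⟩ := (sub_lin (fun t v => (mm φ t v : ℚ)) _ _ (st_inj (hπ v))).2 (card_eq hπ v)
    (fun k => if k = j then 1 else 0)
  have hs : ∑ w, (mm φ (π v) w : ℚ) * a w = 0 := by
    have := haf (π v) (mem_stF.2 (Or.inl rfl))
    rw [this, if_neg hj'.ne]
  have hj1 : ∑ w, (mm φ j w : ℚ) * a w = 1 := by
    have := haf j (mem_stF.2 (Or.inr hj'))
    rw [this, if_pos rfl]
  have ht0 : ∑ w, (mm φ t w : ℚ) * a w = 0 := by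
    by_cases hts : t ∈ stF G (π v)
    · have := haf t hts
      rw [this, if_neg (Ne.symm hjt.1)]
    · rw [mem_stF] at hts; push Not at hts
      have := Zrel (φ := φ) ha (i := π v) (j := t) (Ne.symm hts.1) hts.2
      rw [hs, mul_zero] at this
      rcases mul_eq_zero.1 this with h | h
      · exact absurd (by exact_mod_cast h) (hπ v)
      · exact h
  have := Zrel (φ := φ) ha (i := t) (j := j) (Ne.symm hjt.1) hjt.2
  rw [hj1, ht0, mul_zero, mul_one] at this
  exact ht (by exact_mod_cast this)

end RG

end

section
namespace RG
open scoped Pointwise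
universe u
variable {V : Type u} {G : SimpleGraph V}

theorem perm_adj [Fintype V] {φ : MulAut (RAAG G)} {π : Equiv.Perm V} (hπ : ∀ v, mm φ (π v) v ≠ 0) {v w : V}
    (hvw : G.Adj v w) : G.Adj (π v) (π w) := by
  classical
  by_contra hn
  have hst : π v ≠ π w := fun e => hvw.ne (π.injective e)
  have hH := mm_heis (φ := φ) hvw hst hn
  have hne : mm φ (π v) v * mm φ (π w) w ≠ 0 := mul_ne_zero (hπ v) (hπ w)
  rw [hH] at hne
  have htv : mm φ (π w) v ≠ 0 := left_ne_zero_of_mul hne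
  have hsw : mm φ (π v) w ≠ 0 := right_ne_zero_of_mul hne
  have le1 : LkLeSt G (π v) (π w) := supp_le hπ htv
  have le2 : LkLeSt G (π w) (π v) := supp_le hπ hsw
  let Q : Finset V := Finset.univ.filter (fun i => LkLeSt G (π v) i ∧ ¬ LkLeSt G i (π v))
  let P : Finset V := Finset.univ.filter (fun u => π u ∈ Q)
  have hQ : ∀ i, i ∈ Q ↔ LkLeSt G (π v) i ∧ ¬ LkLeSt G i (π v) := fun i => by simp [Q]
  have hP : ∀ u, u ∈ P ↔ π u ∈ Q := fun u => by simp [P]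
  have hcard : P.card = Q.card := by
    apply Finset.card_bij (fun u _ => π u)
    · intro u hu; exact (hP u).1 hu
    · intro a _ b _ h; exact π.injective h
    · intro b hb; exact ⟨π.symm b, (hP _).2 (by simpa using hb), by simp⟩
  have hup : ∀ (a : V → ℚ), (∀ u ∉ P, a u = 0) → ∀ t ∉ Q, ∑ u, (mm φ t u : ℚ) * a u = 0 := by
    intro a ha t ht
    apply Finset.sum_eq_zero
    intro u _
    by_cases hu : u ∈ P
    · have : mm φ t u = 0 := by
        by_contra h0
        have h1 := supp_le hπ h0
        have h2 := (hQ _).1 ((hP u).1 hu)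
        exact ht ((hQ t).2 ⟨le_trans' h2.1 h1, fun h3 => h2.2 (le_trans' h1 h3)⟩)
      rw [this]; simp
    · rw [ha u hu]; simp
  have hinj : ∀ a : V → ℚ, (∀ u ∉ P, a u = 0) → (∀ j ∈ Q, ∑ u, (mm φ j u : ℚ) * a u = 0) → a = 0 := by
    intro a ha h
    apply mm_inj φ
    intro t
    by_cases ht : t ∈ Q
    · exact h t ht
    · exact hup a ha t ht
  let z : V → ℚ := fun u => if u = v then (mm φ (π v) w : ℚ) else if u = w then -(mm φ (π v) v : ℚ) else 0
  have hz : ∀ t, ∑ u, (mm φ t u : ℚ) * z u = mm φ t v * mm φ (π v) w - mm φ t w * mm φ (π v) v := by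
    intro t
    have : ∀ u, (mm φ t u : ℚ) * z u = (if u = v then (mm φ t v : ℚ) * mm φ (π v) w else 0) +
        (if u = w then -((mm φ t w : ℚ) * mm φ (π v) v) else 0) := by
      intro u
      by_cases h1 : u = v
      · subst h1; simp [z, hvw.ne]
      · by_cases h2 : u = w
        · subst h2; simp [z, h1]
        · simp [z, h1, h2]
    rw [Finset.sum_congr rfl (fun u _ => this u), Finset.sum_add_distrib]
    simp; ring
  have hzQ : ∀ t ∉ Q, ∑ u, (mm φ t u : ℚ) * z u = 0 := by
    intro t ht
    rw [hz]
    by_cases hts : t = π v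
    · subst hts; ring
    by_cases hadj : G.Adj (π v) t
    · have h1 : mm φ t v = 0 ∧ mm φ t w = 0 := by
        have hlt : LkLeSt G (π v) t → False := by
          intro hle
          have hti : LkLeSt G t (π v) := by
            by_contra h
            exact ht ((hQ t).2 ⟨hle, h⟩)
          have h2 : G.Adj (π w) t := by
            rcases le1 (show t ∈ G.neighborSet (π v) from hadj) with h | h
            · have h' : t = π w := h
              exact absurd (h' ▸ hadj) hn
            · exact h
          rcases hti (show π w ∈ G.neighborSet t from h2.symm) with h | h
          · exact hst (show π w = π v from h).symm
          · exact hn h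
        constructor
        · by_contra h0; exact hlt (supp_le hπ h0)
        · by_contra h0; exact hlt (le_trans' le1 (supp_le hπ h0))
      rw [h1.1, h1.2]; simp
    · have := mm_heis (φ := φ) hvw (Ne.symm hts) hadj
      have h2 : (mm φ (π v) v : ℚ) * mm φ t w = mm φ t v * mm φ (π v) w := by exact_mod_cast this
      rw [← h2]; ring
  obtain ⟨a, ha, haf⟩ := (sub_lin (fun t v => (mm φ t v : ℚ)) P Q hinj).2 hcard
    (fun t => ∑ u, (mm φ t u : ℚ) * z u)
  have hdiff : (fun u => a u - z u) = 0 := by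
    apply mm_inj φ
    intro t
    simp only [mul_sub, Finset.sum_sub_distrib]
    by_cases ht : t ∈ Q
    · rw [sub_eq_zero]; exact haf t ht
    · rw [hup a ha t ht, hzQ t ht, sub_zero]
  have hav : a v = z v := by
    have := congrFun hdiff v
    exact sub_eq_zero.1 this
  have hvP : v ∉ P := by
    rw [hP, hQ]; exact fun h => h.2 (le_rfl' _)
  rw [ha v hvP] at hav
  have : z v = (mm φ (π v) w : ℚ) := by simp [z]
  rw [this] at hav
  exact hsw (by exact_mod_cast hav.symm)

noncomputable def permIso [Fintype V] {φ : MulAut (RAAG G)} {π : Equiv.Perm V} (hπ : ∀ v, mm φ (π v) v ≠ 0) :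
    G ≃g G where
  toEquiv := π
  map_rel_iff' := by
    intro a b
    refine ⟨fun h => ?_, fun h => perm_adj hπ h⟩
    have hpow : ∀ (n : ℕ) (a b : V), G.Adj a b → G.Adj ((π ^ n) a) ((π ^ n) b) := by
      intro n
      induction n with
      | zero => intro a b h; simpa using h
      | succ n ih =>
        intro a b h
        rw [pow_succ', Equiv.Perm.mul_apply, Equiv.Perm.mul_apply]
        exact perm_adj hπ (ih a b h)
    have h2 := hpow (orderOf π - 1) _ _ h
    rw [← Equiv.Perm.mul_apply, ← Equiv.Perm.mul_apply, ← pow_succ, Nat.sub_add_cancel (orderOf_pos π), pow_orderOf_eq_one] at h2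
    simpa using h2

/-! ### Elimination -/
theorem el [Finite V] {a b : V} (hab : a ≠ b) (hl : LkLeSt G a b) (c : ℤ) [DecidableEq V] :
    ∃ ψ ∈ NN G, ∀ y t, ex t (ψ y) = ex t y + (if t = b then c * ex a y else 0) := by
  have hf : Finite V := inferInstance
  obtain ⟨τ, h1, h2⟩ := exists_tvR (G := G) hab hl true
  have hτ : ∀ y t, ex t (τ y) = ex t y + (if t = b then ex a y else 0) := by
    intro y t
    have hgen : ∀ v, ex t (τ (gen G v)) = ex t (gen G v) + (if t = b then ex a (gen G v) else 0) := by
      intro v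
      by_cases hv : v = a
      · subst hv
        rw [h1, ex_mul, lt_true, ex_gen_self]
        congr 1
        exact ex_gen _ _
      · rw [h2 v hv, ex_gen_ne hv]; simp
    induction y using ind_left with
    | one => simp
    | step v e g ih =>
      rw [map_mul, ex_mul, ih, ex_mul, ex_mul]
      have := hgen v
      cases e
      · simp only [lt_false, map_inv, ex_inv, this]
        split_ifs <;> ring
      · simp only [lt_true, this]
        split_ifs <;> ring
  have hm : τ ∈ NN G := AutS_le_NN (tvR_mem hab hl true h1 h2)
  have hτa : ∀ (y : RAAG G), ex a (τ y) = ex a y := by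
    intro y; rw [hτ, if_neg hab]; simp
  induction c using Int.induction_on with
  | zero => exact ⟨1, one_mem _, by simp⟩
  | succ i ih =>
    obtain ⟨ψ, hψ, h⟩ := ih
    refine ⟨ψ * τ, mul_mem hψ hm, fun y t => ?_⟩
    rw [MulAut.mul_apply, h, hτ, hτa]
    split_ifs <;> ring
  | pred i ih =>
    obtain ⟨ψ, hψ, h⟩ := ih
    refine ⟨ψ * τ⁻¹, mul_mem hψ (inv_mem hm), fun y t => ?_⟩
    have e : ∀ y t, ex t (τ⁻¹ y) = ex t y - (if t = b then ex a (τ⁻¹ y) else 0) := by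
      intro y t
      have := hτ (τ⁻¹ y) t
      rw [MulAut.apply_inv_self] at this
      rw [this]; ring
    have e2 : ∀ y, ex a (τ⁻¹ y) = ex a y := by
      intro y; rw [e, if_neg hab]; ring
    rw [MulAut.mul_apply, h, e, e2]
    split_ifs <;> ring

theorem el_row [Fintype V] [DecidableEq V] {a b : V} (hab : a ≠ b) (hl : LkLeSt G a b) (c : ℤ) :
    ∃ ψ ∈ NN G, ∀ φ : MulAut (RAAG G), ∀ t v, mm (ψ * φ) t v = mm φ t v + (if t = b then c * mm φ a v else 0) := by
  obtain ⟨ψ, h1, h2⟩ := el hab hl c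
  exact ⟨ψ, h1, fun φ t v => h2 _ t⟩

theorem el_col [Fintype V] [DecidableEq V] {a b : V} (hab : a ≠ b) (hl : LkLeSt G a b) (c : ℤ) :
    ∃ ψ ∈ NN G, ∀ φ : MulAut (RAAG G), ∀ t v, mm (φ * ψ) t v = mm φ t v + (if v = a then c * mm φ t b else 0) := by
  obtain ⟨ψ, h1, h2⟩ := el hab hl c
  refine ⟨ψ, h1, fun φ t v => ?_⟩
  rw [mm_mul]
  have : ∀ s, mm φ t s * mm ψ s v = (if s = v then mm φ t s else 0) + (if s = b then (if v = a then c * mm φ t s else 0) else 0) := by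
    intro s
    unfold mm
    rw [h2, ex_gen, ex_gen]
    simp only [eq_comm (a := a) (b := v)]
    split_ifs <;> ring
  rw [Finset.sum_congr rfl (fun s _ => this s), Finset.sum_add_distrib]
  simp

structure Tri [DecidableEq V] (φ : MulAut (RAAG G)) (D : Finset V) : Prop where
  le : ∀ t v, mm φ t v ≠ 0 → LkLeSt G v t
  one : ∀ d ∈ D, ∀ t, mm φ t d = if t = d then 1 else 0

theorem nn_left {φ ψ : MulAut (RAAG G)} (h : ψ ∈ NN G) (h' : ψ * φ ∈ NN G) : φ ∈ NN G :=
  (Subgroup.mul_mem_cancel_left _ h).1 h'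
theorem nn_right {φ ψ : MulAut (RAAG G)} (h : ψ ∈ NN G) (h' : φ * ψ ∈ NN G) : φ ∈ NN G :=
  (Subgroup.mul_mem_cancel_right _ h).1 h'

theorem Tri.row [Fintype V] [DecidableEq V] {φ ψ : MulAut (RAAG G)} {D : Finset V} (h : Tri φ D) {a b : V} {c : ℤ}
    (hl : LkLeSt G a b) (ha : a ∉ D)
    (hψ : ∀ t v, mm ψ t v = mm φ t v + (if t = b then c * mm φ a v else 0)) : Tri ψ D := by
  constructor
  · intro t v ht
    rw [hψ] at ht
    by_cases h1 : mm φ t v = 0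
    · split_ifs at ht with e
      · subst e
        rw [h1, zero_add] at ht
        exact le_trans' (h.le _ _ (right_ne_zero_of_mul ht)) hl
      · rw [h1] at ht; simp at ht
    · exact h.le _ _ h1
  · intro d hd t
    have : a ≠ d := fun e => ha (e ▸ hd)
    rw [hψ, h.one d hd, h.one d hd, if_neg this]; simp

theorem Tri.col [Fintype V] [DecidableEq V] {φ ψ : MulAut (RAAG G)} {D : Finset V} (h : Tri φ D) {a b : V} {c : ℤ}
    (hl : LkLeSt G a b) (ha : a ∉ D)
    (hψ : ∀ t v, mm ψ t v = mm φ t v + (if v = a then c * mm φ t b else 0)) : Tri ψ D := by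
  constructor
  · intro t v ht
    rw [hψ] at ht
    by_cases h1 : mm φ t v = 0
    · split_ifs at ht with e
      · subst e
        rw [h1, zero_add] at ht
        exact le_trans' hl (h.le _ _ (right_ne_zero_of_mul ht))
      · rw [h1] at ht; simp at ht
    · exact h.le _ _ h1
  · intro d hd t
    have : d ≠ a := fun e => ha (e ▸ hd)
    rw [hψ, h.one d hd, if_neg this]; simp

/-- clearing a column -/
theorem clear_col [Fintype V] [DecidableEq V] {D : Finset V} {s : V} (hs : s ∉ D)
    (H : ∀ φ : MulAut (RAAG G), Tri φ (insert s D) → φ ∈ NN G) (n : ℕ) :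
    ∀ φ : MulAut (RAAG G), Tri φ D → (∀ k, mm φ s k = if k = s then 1 else 0) →
      (Finset.univ.filter (fun t => t ≠ s ∧ mm φ t s ≠ 0)).card = n → φ ∈ NN G := by
  induction n with
  | zero =>
    intro φ hφ hr hn
    apply H
    refine ⟨hφ.le, ?_⟩
    intro d hd t
    rcases Finset.mem_insert.1 hd with rfl | hd
    · by_cases e : t = d
      · subst e; rw [hr]
      · rw [if_neg e]
        by_contra h0
        rw [Finset.card_eq_zero] at hn
        have : t ∈ (Finset.univ.filter (fun t => t ≠ d ∧ mm φ t d ≠ 0)) := by simp [e, h0]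
        rw [hn] at this; simp at this
    · exact hφ.one d hd t
  | succ n ih =>
    intro φ hφ hr hn
    have hne : (Finset.univ.filter (fun t => t ≠ s ∧ mm φ t s ≠ 0)).Nonempty := by
      rw [← Finset.card_pos]; omega
    obtain ⟨b, hb⟩ := hne
    have hb' : b ≠ s ∧ mm φ b s ≠ 0 := by simpa using hb
    have hl := hφ.le _ _ hb'.2
    obtain ⟨ψ, h1, h2⟩ := el_row (Ne.symm hb'.1) hl (-(mm φ b s))
    refine nn_left h1 (ih (ψ * φ) (hφ.row hl hs (h2 φ)) ?_ ?_)
    · intro k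
      rw [h2, if_neg (Ne.symm hb'.1), hr]; simp
    · have : (Finset.univ.filter (fun t => t ≠ s ∧ mm (ψ * φ) t s ≠ 0))
          = (Finset.univ.filter (fun t => t ≠ s ∧ mm φ t s ≠ 0)).erase b := by
        ext t
        simp only [Finset.mem_filter, Finset.mem_univ, true_and, Finset.mem_erase]
        rw [h2]
        by_cases e : t = b
        · subst e; rw [hr]; simp
        · simp [e]
      rw [this, Finset.card_erase_of_mem hb, hn]; rfl

theorem abs_red {p q : ℤ} (hq : q ≠ 0) (h : q.natAbs ≤ p.natAbs) : ∃ c : ℤ, (p + c * q).natAbs < p.natAbs := by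
  rcases le_or_gt 0 p with hp | hp <;> rcases le_or_gt 0 q with hq' | hq'
  · exact ⟨-1, by omega⟩
  · exact ⟨1, by omega⟩
  · exact ⟨1, by omega⟩
  · exact ⟨-1, by omega⟩

/-- reducing a row -/
theorem red_row [Fintype V] [DecidableEq V] {D : Finset V} {s : V} (hs : s ∉ D)
    (hmin : ∀ k ∉ D, LkLeSt G k s → LkLeSt G s k)
    (H : ∀ φ : MulAut (RAAG G), Tri φ D → (∀ k, mm φ s k = if k = s then 1 else 0) → φ ∈ NN G) (n : ℕ) :
    ∀ φ : MulAut (RAAG G), Tri φ D → ∑ k, (mm φ s k).natAbs = n → φ ∈ NN G := by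
  induction n using Nat.strong_induction_on with
  | _ n ih =>
  intro φ hφ hn
  have hsup : ∀ k, mm φ s k ≠ 0 → k ∉ D ∧ LkLeSt G k s ∧ LkLeSt G s k := by
    intro k hk
    have h1 : k ∉ D := by
      intro hd
      have := hφ.one k hd s
      have hsk : s ≠ k := fun e => hs (by rw [e]; exact hd)
      rw [if_neg hsk] at this
      exact hk this
    exact ⟨h1, hφ.le _ _ hk, hmin k h1 (hφ.le _ _ hk)⟩
  by_cases h2 : ∃ a b, a ≠ b ∧ mm φ s a ≠ 0 ∧ mm φ s b ≠ 0 ∧ (mm φ s b).natAbs ≤ (mm φ s a).natAbs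
  · obtain ⟨a, b, hab, ha, hb, hle⟩ := h2
    obtain ⟨c, hc⟩ := abs_red hb hle
    have hl : LkLeSt G a b := le_trans' (hsup a ha).2.1 (hsup b hb).2.2
    obtain ⟨ψ, g1, g2⟩ := el_col hab hl c
    refine nn_right g1 (ih _ ?_ (φ * ψ) (hφ.col hl (hsup a ha).1 (g2 φ)) rfl)
    rw [← hn]
    apply Finset.sum_lt_sum
    · intro k _
      rw [g2]
      split_ifs with e
      · subst e; exact hc.le
      · simp
    · refine ⟨a, Finset.mem_univ _, ?_⟩
      rw [g2, if_pos rfl]; exact hc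
  · push Not at h2
    -- exactly one nonzero entry
    have hone : ∑ k, mm φ s k * mm φ⁻¹ k s = 1 := by
      rw [← mm_mul, mul_inv_cancel, mm_one, if_pos rfl]
    have hex : ∃ a, mm φ s a ≠ 0 := by
      by_contra hcon
      push Not at hcon
      simp [hcon] at hone
    obtain ⟨a, ha⟩ := hex
    have huniq : ∀ k, k ≠ a → mm φ s k = 0 := by
      intro k hk
      by_contra h0
      have := h2 k a hk h0 ha
      have := h2 a k (Ne.symm hk) ha h0
      omega
    have hunit : mm φ s a = 1 ∨ mm φ s a = -1 := by
      rw [Finset.sum_eq_single a (fun k _ hk => by rw [huniq k hk, zero_mul]) (by simp)] at hone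
      exact Int.isUnit_iff.1 (IsUnit.of_mul_eq_one _ hone)
    -- put the entry in place
    have fin : ∀ φ' : MulAut (RAAG G), Tri φ' D → (∀ k, k ≠ s → mm φ' s k = 0) → (mm φ' s s = 1 ∨ mm φ' s s = -1) → φ' ∈ NN G := by
      intro φ' hT h0 h1
      rcases h1 with h1 | h1
      · apply H φ' hT
        intro k
        split_ifs with e
        · rw [e, h1]
        · exact h0 k e
      · have hiv : ∀ t k, mm (φ' * iv G s) t k = if k = s then - mm φ' t k else mm φ' t k := by
          intro t k
          unfold mm
          rw [MulAut.mul_apply]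
          split_ifs with e
          · subst e; rw [iv_self, map_inv, ex_inv]
          · rw [iv_ne e]
        refine nn_right (iv_mem s) (H (φ' * iv G s) ?_ ?_)
        · constructor
          · intro t k hk
            rw [hiv] at hk
            apply hT.le
            split_ifs at hk with e
            · simpa using hk
            · exact hk
          · intro d hd t
            have hds : d ≠ s := fun e => hs (by rw [← e]; exact hd)
            rw [hiv, if_neg hds, hT.one d hd]
        · intro k
          rw [hiv]
          split_ifs with e
          · rw [e, h1]; rfl
          · exact h0 k e
    by_cases has : a = s
    · subst has
      exact fin φ hφ huniq hunit
    · have hsa : LkLeSt G s a := (hsup a ha).2.2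
      have las : LkLeSt G a s := (hsup a ha).2.1
      obtain ⟨ψ, g1, g2⟩ := el_col (Ne.symm has) hsa (mm φ s a)
      obtain ⟨ψ', g1', g2'⟩ := el_col has las (-(mm φ s a))
      have hsq : mm φ s a * mm φ s a = 1 := by rcases hunit with h | h <;> rw [h] <;> rfl
      have e1 : mm (φ * ψ) s s = 1 := by
        rw [g2, if_pos rfl, huniq s (Ne.symm has), hsq]; rfl
      have e2 : mm (φ * ψ) s a = mm φ s a := by rw [g2, if_neg has, add_zero]
      refine nn_right g1 (nn_right g1' (fin (φ * ψ * ψ') ?_ ?_ (Or.inl ?_)))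
      · exact (hφ.col hsa hs (g2 φ)).col las (hsup a ha).1 (g2' _)
      · intro k hk
        rw [g2']
        split_ifs with e
        · subst e; rw [e1, e2]; ring
        · rw [g2, if_neg hk, huniq k e]; rfl
      · rw [g2', if_neg (Ne.symm has), e1]; rfl

theorem tri_mem [Fintype V] [DecidableEq V] (n : ℕ) : ∀ (D : Finset V), Dᶜ.card = n →
    ∀ φ : MulAut (RAAG G), Tri φ D → φ ∈ NN G := by
  induction n with
  | zero =>
    intro D hD φ hφ
    apply IA_mem
    apply IA.of_gen
    intro t v
    have : v ∈ D := by
      rw [Finset.card_eq_zero] at hD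
      by_contra h
      have := Finset.mem_compl.2 h
      rw [hD] at this; simp at this
    rw [ex_gen]
    exact hφ.one v this t
  | succ n ih =>
    intro D hD φ hφ
    have hne : Dᶜ.Nonempty := by rw [← Finset.card_pos]; omega
    classical
    obtain ⟨s, hsD, hmin⟩ := Finset.exists_min_image Dᶜ
      (fun s => (Finset.univ.filter (fun k => LkLeSt G k s)).card) hne
    have hs : s ∉ D := Finset.mem_compl.1 hsD
    refine red_row hs ?_ ?_ _ φ hφ rfl
    · intro k hk hks
      by_contra h
      have := hmin k (Finset.mem_compl.2 hk)
      have h2 : (Finset.univ.filter (fun j => LkLeSt G j k)) ⊂ (Finset.univ.filter (fun j => LkLeSt G j s)) := by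
        rw [Finset.ssubset_iff_of_subset]
        · exact ⟨s, by simp [le_rfl'], by simp [h]⟩
        · intro j hj
          simp only [Finset.mem_filter, Finset.mem_univ, true_and] at hj ⊢
          exact le_trans' hj hks
      have := Finset.card_lt_card h2
      omega
    · intro φ hφ hr
      refine clear_col hs ?_ _ φ hφ hr rfl
      apply ih
      rw [Finset.compl_insert, Finset.card_erase_of_mem hsD, hD]; rfl

theorem all_mem [Fintype V] (φ : MulAut (RAAG G)) : φ ∈ NN G := by
  classical
  obtain ⟨π, hπ⟩ := exists_perm φ
  let ρ := permIso hπ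
  have hρ : ∀ v, ρ v = π v := fun _ => rfl
  refine nn_left (ψ := ga ρ.symm) (ga_mem _) (tri_mem _ ∅ rfl _ ⟨?_, by simp⟩)
  intro t v h
  have hmm : mm (ga ρ.symm * φ) t v = mm φ (ρ t) v := by
    rw [mm_mul, Finset.sum_eq_single (ρ t)]
    · unfold mm; rw [ga_gen, ex_gen]; simp
    · intro s _ hs
      unfold mm
      rw [ga_gen, ex_gen, if_neg, zero_mul]
      rintro rfl; simp at hs
    · simp
  rw [hmm] at h
  have hl := supp_le hπ h
  intro x hx
  have h1 : ρ x ∈ star G (ρ t) := hl (show G.Adj (ρ v) (ρ x) from ρ.map_adj_iff.2 hx)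
  exact (ga_star ρ).1 h1

theorem AutS_normal [Fintype V] : (AutS G).Normal := by
  rw [← Subgroup.normalizer_eq_top_iff]
  exact eq_top_iff.2 (fun φ _ => all_mem φ)

end RG

end

/-- the subgroup `Aut*(A_Γ)` generated by all transvections and all partial
conjugations is a normal subgroup of `Aut(A_Γ)`. -/
theorem statement13 {V : Type*} [Fintype V] [DecidableEq V] (G : SimpleGraph V) :
    (Subgroup.closure {φ : MulAut (RAAG G) | IsTransvection φ ∨ IsPartialConj φ}).Normal := by
  exact RG.AutS_normal
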